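/- arXiv:2304.12839 — 2 statements merged into one kernel-verified Lean document; each statement's English description precedes it below -/
import Mathlib

section
/- Let p ∈ (−(n+1), −1] and let K ⊂ ℝ^{n+1} be a smooth, strictly convex body with the origin in its interior whose support function h satisfies 𝒦 = h^{1−p} on S^n. Then K is a ball centred at the origin (no centroid assumption required). -/
open MeasureTheory Metric
open scoped RealInnerProductSpace ENNReal

noncomputable section

abbrev E (n : ℕ) : Type := EuclideanSpace ℝ (Fin (n + 1))

/-- The Hessian of `H` as a continuous linear map. -/
def hess {n : ℕ} (H : E n → ℝ) (x : E n) : E n →L[ℝ] E n :=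
  fderiv ℝ (gradient H) x

/-- The rank-one projection `y ↦ ⟪x, y⟫ • x`. -/
def proj {n : ℕ} (x : E n) : E n →L[ℝ] E n :=
  ((innerSL ℝ) x).smulRight x

/-- `σ_n = det(∇̄²h + h ḡ)/det ḡ = 1/𝒦`, computed as the determinant of
`D²H + x ⊗ x` where `H` is the 1-homogeneous extension of the support function. -/
def sigmaDet {n : ℕ} (H : E n → ℝ) (x : E n) : ℝ :=
  LinearMap.det ((hess H x + proj x) : E n →L[ℝ] E n).toLinearMap

/-- Tangential (spherical) gradient of the restriction to the unit sphere. -/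
def tgrad {n : ℕ} (F : E n → ℝ) (x : E n) : E n :=
  gradient F x - ⟪gradient F x, x⟫ • x

/-- The convex body with support function `H`. -/
def body {n : ℕ} (H : E n → ℝ) : Set (E n) :=
  {y | ∀ x ∈ sphere (0 : E n) 1, ⟪y, x⟫ ≤ H x}

theorem volume_add_le_of_midpoint_of_isCompact {K L C : Set ℝ} (hK : IsCompact K)
    (hL : IsCompact L) (hKn : K.Nonempty) (hLn : L.Nonempty)
    (h : ∀ x ∈ K, ∀ y ∈ L, (x + y) / 2 ∈ C) :
    volume K + volume L ≤ 2 * volume C := by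
  have hj := hK.sSup_mem hKn
  have hk := hL.sInf_mem hLn
  set j := sSup K
  set k := sInf L
  have hpre : ∀ (D : Set ℝ) (a : ℝ), volume {x | (x + a) / 2 ∈ D} = 2 * volume D := by
    intro D a
    have h1 : {x : ℝ | (x + a) / 2 ∈ D} = (fun x => x + a) ⁻¹' ((fun x => (1 / 2 : ℝ) * x) ⁻¹' D) := by
      ext x
      simp only [Set.mem_ofPred_eq, Set.mem_preimage]
      rw [show (x + a) / 2 = 1 / 2 * (x + a) by ring]
    rw [h1, measure_preimage_add_right, Real.volume_preimage_mul_left (by norm_num)]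
    norm_num
  have h1 : volume K ≤ 2 * volume (C ∩ Set.Iic ((j + k) / 2)) := by
    rw [← hpre _ k]
    refine measure_mono fun x hx => ⟨h x hx k hk, ?_⟩
    have := le_csSup hK.bddAbove hx
    simp only [Set.mem_Iic]; linarith
  have h2 : volume L ≤ 2 * volume (C ∩ Set.Ici ((j + k) / 2)) := by
    rw [← hpre _ j]
    refine measure_mono fun x hx => ⟨by rw [add_comm]; exact h j hj x hx, ?_⟩
    have := csInf_le hL.bddBelow hx
    simp only [Set.mem_Ici]; linarith
  have h3 : volume (C ∩ Set.Ici ((j + k) / 2)) = volume (C \ Set.Iic ((j + k) / 2)) := by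
    rw [Set.sdiff_eq, Set.compl_Iic]
    exact measure_congr ((Filter.EventuallyEq.refl _ C).inter Ioi_ae_eq_Ici.symm)
  calc volume K + volume L ≤ 2 * (volume (C ∩ Set.Iic ((j + k) / 2))
        + volume (C \ Set.Iic ((j + k) / 2))) := by
        rw [mul_add, ← h3]; exact add_le_add h1 h2
    _ = 2 * volume C := by rw [measure_inter_add_sdiff _ measurableSet_Iic]

theorem volume_add_le_of_midpoint {A B C : Set ℝ} (hA : MeasurableSet A)
    (hB : MeasurableSet B) (hAn : A.Nonempty) (hBn : B.Nonempty)
    (h : ∀ x ∈ A, ∀ y ∈ B, (x + y) / 2 ∈ C) :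
    volume A + volume B ≤ 2 * volume C := by
  obtain ⟨a, ha⟩ := hAn
  obtain ⟨b, hb⟩ := hBn
  rw [hA.measure_eq_iSup_isCompact, hB.measure_eq_iSup_isCompact]
  simp only [iSup_and']
  refine ENNReal.biSup_add_biSup_le' ⟨∅, by simp⟩ ⟨∅, by simp⟩ ?_
  rintro K ⟨hK, hKc⟩ L ⟨hL, hLc⟩
  calc volume K + volume L ≤ volume (insert a K) + volume (insert b L) :=
        add_le_add (measure_mono (Set.subset_insert _ _)) (measure_mono (Set.subset_insert _ _))
    _ ≤ _ := volume_add_le_of_midpoint_of_isCompact (hKc.insert a) (hLc.insert b)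
        (Set.insert_nonempty _ _) (Set.insert_nonempty _ _) fun x hx y hy =>
          h x (Set.insert_subset ha hK hx) y (Set.insert_subset hb hL hy)

/-- One-dimensional Prékopa–Leindler inequality for functions with supremum one. -/
theorem lintegral_add_le_of_sup_eq_one {f g h : ℝ → ℝ} (hf : Measurable f) (hg : Measurable g)
    (hh : Measurable h) (hf0 : ∀ x, 0 ≤ f x) (hg0 : ∀ x, 0 ≤ g x) (hh0 : ∀ x, 0 ≤ h x)
    (hf1 : ∀ x, f x ≤ 1) (hg1 : ∀ x, g x ≤ 1)
    (hfs : ∀ t < 1, ∃ x, t < f x) (hgs : ∀ t < 1, ∃ x, t < g x)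
    (H : ∀ x y, f x * g y ≤ h ((x + y) / 2) ^ 2) :
    (∫⁻ x, ENNReal.ofReal (f x)) + ∫⁻ x, ENNReal.ofReal (g x)
      ≤ 2 * ∫⁻ x, ENNReal.ofReal (h x) := by
  have meas_anti : ∀ {u : ℝ → ℝ}, Measurable fun t : ℝ => volume {a : ℝ | t < u a} := by
    intro u
    refine Antitone.measurable fun s t hst => measure_mono fun x hx => lt_of_le_of_lt hst hx
  rw [lintegral_eq_lintegral_meas_lt volume (ae_of_all _ hf0) hf.aemeasurable,
    lintegral_eq_lintegral_meas_lt volume (ae_of_all _ hg0) hg.aemeasurable,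
    lintegral_eq_lintegral_meas_lt volume (ae_of_all _ hh0) hh.aemeasurable,
    ← lintegral_add_left meas_anti, ← lintegral_const_mul _ meas_anti]
  refine setLIntegral_mono (meas_anti.const_mul _) fun t ht => ?_
  rcases lt_or_ge t 1 with h1 | h1
  · refine volume_add_le_of_midpoint (measurableSet_lt measurable_const hf)
      (measurableSet_lt measurable_const hg) (hfs t h1) (hgs t h1) fun x hx y hy => ?_
    have ht0 : (0 : ℝ) < t := ht
    have hx' : t < f x := hx
    have hy' : t < g y := hy
    have : t ^ 2 < h ((x + y) / 2) ^ 2 :=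
      lt_of_lt_of_le (by nlinarith) (H x y)
    exact lt_of_pow_lt_pow_left₀ 2 (hh0 _) this
  · have e1 : {a | t < f a} = ∅ := by
      ext x; simpa using (hf1 x).trans h1
    have e2 : {a | t < g a} = ∅ := by
      ext x; simpa using (hg1 x).trans h1
    simp [e1, e2]

theorem ENNReal.mul_le_sq_of_add_le {a b c : ℝ≥0∞} (h : a + b ≤ 2 * c) : a * b ≤ c ^ 2 := by
  rcases eq_or_ne c ⊤ with rfl | hc
  · simp
  have hab : a + b ≠ ⊤ := ne_top_of_le_ne_top (ENNReal.mul_ne_top (by simp) hc) h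
  have ha : a ≠ ⊤ := fun h => hab (by simp [h])
  have hb : b ≠ ⊤ := fun h => hab (by simp [h])
  lift a to NNReal using ha
  lift b to NNReal using hb
  lift c to NNReal using hc
  norm_cast at h ⊢
  rw [← NNReal.coe_le_coe] at h ⊢
  push_cast at h ⊢
  nlinarith [sq_nonneg ((a : ℝ) - b), a.coe_nonneg, b.coe_nonneg, c.coe_nonneg]

theorem prekopa_leindler_real_of_bdd {f g h : ℝ → ℝ≥0∞} (hf : Measurable f) (hg : Measurable g)
    (hh : Measurable h) {M : ℝ≥0∞} (hM : M ≠ ⊤) (hfM : ∀ x, f x ≤ M) (hgM : ∀ x, g x ≤ M)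
    (H : ∀ x y, f x * g y ≤ h ((x + y) / 2) ^ 2) :
    (∫⁻ x, f x) * (∫⁻ x, g x) ≤ (∫⁻ x, h x) ^ 2 := by
  set a := ⨆ x, f x with ha
  set b := ⨆ x, g x with hb
  have hfa : ∀ x, f x ≤ a := le_iSup f
  have hgb : ∀ x, g x ≤ b := le_iSup g
  have haT : a ≠ ⊤ := ne_top_of_le_ne_top hM (iSup_le hfM)
  have hbT : b ≠ ⊤ := ne_top_of_le_ne_top hM (iSup_le hgM)
  rcases eq_or_ne a 0 with ha0 | ha0
  · have : ∀ x, f x = 0 := fun x => le_antisymm (ha0 ▸ hfa x) zero_le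
    simp [this]
  rcases eq_or_ne b 0 with hb0 | hb0
  · have : ∀ x, g x = 0 := fun x => le_antisymm (hb0 ▸ hgb x) zero_le
    simp [this]
  set c := (a * b) ^ (1 / 2 : ℝ) with hc
  have hc2 : c ^ 2 = a * b := by
    rw [hc, ← ENNReal.rpow_natCast, ← ENNReal.rpow_mul]; norm_num
  have habT : a * b ≠ ⊤ := ENNReal.mul_ne_top haT hbT
  have hcT : c ≠ ⊤ := ENNReal.rpow_ne_top_of_nonneg (by norm_num) habT
  have hc0 : c ≠ 0 := by
    intro h0
    rw [h0] at hc2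
    simp only [ne_eq, OfNat.ofNat_ne_zero, not_false_eq_true, zero_pow] at hc2
    exact (mul_ne_zero ha0 hb0) hc2.symm
  have key : ∀ {u : ℝ → ℝ≥0∞} {d : ℝ≥0∞}, Measurable u → d ≠ 0 → d ≠ ⊤ → (∀ x, u x ≤ d) →
      ∫⁻ x, u x = d * ∫⁻ x, ENNReal.ofReal (u x / d).toReal := by
    intro u d hu hd hdT hud
    rw [← lintegral_const_mul _ (hu.div_const d).ennreal_toReal.ennreal_ofReal]
    refine lintegral_congr fun x => ?_
    rw [ENNReal.ofReal_toReal (ENNReal.div_ne_top (ne_top_of_le_ne_top hdT (hud x)) hd),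
      ENNReal.mul_div_cancel hd hdT]
  have le_one : ∀ {u : ℝ → ℝ≥0∞} {d : ℝ≥0∞}, (∀ x, u x ≤ d) → ∀ x, (u x / d).toReal ≤ 1 := by
    intro u d hud x
    refine ENNReal.toReal_le_of_le_ofReal zero_le_one ?_
    rw [ENNReal.ofReal_one]
    exact ENNReal.div_le_of_le_mul (by simpa using hud x)
  have sup_one : ∀ {u : ℝ → ℝ≥0∞}, (⨆ x, u x) ≠ 0 → (⨆ x, u x) ≠ ⊤ →
      ∀ t < 1, ∃ x, t < (u x / ⨆ x, u x).toReal := by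
    intro u h0 hT t ht
    rcases lt_or_ge t 0 with ht0 | ht0
    · exact ⟨0, lt_of_lt_of_le ht0 ENNReal.toReal_nonneg⟩
    have : ENNReal.ofReal t * (⨆ x, u x) < ⨆ x, u x := by
      conv_rhs => rw [← one_mul (⨆ x, u x)]
      exact (ENNReal.mul_lt_mul_iff_left h0 hT).2 (by simpa using ht)
    obtain ⟨x, hx⟩ := lt_iSup_iff.1 this
    refine ⟨x, ?_⟩
    rw [← ENNReal.ofReal_lt_iff_lt_toReal ht0
      (ENNReal.div_ne_top (ne_top_of_le_ne_top hT (le_iSup u x)) h0)]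
    exact (ENNReal.lt_div_iff_mul_lt (Or.inl h0) (Or.inl hT)).2 hx
  have hm : ∀ x, min (h x) c ≤ c := fun x => min_le_right _ _
  have hh' : Measurable fun x => min (h x) c := hh.min measurable_const
  have main := lintegral_add_le_of_sup_eq_one (hf.div_const a).ennreal_toReal
    (hg.div_const b).ennreal_toReal (hh'.div_const c).ennreal_toReal
    (fun _ => ENNReal.toReal_nonneg) (fun _ => ENNReal.toReal_nonneg)
    (fun _ => ENNReal.toReal_nonneg) (le_one hfa) (le_one hgb) (sup_one ha0 haT) (sup_one hb0 hbT)
    (by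
      intro x y
      rw [← ENNReal.toReal_mul, ← ENNReal.toReal_pow]
      refine ENNReal.toReal_mono (ENNReal.pow_ne_top (ENNReal.div_ne_top
        (ne_top_of_le_ne_top hcT (hm _)) hc0)) ?_
      have h1 : f x * g y ≤ min (h ((x + y) / 2)) c ^ 2 := by
        rcases le_total (h ((x + y) / 2)) c with h2 | h2
        · rw [min_eq_left h2]; exact H x y
        · rw [min_eq_right h2, hc2]; exact mul_le_mul' (hfa x) (hgb y)
      calc f x / a * (g y / b) = f x * g y / c ^ 2 := by
            rw [hc2, div_eq_mul_inv, div_eq_mul_inv, div_eq_mul_inv,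
              ENNReal.mul_inv (Or.inl ha0) (Or.inl haT)]
            ring
        _ ≤ min (h ((x + y) / 2)) c ^ 2 / c ^ 2 := ENNReal.div_le_div_right h1 _
        _ = _ := by
            simp only [ENNReal.div_eq_inv_mul, mul_pow, ENNReal.inv_pow])
  have main' := ENNReal.mul_le_sq_of_add_le main
  calc (∫⁻ x, f x) * ∫⁻ x, g x = a * b * ((∫⁻ x, ENNReal.ofReal (f x / a).toReal) *
        ∫⁻ x, ENNReal.ofReal (g x / b).toReal) := by
        rw [key hf ha0 haT hfa, key hg hb0 hbT hgb]; ring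
    _ ≤ c ^ 2 * (∫⁻ x, ENNReal.ofReal (min (h x) c / c).toReal) ^ 2 := by
        rw [hc2]; gcongr
    _ = (∫⁻ x, min (h x) c) ^ 2 := by rw [key hh' hc0 hcT hm]; ring
    _ ≤ (∫⁻ x, h x) ^ 2 := by gcongr; exact min_le_left _ _

/-- The measure `μ` satisfies the Prékopa–Leindler inequality for midpoints. -/
def PrekopaLeindler {V : Type*} [AddCommGroup V] [Module ℝ V] [MeasurableSpace V]
    (μ : Measure V) : Prop :=
  ∀ f g h : V → ℝ≥0∞, Measurable f → Measurable g → Measurable h →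
    (∀ x y, f x * g y ≤ h ((1 / 2 : ℝ) • (x + y)) ^ 2) →
    (∫⁻ x, f x ∂μ) * (∫⁻ x, g x ∂μ) ≤ (∫⁻ x, h x ∂μ) ^ 2

theorem prekopaLeindler_real : PrekopaLeindler (volume : Measure ℝ) := by
  intro f g h hf hg hh H
  have trunc : ∀ {u : ℝ → ℝ≥0∞}, Measurable u →
      ∫⁻ x, u x = ⨆ k : ℕ, ∫⁻ x, min (u x) k := by
    intro u hu
    rw [← lintegral_iSup (fun k => hu.min measurable_const)
      (fun i j hij x => min_le_min_left _ (by exact_mod_cast hij))]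
    refine lintegral_congr fun x => ?_
    rw [← inf_iSup_eq, ENNReal.iSup_natCast, inf_top_eq]
  have mono : ∀ {u : ℝ → ℝ≥0∞}, Monotone fun k : ℕ => ∫⁻ x, min (u x) k := fun {u} i j hij =>
    lintegral_mono fun x => min_le_min_left _ (by exact_mod_cast hij)
  rw [trunc hf, trunc hg, ENNReal.iSup_mul]
  simp only [ENNReal.mul_iSup]
  refine iSup₂_le fun i j => (mul_le_mul' (mono (le_max_left i j))
    (mono (le_max_right i j))).trans ?_
  generalize max i j = k
  refine prekopa_leindler_real_of_bdd (hf.min measurable_const) (hg.min measurable_const) hh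
    (ENNReal.natCast_ne_top k) (fun x => min_le_right _ _) (fun x => min_le_right _ _)
    fun x y => ?_
  refine (mul_le_mul' (min_le_left _ _) (min_le_left _ _)).trans ((H x y).trans_eq ?_)
  rw [smul_eq_mul, one_div_mul_eq_div]

theorem PrekopaLeindler.prod {V W : Type*} [AddCommGroup V] [Module ℝ V] [MeasurableSpace V]
    [AddCommGroup W] [Module ℝ W] [MeasurableSpace W] {μ : Measure V} {ν : Measure W}
    [SFinite μ] [SFinite ν] (hμ : PrekopaLeindler μ) (hν : PrekopaLeindler ν) :
    PrekopaLeindler (μ.prod ν) := by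
  intro f g h hf hg hh H
  rw [lintegral_prod _ hf.aemeasurable, lintegral_prod _ hg.aemeasurable,
    lintegral_prod _ hh.aemeasurable]
  refine hμ _ _ _ hf.lintegral_prod_right' hg.lintegral_prod_right' hh.lintegral_prod_right'
    fun x x' => ?_
  exact hν _ _ _ (hf.comp measurable_prodMk_left) (hg.comp measurable_prodMk_left)
    (hh.comp measurable_prodMk_left) fun y y' => H (x, y) (x', y')

theorem PrekopaLeindler.of_measurableEquiv {V W : Type*} [AddCommGroup V] [Module ℝ V]
    [MeasurableSpace V] [AddCommGroup W] [Module ℝ W] [MeasurableSpace W] {μ : Measure V}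
    {ν : Measure W} (e : V ≃ᵐ W) (he : MeasurePreserving e μ ν)
    (hadd : ∀ x y, e ((1 / 2 : ℝ) • (x + y)) = (1 / 2 : ℝ) • (e x + e y))
    (hν : PrekopaLeindler ν) : PrekopaLeindler μ := by
  intro f g h hf hg hh H
  have key : ∀ u : V → ℝ≥0∞, ∫⁻ x, u x ∂μ = ∫⁻ y, u (e.symm y) ∂ν := fun u => by
    rw [← he.lintegral_comp_emb e.measurableEmbedding]; simp
  rw [key, key, key]
  refine hν _ _ _ (hf.comp e.symm.measurable) (hg.comp e.symm.measurable)
    (hh.comp e.symm.measurable) fun x y => ?_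
  have := H (e.symm x) (e.symm y)
  rwa [← e.symm_apply_apply ((1 / 2 : ℝ) • (e.symm x + e.symm y)), hadd, e.apply_symm_apply,
    e.apply_symm_apply] at this

theorem prekopaLeindler_pi (n : ℕ) : PrekopaLeindler (volume : Measure (Fin n → ℝ)) := by
  induction n with
  | zero =>
    intro f g h _ _ _ H
    have := H 0 0
    rw [volume_pi, Measure.pi_of_empty (fun _ : Fin 0 => (volume : Measure ℝ)) 0]
    simp only [lintegral_dirac]
    rwa [Subsingleton.elim ((1 / 2 : ℝ) • (0 + 0)) (0 : Fin 0 → ℝ)] at this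
  | succ n ih =>
    exact (prekopaLeindler_real.prod ih).of_measurableEquiv _
      (volume_preserving_piFinSuccAbove (fun _ => ℝ) 0) fun x y => rfl

theorem prekopaLeindler_euclideanSpace (n : ℕ) :
    PrekopaLeindler (volume : Measure (EuclideanSpace ℝ (Fin n))) :=
  (prekopaLeindler_pi n).of_measurableEquiv (MeasurableEquiv.toLp 2 (Fin n → ℝ)).symm
    (EuclideanSpace.volume_preserving_symm_measurableEquiv_toLp (Fin n)) fun _ _ => rfl

/-- `H` is the one-homogeneous support function of a smooth strictly convex body with the origin
in its interior. -/
structure IsSmoothSupport {n : ℕ} (H : E n → ℝ) : Prop where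
  hom : ∀ (t : ℝ) (x : E n), 0 < t → H (t • x) = t * H x
  smooth : ContDiffOn ℝ (⊤ : ℕ∞) H {(0 : E n)}ᶜ
  pos_sphere : ∀ x ∈ sphere (0 : E n) 1, 0 < H x
  convex_sphere : ∀ x ∈ sphere (0 : E n) 1, ∀ v : E n, ⟪v, x⟫ = 0 → v ≠ 0 →
    0 < ⟪(hess H x) v, v⟫

theorem inv_norm_smul_mem_sphere {V : Type*} [NormedAddCommGroup V] [NormedSpace ℝ V] {x : V}
    (hx : x ≠ 0) : ‖x‖⁻¹ • x ∈ sphere (0 : V) 1 := by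
  rw [mem_sphere_zero_iff_norm, norm_smul, norm_inv, norm_norm, inv_mul_cancel₀ (norm_ne_zero_iff.2 hx)]

/-- A degree-zero homogeneous function continuous off the origin is bounded off the origin. -/
theorem exists_bound_of_zero_homogeneous {n : ℕ} {F : Type*} [SeminormedAddCommGroup F]
    {G : E n → F} (hc : ContinuousOn G {(0 : E n)}ᶜ)
    (hG : ∀ (t : ℝ) (x : E n), 0 < t → x ≠ 0 → G (t • x) = G x) :
    ∃ C, 0 ≤ C ∧ ∀ x ≠ 0, ‖G x‖ ≤ C := by
  obtain ⟨C, hC⟩ := (isCompact_sphere (0 : E n) 1).exists_bound_of_continuousOn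
    (hc.mono fun x hx => ne_of_mem_sphere hx one_ne_zero)
  refine ⟨max C 0, le_max_right _ _, fun x hx => ?_⟩
  rw [← hG ‖x‖⁻¹ x (inv_pos.2 (norm_pos_iff.2 hx)) hx]
  exact (hC _ (inv_norm_smul_mem_sphere hx)).trans (le_max_left _ _)

namespace IsSmoothSupport

variable {n : ℕ} {H : E n → ℝ} (S : IsSmoothSupport H)
include S

theorem zero : H 0 = 0 := by
  have := S.hom 2 0 (by norm_num)
  rw [smul_zero] at this
  linarith

theorem hom' {t : ℝ} (ht : 0 ≤ t) (x : E n) : H (t • x) = t * H x := by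
  rcases ht.eq_or_lt with rfl | ht
  · simp [S.zero]
  · exact S.hom t x ht

theorem pos {x : E n} (hx : x ≠ 0) : 0 < H x := by
  have := S.pos_sphere _ (inv_norm_smul_mem_sphere hx)
  rw [S.hom _ _ (inv_pos.2 (norm_pos_iff.2 hx))] at this
  exact pos_of_mul_pos_right this (inv_nonneg.2 (norm_nonneg x))

theorem nonneg (x : E n) : 0 ≤ H x := by
  rcases eq_or_ne x 0 with rfl | hx
  · exact S.zero.ge
  · exact (S.pos hx).le

theorem hasGradientAt {x : E n} (hx : x ≠ 0) : HasGradientAt H (gradient H x) x :=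
  ((S.smooth.contDiffAt (isOpen_compl_singleton.mem_nhds hx)).differentiableAt
    (by simp)).hasGradientAt

theorem hasFDerivAt {x : E n} (hx : x ≠ 0) : HasFDerivAt H (innerSL ℝ (gradient H x)) x :=
  (S.hasGradientAt hx).hasFDerivAt

theorem contDiffOn_gradient : ContDiffOn ℝ (⊤ : ℕ∞) (gradient H) {(0 : E n)}ᶜ := by
  have h1 : ContDiffOn ℝ (⊤ : ℕ∞) (fderiv ℝ H) {(0 : E n)}ᶜ :=
    S.smooth.fderiv_of_isOpen isOpen_compl_singleton (by simp)
  exact (InnerProductSpace.toDual ℝ (E n)).symm.toContinuousLinearEquiv.contDiff.comp_contDiffOn h1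

theorem hasFDerivAt_gradient {x : E n} (hx : x ≠ 0) :
    HasFDerivAt (gradient H) (hess H x) x :=
  ((S.contDiffOn_gradient.contDiffAt (isOpen_compl_singleton.mem_nhds hx)).differentiableAt
    (by simp)).hasFDerivAt

theorem continuousOn_hess : ContinuousOn (hess H) {(0 : E n)}ᶜ :=
  S.contDiffOn_gradient.continuousOn_fderiv_of_isOpen isOpen_compl_singleton (by simp)

theorem continuousOn_gradient : ContinuousOn (gradient H) {(0 : E n)}ᶜ :=
  S.contDiffOn_gradient.continuousOn

theorem gradient_smul {t : ℝ} (ht : 0 < t) {x : E n} (hx : x ≠ 0) :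
    gradient H (t • x) = gradient H x := by
  have htx : t • x ≠ 0 := smul_ne_zero ht.ne' hx
  have h1 : HasFDerivAt (fun y => H (t • y)) (t • innerSL ℝ (gradient H (t • x))) x := by
    have h2 : HasFDerivAt (fun y : E n => t • y) (t • ContinuousLinearMap.id ℝ (E n)) x :=
      (hasFDerivAt_id x).const_smul t
    convert! (S.hasFDerivAt htx).comp x h2 using 1
    ext v
    simp
  have h3 : HasFDerivAt (fun y => H (t • y)) (t • innerSL ℝ (gradient H x)) x := by
    simp only [S.hom t _ ht]
    exact (S.hasFDerivAt hx).const_mul t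
  have h4 := smul_right_injective _ ht.ne' (h1.unique h3)
  exact (InnerProductSpace.toDual ℝ (E n)).injective h4

theorem hess_smul {t : ℝ} (ht : 0 < t) {x : E n} (hx : x ≠ 0) :
    t • hess H (t • x) = hess H x := by
  have htx : t • x ≠ 0 := smul_ne_zero ht.ne' hx
  have h2 : HasFDerivAt (fun y : E n => t • y) (t • ContinuousLinearMap.id ℝ (E n)) x :=
    (hasFDerivAt_id x).const_smul t
  have h1 := (S.hasFDerivAt_gradient htx).comp x h2
  have h3 : HasFDerivAt (gradient H ∘ fun y => t • y) (hess H x) x := by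
    refine (S.hasFDerivAt_gradient hx).congr_of_eventuallyEq ?_
    filter_upwards [isOpen_compl_singleton.mem_nhds hx] with y hy
    exact S.gradient_smul ht hy
  have h4 := h1.unique h3
  rw [← h4]
  ext v
  simp

theorem inner_gradient_self {x : E n} (hx : x ≠ 0) : ⟪gradient H x, x⟫ = H x := by
  have h2 : HasDerivAt (fun t : ℝ => t • x) ((1 : ℝ) • x) 1 := (hasDerivAt_id 1).smul_const x
  have h1 : HasDerivAt (fun t : ℝ => H (t • x)) (innerSL ℝ (gradient H ((1 : ℝ) • x)) ((1 : ℝ) • x)) 1 :=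
    (S.hasFDerivAt (by simpa using hx)).comp_hasDerivAt (1 : ℝ) h2
  have h3 : HasDerivAt (fun t : ℝ => H (t • x)) (1 * H x) 1 := by
    refine ((hasDerivAt_id (1 : ℝ)).mul_const (H x)).congr_of_eventuallyEq ?_
    filter_upwards [lt_mem_nhds (zero_lt_one' ℝ)] with t ht
    exact S.hom t x ht
  simpa using h1.unique h3

theorem hess_self {x : E n} (hx : x ≠ 0) : hess H x x = 0 := by
  have h2 : HasDerivAt (fun t : ℝ => t • x) ((1 : ℝ) • x) 1 := (hasDerivAt_id 1).smul_const x
  have h1 : HasDerivAt (fun t : ℝ => gradient H (t • x)) (hess H ((1 : ℝ) • x) ((1 : ℝ) • x)) 1 :=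
    (S.hasFDerivAt_gradient (by simpa using hx)).comp_hasDerivAt (1 : ℝ) h2
  have h3 : HasDerivAt (fun t : ℝ => gradient H (t • x)) 0 1 := by
    refine (hasDerivAt_const (1 : ℝ) (gradient H x)).congr_of_eventuallyEq ?_
    filter_upwards [lt_mem_nhds (zero_lt_one' ℝ)] with t ht
    exact S.gradient_smul ht hx
  simpa using h1.unique h3

theorem inner_hess {x : E n} (hx : x ≠ 0) (v : E n) : ⟪x, hess H x v⟫ = 0 := by
  have h1 : HasFDerivAt (fun y => ⟪gradient H y, y⟫) _ x :=
    (S.hasFDerivAt_gradient hx).inner ℝ (hasFDerivAt_id x)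
  have h3 : HasFDerivAt (fun y => ⟪gradient H y, y⟫) (innerSL ℝ (gradient H x)) x := by
    refine (S.hasFDerivAt hx).congr_of_eventuallyEq ?_
    filter_upwards [isOpen_compl_singleton.mem_nhds hx] with y hy
    exact S.inner_gradient_self hy
  have h4 := congrArg (fun L : E n →L[ℝ] ℝ => L v) (h1.unique h3)
  simp [fderivInnerCLM_apply] at h4
  rw [real_inner_comm]; exact h4

theorem continuousOn : ContinuousOn H {(0 : E n)}ᶜ := S.smooth.continuousOn

theorem exists_bounds : ∃ b B : ℝ, 0 < b ∧ 0 < B ∧ (∀ x, b * ‖x‖ ≤ H x) ∧ (∀ x, H x ≤ B * ‖x‖) ∧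
    (∀ x ≠ 0, ‖gradient H x‖ ≤ B) ∧ ∀ x ≠ 0, ‖x‖ * ‖hess H x‖ ≤ B := by
  obtain ⟨C1, hC1, h1⟩ := exists_bound_of_zero_homogeneous S.continuousOn_gradient
    fun t x ht hx => S.gradient_smul ht hx
  obtain ⟨C2, hC2, h2⟩ := exists_bound_of_zero_homogeneous
    (G := fun x => ‖x‖ • hess H x) (continuous_norm.continuousOn.smul S.continuousOn_hess)
    fun t x ht hx => by
      rw [← S.hess_smul ht hx, norm_smul, Real.norm_of_nonneg ht.le, smul_smul, mul_comm]
  have hc3 : ContinuousOn (fun x => ‖x‖ / H x) {(0 : E n)}ᶜ :=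
    continuous_norm.continuousOn.div S.continuousOn fun x hx => (S.pos hx).ne'
  obtain ⟨C3, hC3, h3⟩ := exists_bound_of_zero_homogeneous hc3 fun t x ht hx => by
      rw [S.hom t x ht, norm_smul, Real.norm_of_nonneg ht.le, mul_div_mul_left _ _ ht.ne']
  refine ⟨(C3 + 1)⁻¹, C1 + C2 + 1, by positivity, by positivity, fun x => ?_, fun x => ?_,
    fun x hx => (h1 x hx).trans (by linarith), fun x hx => ?_⟩
  · rcases eq_or_ne x 0 with rfl | hx
    · simp [S.zero]
    have := h3 x hx
    rw [Real.norm_of_nonneg (div_nonneg (norm_nonneg _) (S.nonneg _)), div_le_iff₀ (S.pos hx)] at this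
    rw [inv_mul_le_iff₀ (by positivity)]
    nlinarith [S.pos hx]
  · rcases eq_or_ne x 0 with rfl | hx
    · simp [S.zero]
    rw [← S.inner_gradient_self hx]
    refine (real_inner_le_norm _ _).trans (mul_le_mul_of_nonneg_right ?_ (norm_nonneg _))
    linarith [h1 x hx]
  · have := h2 x hx
    rw [norm_smul, norm_norm] at this
    linarith

theorem hess_nonneg_and_pos {x : E n} (hx : x ≠ 0) (v : E n) :
    0 ≤ ⟪hess H x v, v⟫ ∧ ((∀ k : ℝ, v ≠ k • x) → 0 < ⟪hess H x v, v⟫) := by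
  have ht : 0 < ‖x‖⁻¹ := inv_pos.2 (norm_pos_iff.2 hx)
  set u := ‖x‖⁻¹ • x with hu
  have hus : u ∈ sphere (0 : E n) 1 := inv_norm_smul_mem_sphere hx
  have hu0 : u ≠ 0 := smul_ne_zero ht.ne' hx
  have huu : ⟪u, u⟫ = 1 := by
    rw [real_inner_self_eq_norm_sq, mem_sphere_zero_iff_norm.1 hus, one_pow]
  set w := v - ⟪v, u⟫ • u with hw
  have hwu : ⟪w, u⟫ = 0 := by rw [hw, inner_sub_left, real_inner_smul_left, huu]; ring
  have hv : v = w + ⟪v, u⟫ • u := by rw [hw]; abel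
  have key : ⟪hess H x v, v⟫ = ‖x‖⁻¹ * ⟪hess H u w, w⟫ := by
    rw [← S.hess_smul ht hx]
    change ⟪‖x‖⁻¹ • hess H u v, v⟫ = _
    rw [real_inner_smul_left]
    congr 1
    conv_lhs => rw [hv]
    rw [map_add, map_smul, S.hess_self hu0, smul_zero, add_zero, inner_add_right,
      real_inner_smul_right, real_inner_comm u (hess H u w), S.inner_hess hu0, mul_zero, add_zero]
  rw [key]
  constructor
  · rcases eq_or_ne w 0 with h0 | h0
    · simp [h0]
    · exact (mul_pos ht (S.convex_sphere u hus w hwu h0)).le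
  · intro hk
    refine mul_pos ht (S.convex_sphere u hus w hwu fun h0 => hk (⟪v, u⟫ * ‖x‖⁻¹) ?_)
    rw [h0, zero_add, hu, smul_smul] at hv
    exact hv

theorem inner_gradient_lt {x x' : E n} (hx : x ≠ 0) (hk : ∀ k : ℝ, 0 ≤ k → x' ≠ k • x) :
    ⟪gradient H x, x'⟫ < H x' := by
  by_cases hneg : ∃ k : ℝ, k < 0 ∧ x' = k • x
  · obtain ⟨k, hk0, rfl⟩ := hneg
    rw [real_inner_smul_right, S.inner_gradient_self hx]
    exact (mul_neg_of_neg_of_pos hk0 (S.pos hx)).trans_le (S.nonneg _)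
  have hk' : ∀ k : ℝ, x' ≠ k • x := fun k h => by
    rcases lt_or_ge k 0 with h0 | h0
    · exact hneg ⟨k, h0, h⟩
    · exact hk k h0 h
  set v := x' - x with hv
  have hvk : ∀ k : ℝ, v ≠ k • x := fun k h => hk' (k + 1) (by
    rw [add_smul, one_smul, ← h, hv, sub_add_cancel])
  have hγ : ∀ t : ℝ, x + t • v ≠ 0 := fun t h => by
    rcases eq_or_ne t 0 with rfl | ht
    · exact hx (by simpa using h)
    · refine hvk (-t⁻¹) ?_
      rw [eq_neg_of_add_eq_zero_left h, smul_neg, neg_smul, neg_neg, smul_smul,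
        inv_mul_cancel₀ ht, one_smul]
  have hvγ : ∀ t k : ℝ, v ≠ k • (x + t • v) := fun t k h => by
    have h1 : (1 - k * t) • v = k • x := by
      rw [sub_smul, one_smul, mul_smul, sub_eq_iff_eq_add, ← smul_add]; exact h
    rcases eq_or_ne (1 - k * t) 0 with h0 | h0
    · rw [h0, zero_smul] at h1
      rcases smul_eq_zero.1 h1.symm with h2 | h2
      · rw [h2] at h0; norm_num at h0
      · exact hx h2
    · refine hvk ((1 - k * t)⁻¹ * k) ?_
      rw [mul_smul, ← h1, smul_smul, inv_mul_cancel₀ h0, one_smul]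
  have hd : ∀ t : ℝ, HasDerivAt (fun t : ℝ => x + t • v) v t := fun t => by
    simpa using ((hasDerivAt_id t).smul_const v).const_add x
  have h1 : ∀ t : ℝ, HasDerivAt (fun t : ℝ => H (x + t • v)) ⟪gradient H (x + t • v), v⟫ t :=
    fun t => by
      have := (S.hasFDerivAt (hγ t)).comp_hasDerivAt t (hd t)
      rwa [innerSL_apply_apply] at this
  have h2 : ∀ t : ℝ, HasDerivAt (fun t : ℝ => ⟪gradient H (x + t • v), v⟫)
      ⟪hess H (x + t • v) v, v⟫ t := fun t => by
    simpa using ((S.hasFDerivAt_gradient (hγ t)).comp_hasDerivAt t (hd t)).inner ℝ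
      (hasDerivAt_const t v)
  have hmono : StrictMono fun t : ℝ => ⟪gradient H (x + t • v), v⟫ :=
    strictMono_of_deriv_pos fun t => by
      rw [(h2 t).deriv]
      exact (S.hess_nonneg_and_pos (hγ t) v).2 (hvγ t)
  obtain ⟨ξ, hξ, hξ'⟩ := exists_hasDerivAt_eq_slope (fun t : ℝ => H (x + t • v)) _ zero_lt_one
    (fun t _ => (h1 t).continuousAt.continuousWithinAt) fun t _ => h1 t
  have h3 : ⟪gradient H (x + (0 : ℝ) • v), v⟫ < ⟪gradient H (x + ξ • v), v⟫ := hmono hξ.1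
  have h4 : x + v = x' := add_sub_cancel x x'
  rw [hξ', zero_smul, add_zero, one_smul, h4, sub_zero, div_one, hv, inner_sub_right,
    S.inner_gradient_self hx] at h3
  linarith

theorem inner_gradient_le {x : E n} (hx : x ≠ 0) (x' : E n) : ⟪gradient H x, x'⟫ ≤ H x' := by
  by_cases h : ∃ k : ℝ, 0 ≤ k ∧ x' = k • x
  · obtain ⟨k, hk, rfl⟩ := h
    rw [real_inner_smul_right, S.inner_gradient_self hx, S.hom' hk]
  · push Not at h
    exact (S.inner_gradient_lt hx h).le

theorem add_le (x y : E n) : H (x + y) ≤ H x + H y := by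
  rcases eq_or_ne (x + y) 0 with h | h
  · rw [h, S.zero]; exact add_nonneg (S.nonneg x) (S.nonneg y)
  · rw [← S.inner_gradient_self h, inner_add_right]
    exact add_le_add (S.inner_gradient_le h x) (S.inner_gradient_le h y)

theorem abs_sub_le {B : ℝ} (hB : ∀ x, H x ≤ B * ‖x‖) (x v : E n) :
    |H (x + v) - H x| ≤ B * ‖v‖ := by
  rw [abs_sub_le_iff]
  constructor
  · linarith [S.add_le x v, hB v]
  · have := S.add_le (x + v) (-v)
    have h2 := hB (-v)
    rw [add_neg_cancel_right] at this
    rw [norm_neg] at h2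
    linarith

theorem continuous : Continuous H := by
  obtain ⟨b, B, hb, hB, -, h2, -⟩ := S.exists_bounds
  refine (LipschitzWith.of_dist_le_mul (K := ⟨B, hB.le⟩) fun x y => ?_).continuous
  rw [Real.dist_eq, dist_eq_norm]
  have := S.abs_sub_le h2 y (x - y)
  rw [add_sub_cancel] at this
  exact this

end IsSmoothSupport

/-- The gradient of `H ^ 2 / 2`. -/
def halfSqGrad {n : ℕ} (H : E n → ℝ) (x : E n) : E n := H x • gradient H x

/-- The Hessian of `H ^ 2 / 2`. -/
def halfSqHess {n : ℕ} (H : E n → ℝ) (x : E n) : E n →L[ℝ] E n :=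
  H x • hess H x + (innerSL ℝ (gradient H x)).smulRight (gradient H x)

namespace IsSmoothSupport

variable {n : ℕ} {H : E n → ℝ} (S : IsSmoothSupport H)
include S

theorem hasFDerivAt_halfSqGrad {x : E n} (hx : x ≠ 0) :
    HasFDerivAt (halfSqGrad H) (halfSqHess H x) x :=
  (S.hasFDerivAt hx).smul (S.hasFDerivAt_gradient hx)

theorem halfSqGrad_zero : halfSqGrad H 0 = 0 := by rw [halfSqGrad, S.zero, zero_smul]

theorem inner_halfSqGrad_self (x : E n) : ⟪x, halfSqGrad H x⟫ = H x ^ 2 := by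
  rcases eq_or_ne x 0 with rfl | hx
  · simp [S.zero]
  · rw [halfSqGrad, real_inner_smul_right, real_inner_comm, S.inner_gradient_self hx, sq]

theorem inner_halfSqGrad_le (x' x : E n) : ⟪x', halfSqGrad H x⟫ ≤ H x' * H x := by
  rcases eq_or_ne x 0 with rfl | hx
  · simp [S.halfSqGrad_zero, S.zero]
  · rw [halfSqGrad, real_inner_smul_right, real_inner_comm, mul_comm (H x')]
    exact mul_le_mul_of_nonneg_left (S.inner_gradient_le hx x') (S.nonneg x)

theorem halfSqGrad_smul {t : ℝ} (ht : 0 < t) {x : E n} (hx : x ≠ 0) :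
    halfSqGrad H (t • x) = t • halfSqGrad H x := by
  rw [halfSqGrad, halfSqGrad, S.hom t x ht, S.gradient_smul ht hx, mul_smul]

theorem halfSqHess_smul {t : ℝ} (ht : 0 < t) {x : E n} (hx : x ≠ 0) :
    halfSqHess H (t • x) = halfSqHess H x := by
  rw [halfSqHess, halfSqHess, S.hom t x ht, S.gradient_smul ht hx, mul_comm, mul_smul,
    S.hess_smul ht hx]

theorem continuousOn_halfSqGrad : ContinuousOn (halfSqGrad H) {(0 : E n)}ᶜ :=
  S.continuousOn.smul S.continuousOn_gradient

theorem halfSqGrad_ne_zero {x : E n} (hx : x ≠ 0) : halfSqGrad H x ≠ 0 := fun h => by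
  have := S.inner_halfSqGrad_self x
  rw [h, inner_zero_right] at this
  exact (pow_pos (S.pos hx) 2).ne this

theorem injOn_halfSqGrad : Set.InjOn (halfSqGrad H) {(0 : E n)}ᶜ := by
  have key : ∀ {x y : E n}, x ≠ 0 → y ≠ 0 → halfSqGrad H x = halfSqGrad H y →
      (∀ k : ℝ, 0 ≤ k → y ≠ k • x) → H y < H x := by
    intro x y hx hy hxy hk
    have h1 := S.inner_gradient_lt hx hk
    have h2 := S.inner_halfSqGrad_self y
    rw [← hxy, halfSqGrad, real_inner_smul_right, real_inner_comm] at h2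
    nlinarith [S.pos hx, S.pos hy]
  have key2 : ∀ {x : E n} {k : ℝ}, x ≠ 0 → k • x ≠ 0 → 0 ≤ k →
      halfSqGrad H x = halfSqGrad H (k • x) → k • x = x := by
    intro x k hx hkx hk hxk
    have hk' : 0 < k := lt_of_le_of_ne hk fun h => hkx (by rw [← h, zero_smul])
    rw [S.halfSqGrad_smul hk' hx] at hxk
    have h1 : (k - 1) • halfSqGrad H x = 0 := by rw [sub_smul, one_smul, ← hxk, sub_self]
    rcases smul_eq_zero.1 h1 with h2 | h2
    · rw [sub_eq_zero.1 h2, one_smul]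
    · exact absurd h2 (S.halfSqGrad_ne_zero hx)
  intro x hx y hy hxy
  by_cases h : ∃ k : ℝ, 0 ≤ k ∧ y = k • x
  · obtain ⟨k, hk, rfl⟩ := h
    exact (key2 hx hy hk hxy).symm
  by_cases h' : ∃ k : ℝ, 0 ≤ k ∧ x = k • y
  · obtain ⟨k, hk, rfl⟩ := h'
    exact key2 hy hx hk hxy.symm
  push Not at h h'
  exact absurd (key hx hy hxy h) (key hy hx hxy.symm h').not_gt

theorem exists_halfSqGrad_eq {y : E n} (hy : y ≠ 0) : ∃ x ≠ 0, halfSqGrad H x = y := by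
  have hc : ContinuousOn (fun x => ⟪y, x⟫ / H x) (sphere (0 : E n) 1) :=
    (ContinuousOn.div (by fun_prop) S.continuousOn fun x hx => (S.pos hx).ne').mono
      fun x hx => ne_of_mem_sphere hx one_ne_zero
  obtain ⟨x, hxs, hmax⟩ := (isCompact_sphere (0 : E n) 1).exists_isMaxOn
    ⟨_, inv_norm_smul_mem_sphere hy⟩ hc
  have hx : x ≠ 0 := ne_of_mem_sphere hxs one_ne_zero
  set l := ⟪y, x⟫ / H x with hl
  have hle : ∀ z, ⟪y, z⟫ - l * H z ≤ 0 := by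
    intro z
    rcases eq_or_ne z 0 with rfl | hz
    · simp [S.zero]
    have h1 : ⟪y, ‖z‖⁻¹ • z⟫ / H (‖z‖⁻¹ • z) ≤ l := hmax (inv_norm_smul_mem_sphere hz)
    have hz' : 0 < ‖z‖⁻¹ := inv_pos.2 (norm_pos_iff.2 hz)
    rw [S.hom _ _ hz', real_inner_smul_right, mul_div_mul_left _ _ hz'.ne',
      div_le_iff₀ (S.pos hz)] at h1
    linarith
  have hl0 : 0 < l := by
    have h1 := hle y
    have h2 : 0 < ⟪y, y⟫ := real_inner_self_pos.2 hy
    have h3 := S.pos hy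
    by_contra h
    nlinarith
  have hloc : IsLocalMax (fun z => ⟪y, z⟫ - l * H z) x := Filter.Eventually.of_forall fun z => by
    have : ⟪y, x⟫ - l * H x = 0 := by rw [hl, div_mul_cancel₀ _ (S.pos hx).ne', sub_self]
    exact (hle z).trans_eq this.symm
  have hd : HasFDerivAt (fun z => ⟪y, z⟫ - l * H z) (innerSL ℝ y - l • innerSL ℝ (gradient H x)) x :=
    (innerSL ℝ y).hasFDerivAt.sub ((S.hasFDerivAt hx).const_mul l)
  have h0 := hloc.hasFDerivAt_eq_zero hd
  have hy' : y = l • gradient H x := by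
    rw [← map_smul, ← map_sub] at h0
    rw [← sub_eq_zero, ← inner_self_eq_zero (𝕜 := ℝ)]
    exact congrArg (fun L : E n →L[ℝ] ℝ => L (y - l • gradient H x)) h0
  have ht : 0 < l / H x := div_pos hl0 (S.pos hx)
  refine ⟨(l / H x) • x, smul_ne_zero ht.ne' hx, ?_⟩
  rw [S.halfSqGrad_smul ht hx, halfSqGrad, smul_smul, div_mul_cancel₀ _ (S.pos hx).ne', ← hy']

theorem image_halfSqGrad : halfSqGrad H '' {(0 : E n)}ᶜ = {(0 : E n)}ᶜ := by
  ext y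
  constructor
  · rintro ⟨x, hx, rfl⟩
    exact S.halfSqGrad_ne_zero hx
  · intro hy
    obtain ⟨x, hx, h⟩ := S.exists_halfSqGrad_eq hy
    exact ⟨x, hx, h⟩

theorem det_halfSqHess_of_mem_sphere {x : E n} (hx : x ∈ sphere (0 : E n) 1) :
    (halfSqHess H x).det = H x ^ (n + 2) * sigmaDet H x := by
  have hx0 : x ≠ 0 := ne_of_mem_sphere hx one_ne_zero
  have hxx : ⟪x, x⟫ = 1 := by
    rw [real_inner_self_eq_norm_sq, mem_sphere_zero_iff_norm.1 hx, one_pow]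
  have hH : H x ≠ 0 := (S.pos hx0).ne'
  set g := gradient H x with hg
  have hgx : ⟪g, x⟫ = H x := S.inner_gradient_self hx0
  have hfac : (halfSqHess H x).toLinearMap =
      LinearMap.transvection (innerSL ℝ x).toLinearMap (g - x) ∘ₗ
        (hess H x + proj x).toLinearMap ∘ₗ
          (H x • LinearMap.transvection
            (innerSL ℝ ((H x)⁻¹ • (g - H x • x))).toLinearMap x) := by
    ext1 v
    have hw : ⟪(H x)⁻¹ • (g - H x • x), v⟫ = (H x)⁻¹ * ⟪g, v⟫ - ⟪x, v⟫ := by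
      rw [real_inner_smul_left, inner_sub_left, real_inner_smul_left, mul_sub,
        inv_mul_cancel_left₀ hH]
    have hu : (hess H x + proj x) (H x • (v + ((H x)⁻¹ * ⟪g, v⟫ - ⟪x, v⟫) • x)) =
        H x • hess H x v + ⟪g, v⟫ • x := by
      have e : ⟪x, H x • (v + ((H x)⁻¹ * ⟪g, v⟫ - ⟪x, v⟫) • x)⟫ = ⟪g, v⟫ := by
        rw [real_inner_smul_right, inner_add_right, real_inner_smul_right, hxx]
        field_simp
        ring
      have e' : proj x (H x • (v + ((H x)⁻¹ * ⟪g, v⟫ - ⟪x, v⟫) • x)) = ⟪g, v⟫ • x := by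
        conv_rhs => rw [← e]
        rfl
      rw [add_apply, e', map_smul, map_add, map_smul, S.hess_self hx0, smul_zero, add_zero]
    have hi : ⟪x, H x • hess H x v + ⟪g, v⟫ • x⟫ = ⟪g, v⟫ := by
      rw [inner_add_right, real_inner_smul_right, real_inner_smul_right, S.inner_hess hx0, hxx]
      ring
    change H x • hess H x v + ⟪g, v⟫ • g =
      (hess H x + proj x) (H x • (v + ⟪(H x)⁻¹ • (g - H x • x), v⟫ • x)) +
        ⟪x, (hess H x + proj x) (H x • (v + ⟪(H x)⁻¹ • (g - H x • x), v⟫ • x))⟫ • (g - x)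
    rw [hw, hu, hi, smul_sub]
    abel
  have hdet : (halfSqHess H x).det = LinearMap.det (halfSqHess H x).toLinearMap := rfl
  rw [hdet, hfac, LinearMap.det_comp, LinearMap.det_comp, LinearMap.det_smul,
    LinearMap.transvection.det, LinearMap.transvection.det, sigmaDet, finrank_euclideanSpace_fin]
  have e1 : (innerSL ℝ x).toLinearMap (g - x) = H x - 1 := by
    change ⟪x, g - x⟫ = _
    rw [inner_sub_right, hxx, real_inner_comm, hgx]
  have e2 : (innerSL ℝ ((H x)⁻¹ • (g - H x • x))).toLinearMap x = 0 := by
    change ⟪(H x)⁻¹ • (g - H x • x), x⟫ = 0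
    rw [real_inner_smul_left, inner_sub_left, hgx, real_inner_smul_left, hxx]
    ring
  rw [e1, e2]
  ring

theorem det_halfSqHess {p : ℝ}
    (hσ : ∀ x ∈ sphere (0 : E n) 1, (sigmaDet H x)⁻¹ = H x ^ (1 - p)) {x : E n} (hx : x ≠ 0) :
    (halfSqHess H x).det = (H x / ‖x‖) ^ ((n : ℝ) + 1 + p) := by
  have ht : 0 < ‖x‖⁻¹ := inv_pos.2 (norm_pos_iff.2 hx)
  have hu := inv_norm_smul_mem_sphere hx
  have h0 := S.pos_sphere _ hu
  have hs : sigmaDet H (‖x‖⁻¹ • x) = H (‖x‖⁻¹ • x) ^ (p - 1) := by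
    rw [← inv_inv (sigmaDet H _), hσ _ hu, ← Real.rpow_neg h0.le, neg_sub]
  rw [← S.halfSqHess_smul ht hx, S.det_halfSqHess_of_mem_sphere hu, hs, ← Real.rpow_natCast,
    ← Real.rpow_add h0, S.hom _ _ ht, div_eq_inv_mul]
  congr 1
  push_cast
  ring

end IsSmoothSupport

/-- Continuity off the origin together with at most exponential growth. -/
def ExpGrowth {n : ℕ} (f : E n → ℝ) : Prop :=
  ContinuousOn f {(0 : E n)}ᶜ ∧ ∃ C, 0 ≤ C ∧ ∀ x ≠ 0, |f x| ≤ C * Real.exp (C * ‖x‖)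

namespace ExpGrowth

variable {n : ℕ} {f g : E n → ℝ}

theorem of_le {C D : ℝ} (hc : ContinuousOn f {(0 : E n)}ᶜ)
    (h : ∀ x ≠ 0, |f x| ≤ C * Real.exp (D * ‖x‖)) : ExpGrowth f := by
  refine ⟨hc, max (max C D) 0, le_max_right _ _, fun x hx => (h x hx).trans ?_⟩
  have h1 : C ≤ max (max C D) 0 := (le_max_left _ _).trans (le_max_left _ _)
  have h2 : D ≤ max (max C D) 0 := (le_max_right _ _).trans (le_max_left _ _)
  have h3 : 0 ≤ max (max C D) 0 := le_max_right _ _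
  gcongr

theorem of_bounded {C : ℝ} (hc : ContinuousOn f {(0 : E n)}ᶜ) (h : ∀ x ≠ 0, |f x| ≤ C) :
    ExpGrowth f :=
  of_le (C := C) (D := 0) hc fun x hx => by simpa using h x hx

theorem const (c : ℝ) : ExpGrowth fun _ : E n => c :=
  of_bounded continuousOn_const fun _ _ => le_rfl

theorem add (hf : ExpGrowth f) (hg : ExpGrowth g) : ExpGrowth fun x => f x + g x := by
  obtain ⟨hf, C, hC, h⟩ := hf
  obtain ⟨hg, D, hD, h'⟩ := hg
  refine of_le (C := C + D) (D := max C D) (hf.add hg) fun x hx => ?_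
  calc |f x + g x| ≤ |f x| + |g x| := abs_add_le _ _
    _ ≤ C * Real.exp (max C D * ‖x‖) + D * Real.exp (max C D * ‖x‖) :=
        add_le_add ((h x hx).trans (by gcongr; exact le_max_left _ _))
          ((h' x hx).trans (by gcongr; exact le_max_right _ _))
    _ = _ := by ring

theorem mul (hf : ExpGrowth f) (hg : ExpGrowth g) : ExpGrowth fun x => f x * g x := by
  obtain ⟨hf, C, hC, h⟩ := hf
  obtain ⟨hg, D, hD, h'⟩ := hg
  refine of_le (C := C * D) (D := C + D) (hf.mul hg) fun x hx => ?_
  calc |f x * g x| = |f x| * |g x| := abs_mul _ _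
    _ ≤ (C * Real.exp (C * ‖x‖)) * (D * Real.exp (D * ‖x‖)) :=
        mul_le_mul (h x hx) (h' x hx) (abs_nonneg _) (by positivity)
    _ = _ := by rw [add_mul, Real.exp_add]; ring

theorem neg (hf : ExpGrowth f) : ExpGrowth fun x => -f x := by
  simpa using (const (-1)).mul hf

theorem sub (hf : ExpGrowth f) (hg : ExpGrowth g) : ExpGrowth fun x => f x - g x := by
  simpa only [sub_eq_add_neg] using hf.add hg.neg

theorem const_mul (hf : ExpGrowth f) (c : ℝ) : ExpGrowth fun x => c * f x := (const c).mul hf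

theorem pow (hf : ExpGrowth f) (k : ℕ) : ExpGrowth fun x => f x ^ k := by
  induction k with
  | zero => simpa using const (n := n) 1
  | succ k ih => simpa only [pow_succ] using ih.mul hf

theorem exp {C : ℝ} (hc : ContinuousOn f {(0 : E n)}ᶜ) (h : ∀ x ≠ 0, f x ≤ C * (1 + ‖x‖)) :
    ExpGrowth fun x => Real.exp (f x) :=
  of_le (C := Real.exp C) (D := C) hc.rexp fun x hx => by
    rw [abs_of_pos (Real.exp_pos _), ← Real.exp_add]
    exact Real.exp_le_exp.2 ((h x hx).trans_eq (by ring))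

theorem aestronglyMeasurable (hf : ExpGrowth f) : AEStronglyMeasurable f volume := by
  have := hf.1.aestronglyMeasurable (μ := volume) isOpen_compl_singleton.measurableSet
  rwa [MeasureTheory.restrict_compl_singleton] at this

theorem integrable_mul_exp (hf : ExpGrowth f) {b : ℝ} (hb : 0 < b) :
    Integrable (fun x => f x * Real.exp (-b * ‖x‖ ^ 2)) volume := by
  obtain ⟨C, hC, h⟩ := hf.2
  have h1 : Integrable (fun x : E n => Real.exp (-(b / 2) * ‖x‖ ^ 2)) volume := by
    have := (GaussianFourier.integrable_cexp_neg_mul_sq_norm_add (V := E n) (b := (b / 2 : ℝ))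
      (by simpa using hb) 0 0).norm
    refine this.congr (Filter.Eventually.of_forall fun x => ?_)
    simp only [Complex.norm_exp]
    norm_cast
    simp
  refine (h1.const_mul (C * Real.exp (C ^ 2 / (2 * b)))).mono'
    (hf.aestronglyMeasurable.mul (by fun_prop)) ?_
  filter_upwards [Measure.ae_ne volume (0 : E n)] with x hx
  rw [norm_mul, Real.norm_eq_abs, Real.norm_of_nonneg (Real.exp_pos _).le, mul_assoc, ← Real.exp_add]
  refine (mul_le_mul_of_nonneg_right (h x hx) (Real.exp_pos _).le).trans ?_
  rw [mul_assoc, ← Real.exp_add]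
  refine mul_le_mul_of_nonneg_left (Real.exp_le_exp.2 ?_) hC
  have : C ^ 2 / (2 * b) + -(b / 2) * ‖x‖ ^ 2 - (C * ‖x‖ + -b * ‖x‖ ^ 2) =
      (C - b * ‖x‖) ^ 2 / (2 * b) := by field_simp; ring
  have h2 : 0 ≤ (C - b * ‖x‖) ^ 2 / (2 * b) := by positivity
  linarith

end ExpGrowth

theorem sum_inner_single_mul_inner_single (x y : E n) :
    ∑ l, ⟪x, EuclideanSpace.single l (1 : ℝ)⟫ * ⟪y, EuclideanSpace.single l (1 : ℝ)⟫ = ⟪x, y⟫ := by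
  simp [PiLp.inner_apply, mul_comm]

/-- The density `exp (-H² / 2) (H / ‖x‖) ^ a`. -/
def weight {n : ℕ} (H : E n → ℝ) (a : ℝ) (x : E n) : ℝ :=
  Real.exp (-(H x ^ 2 / 2)) * (H x / ‖x‖) ^ a

/-- The measure with density `weight H a`. -/
def weightMeasure {n : ℕ} (H : E n → ℝ) (a : ℝ) : Measure (E n) :=
  volume.withDensity fun x => ENNReal.ofReal (weight H a x)

theorem ae_ne_zero_weightMeasure {n : ℕ} (H : E n → ℝ) (a : ℝ) :
    ∀ᵐ x ∂weightMeasure H a, x ≠ 0 :=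
  (withDensity_absolutelyContinuous _ _).ae_le (Measure.ae_ne volume 0)

namespace IsSmoothSupport

variable {n : ℕ} {H : E n → ℝ} (S : IsSmoothSupport H)
include S

theorem div_norm_nonneg (x : E n) : 0 ≤ H x / ‖x‖ := div_nonneg (S.nonneg x) (norm_nonneg x)

theorem div_norm_pos {x : E n} (hx : x ≠ 0) : 0 < H x / ‖x‖ :=
  div_pos (S.pos hx) (norm_pos_iff.2 hx)

theorem weight_nonneg (a : ℝ) (x : E n) : 0 ≤ weight H a x :=
  mul_nonneg (Real.exp_pos _).le (Real.rpow_nonneg (S.div_norm_nonneg x) a)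

theorem measurable_weight (a : ℝ) : Measurable (weight H a) :=
  ((S.continuous.measurable.pow_const 2).div_const 2).neg.exp.mul
    ((S.continuous.measurable.div measurable_norm).pow_const a)

theorem expGrowth : ExpGrowth H := by
  obtain ⟨b, B, hb, hB, -, h2, -⟩ := S.exists_bounds
  refine .of_le (C := B) (D := 1) S.continuousOn fun x _ => ?_
  rw [abs_of_nonneg (S.nonneg x)]
  refine (h2 x).trans (mul_le_mul_of_nonneg_left ?_ hB.le)
  linarith [Real.add_one_le_exp (1 * ‖x‖)]

theorem expGrowth_inner_gradient (e : E n) : ExpGrowth fun x => ⟪gradient H x, e⟫ := by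
  obtain ⟨b, B, hb, hB, -, -, h3, -⟩ := S.exists_bounds
  refine .of_bounded (C := B * ‖e‖) (S.continuousOn_gradient.inner continuousOn_const) fun x hx => ?_
  exact (abs_real_inner_le_norm _ _).trans (by gcongr; exact h3 x hx)

theorem expGrowth_div_norm : ExpGrowth fun x => H x / ‖x‖ := by
  obtain ⟨b, B, hb, hB, -, h2, -⟩ := S.exists_bounds
  refine .of_bounded (C := B) (S.continuousOn.div (by fun_prop) fun x hx => norm_ne_zero_iff.2 hx)
    fun x hx => ?_
  rw [abs_of_nonneg (S.div_norm_nonneg x), div_le_iff₀ (norm_pos_iff.2 hx)]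
  exact h2 x

theorem continuousOn_div_norm_rpow (a : ℝ) :
    ContinuousOn (fun x => (H x / ‖x‖) ^ a) {(0 : E n)}ᶜ :=
  S.expGrowth_div_norm.1.rpow_const fun _ hx => Or.inl (S.div_norm_pos hx).ne'

theorem expGrowth_div_norm_rpow (a : ℝ) : ExpGrowth fun x => (H x / ‖x‖) ^ a := by
  obtain ⟨C, -, h⟩ := exists_bound_of_zero_homogeneous (S.continuousOn_div_norm_rpow a)
    fun t x ht hx => by
      rw [S.hom t x ht, norm_smul, Real.norm_of_nonneg ht.le, mul_div_mul_left _ _ ht.ne']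
  exact .of_bounded (S.continuousOn_div_norm_rpow a) h

theorem integrable_mul_exp {f : E n → ℝ} (hf : ExpGrowth f) {t : ℝ} (ht : 0 < t) :
    Integrable (fun x => f x * Real.exp (-(t * H x ^ 2))) volume := by
  obtain ⟨b, B, hb, hB, h1, -⟩ := S.exists_bounds
  have := hf.integrable_mul_exp (b := t * b ^ 2) (by positivity)
  refine this.mono (hf.aestronglyMeasurable.mul
    ((S.continuous.pow 2).const_mul t).neg.rexp.aestronglyMeasurable)
    (Filter.Eventually.of_forall fun x => ?_)
  rw [norm_mul, norm_mul]
  refine mul_le_mul_of_nonneg_left ?_ (norm_nonneg _)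
  rw [Real.norm_of_nonneg (Real.exp_pos _).le, Real.norm_of_nonneg (Real.exp_pos _).le,
    Real.exp_le_exp]
  have h2 : (b * ‖x‖) ^ 2 ≤ H x ^ 2 := pow_le_pow_left₀ (by positivity) (h1 x) 2
  nlinarith

theorem integrable_weight_mul {f : E n → ℝ} (hf : ExpGrowth f) (a : ℝ) :
    Integrable (fun x => weight H a x * f x) volume := by
  refine (S.integrable_mul_exp (hf.mul (S.expGrowth_div_norm_rpow a)) one_half_pos).congr
    (Filter.Eventually.of_forall fun x => ?_)
  simp only [weight]
  rw [show H x ^ 2 / 2 = 1 / 2 * H x ^ 2 by ring]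
  ring

theorem integral_weightMeasure (f : E n → ℝ) (a : ℝ) :
    ∫ x, f x ∂weightMeasure H a = ∫ x, weight H a x * f x := by
  rw [weightMeasure, integral_withDensity_eq_integral_toReal_smul
    (S.measurable_weight a).ennreal_ofReal (Filter.Eventually.of_forall fun x => ENNReal.ofReal_lt_top)]
  simp only [ENNReal.toReal_ofReal (S.weight_nonneg a _), smul_eq_mul]

theorem integrable {f : E n → ℝ} (hf : ExpGrowth f) (a : ℝ) : Integrable f (weightMeasure H a) := by
  rw [weightMeasure, integrable_withDensity_iff_integrable_smul'
    (S.measurable_weight a).ennreal_ofReal (Filter.Eventually.of_forall fun x => ENNReal.ofReal_lt_top)]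
  simpa only [ENNReal.toReal_ofReal (S.weight_nonneg a _), smul_eq_mul] using
    S.integrable_weight_mul hf a

theorem integral_add {f g : E n → ℝ} (hf : ExpGrowth f) (hg : ExpGrowth g) (a : ℝ) :
    ∫ x, (f x + g x) ∂weightMeasure H a =
      ∫ x, f x ∂weightMeasure H a + ∫ x, g x ∂weightMeasure H a :=
  MeasureTheory.integral_add (S.integrable hf a) (S.integrable hg a)

theorem integral_sub {f g : E n → ℝ} (hf : ExpGrowth f) (hg : ExpGrowth g) (a : ℝ) :
    ∫ x, (f x - g x) ∂weightMeasure H a =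
      ∫ x, f x ∂weightMeasure H a - ∫ x, g x ∂weightMeasure H a :=
  MeasureTheory.integral_sub (S.integrable hf a) (S.integrable hg a)

theorem isFiniteMeasure (a : ℝ) : IsFiniteMeasure (weightMeasure H a) := by
  have := S.integrable (.const 1) a
  rwa [integrable_const_iff_isFiniteMeasure one_ne_zero] at this

theorem ae_volume {a : ℝ} {P : E n → Prop} (h : ∀ᵐ x ∂weightMeasure H a, P x) :
    ∀ᵐ x, P x := by
  rw [weightMeasure, ae_withDensity_iff (S.measurable_weight a).ennreal_ofReal] at h
  filter_upwards [h, Measure.ae_ne volume (0 : E n)] with x hx hx0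
  refine hx ?_
  rw [Ne, ENNReal.ofReal_eq_zero, not_le]
  exact mul_pos (Real.exp_pos _) (Real.rpow_pos_of_pos (S.div_norm_pos hx0) a)

theorem integral_pos {f : E n → ℝ} (hf : ExpGrowth f) (hpos : ∀ x ≠ 0, 0 < f x) (a : ℝ) :
    0 < ∫ x, f x ∂weightMeasure H a := by
  have h0 : 0 ≤ᵐ[weightMeasure H a] f := by
    filter_upwards [ae_ne_zero_weightMeasure H a] with x hx using (hpos x hx).le
  refine (integral_nonneg_of_ae h0).lt_of_ne fun h => ?_
  have h1 := (integral_eq_zero_iff_of_nonneg_ae h0 (S.integrable hf a)).1 h.symm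
  have h2 := S.ae_volume h1
  have h3 : ∀ᵐ x : E n, False := by
    filter_upwards [h2, Measure.ae_ne volume (0 : E n)] with x hx hx0
    exact (hpos x hx0).ne' hx
  rw [Filter.eventually_false_iff_eq_bot, ae_eq_bot] at h3
  exact NeZero.ne _ h3

theorem continuous_halfSqGrad : Continuous (halfSqGrad H) := by
  obtain ⟨b, B, hb, hB, -, h2, h3, -⟩ := S.exists_bounds
  rw [continuous_iff_continuousAt]
  intro x
  rcases eq_or_ne x 0 with rfl | hx
  · rw [ContinuousAt, S.halfSqGrad_zero]
    refine squeeze_zero_norm (a := fun x => H x * B) (fun x => ?_) ?_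
    · rcases eq_or_ne x 0 with rfl | hx
      · simp [S.halfSqGrad_zero, S.zero]
      · rw [halfSqGrad, norm_smul, Real.norm_of_nonneg (S.nonneg x)]
        exact mul_le_mul_of_nonneg_left (h3 x hx) (S.nonneg x)
    · have := (S.continuous.mul_const B).tendsto 0
      rwa [S.zero, zero_mul] at this
  · exact S.continuousOn_halfSqGrad.continuousAt (isOpen_compl_singleton.mem_nhds hx)

theorem bijective_halfSqGrad : Function.Bijective (halfSqGrad H) := by
  constructor
  · intro x y hxy
    rcases eq_or_ne x 0 with rfl | hx
    · by_contra hy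
      rw [S.halfSqGrad_zero] at hxy
      exact S.halfSqGrad_ne_zero (Ne.symm hy) hxy.symm
    · rcases eq_or_ne y 0 with rfl | hy
      · rw [S.halfSqGrad_zero] at hxy
        exact absurd hxy (S.halfSqGrad_ne_zero hx)
      · exact S.injOn_halfSqGrad hx hy hxy
  · intro y
    rcases eq_or_ne y 0 with rfl | hy
    · exact ⟨0, S.halfSqGrad_zero⟩
    · obtain ⟨x, -, h⟩ := S.exists_halfSqGrad_eq hy
      exact ⟨x, h⟩

theorem exists_measurable_inverse : ∃ R : E n → E n, Measurable R ∧
    (∀ x, R (halfSqGrad H x) = x) ∧ ∀ y, halfSqGrad H (R y) = y := by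
  let T := Equiv.ofBijective (halfSqGrad H) S.bijective_halfSqGrad
  refine ⟨T.symm, fun s hs => ?_, T.symm_apply_apply, T.apply_symm_apply⟩
  rw [← T.image_eq_preimage_symm]
  exact (S.continuous_halfSqGrad.measurableEmbedding
    S.bijective_halfSqGrad.1).measurableSet_image.2 hs

theorem lintegral_comp_halfSqGrad {a : ℝ}
    (hdet : ∀ x ≠ 0, (halfSqHess H x).det = (H x / ‖x‖) ^ a) {F : E n → ℝ≥0∞} {φ : E n → ℝ}
    (hF : ∀ x, F (halfSqGrad H x) = ENNReal.ofReal (Real.exp (-(H x ^ 2 / 2) + φ x)))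
    (hφ : ExpGrowth fun x => Real.exp (φ x)) :
    ∫⁻ y, F y = ENNReal.ofReal (∫ x, Real.exp (φ x) ∂weightMeasure H a) := by
  rw [S.integral_weightMeasure, ofReal_integral_eq_lintegral_ofReal (S.integrable_weight_mul hφ a)
    (Filter.Eventually.of_forall fun x => mul_nonneg (S.weight_nonneg a x) (Real.exp_pos _).le),
    ← MeasureTheory.restrict_compl_singleton (μ := volume) (0 : E n)]
  conv_lhs => rw [← S.image_halfSqGrad]
  rw [lintegral_image_eq_lintegral_abs_det_fderiv_mul volume
    isOpen_compl_singleton.measurableSet (fun x hx => (S.hasFDerivAt_halfSqGrad hx).hasFDerivWithinAt)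
    S.injOn_halfSqGrad]
  refine setLIntegral_congr_fun isOpen_compl_singleton.measurableSet fun x hx => ?_
  have h0 : 0 ≤ (H x / ‖x‖) ^ a := Real.rpow_nonneg (S.div_norm_nonneg x) a
  simp only [hF]
  rw [hdet x hx, abs_of_nonneg h0, ← ENNReal.ofReal_mul h0, Real.exp_add, weight]
  congr 1
  ring

end IsSmoothSupport

/-- A perturbed second difference of `H ^ 2 / 2`. -/
def secondDiff {n : ℕ} (H : E n → ℝ) (e : E n) (c s : ℝ) (x : E n) : ℝ :=
  -(H x ^ 2 / 2) + (H (x + s • e) - s * c) ^ 2 / 4 + (H (x - s • e) + s * c) ^ 2 / 4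

namespace IsSmoothSupport

variable {n : ℕ} {H : E n → ℝ} (S : IsSmoothSupport H)
include S

theorem integral_exp_mul_integral_exp_le {a : ℝ}
    (hdet : ∀ x ≠ 0, (halfSqHess H x).det = (H x / ‖x‖) ^ a) (e : E n) (c s : ℝ)
    (h1 : ExpGrowth fun x => Real.exp (s * (H x * (⟪gradient H x, e⟫ - c))))
    (h2 : ExpGrowth fun x => Real.exp (-(s * (H x * (⟪gradient H x, e⟫ - c)))))
    (h3 : ExpGrowth fun x => Real.exp (secondDiff H e c s x)) :
    (∫ x, Real.exp (s * (H x * (⟪gradient H x, e⟫ - c))) ∂weightMeasure H a) *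
      (∫ x, Real.exp (-(s * (H x * (⟪gradient H x, e⟫ - c)))) ∂weightMeasure H a) ≤
      (∫ x, Real.exp (secondDiff H e c s x) ∂weightMeasure H a) ^ 2 := by
  obtain ⟨R, hR, hRT, hTR⟩ := S.exists_measurable_inverse
  have hH : Measurable H := S.continuous.measurable
  have hψ : ∀ x, H x * (⟪gradient H x, e⟫ - c) = ⟪halfSqGrad H x, e⟫ - c * H x := fun x => by
    rw [halfSqGrad, real_inner_smul_left]; ring
  have hi : Measurable fun y : E n => ⟪y, e⟫ := measurable_id.inner measurable_const
  have key := prekopaLeindler_euclideanSpace (n + 1)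
    (fun y => ENNReal.ofReal (Real.exp (-(H (R y) ^ 2 / 2) + s * (⟪y, e⟫ - c * H (R y)))))
    (fun y => ENNReal.ofReal (Real.exp (-(H (R y) ^ 2 / 2) + -(s * (⟪y, e⟫ - c * H (R y))))))
    (fun y => ENNReal.ofReal (Real.exp (-⟪R y, y⟫ + (H (R y + s • e) - s * c) ^ 2 / 4 +
      (H (R y - s • e) + s * c) ^ 2 / 4)))
    (Measurable.ennreal_ofReal (Measurable.exp (by fun_prop)))
    (Measurable.ennreal_ofReal (Measurable.exp (by fun_prop)))
    (by
      have h6 : Measurable fun y => ⟪R y, y⟫ := hR.inner measurable_id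
      exact Measurable.ennreal_ofReal (Measurable.exp (by fun_prop)))
    (fun y₁ y₂ => by
      rw [← ENNReal.ofReal_mul (Real.exp_pos _).le, ← ENNReal.ofReal_pow (Real.exp_pos _).le,
        ← Real.exp_add, ← Real.exp_nat_mul]
      refine ENNReal.ofReal_le_ofReal (Real.exp_le_exp.2 ?_)
      set x := R ((1 / 2 : ℝ) • (y₁ + y₂)) with hx
      have i1 := S.inner_halfSqGrad_le (x + s • e) (R y₁)
      have i2 := S.inner_halfSqGrad_le (x - s • e) (R y₂)
      rw [hTR, inner_add_left, real_inner_smul_left, real_inner_comm y₁ e] at i1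
      rw [hTR, inner_sub_left, real_inner_smul_left, real_inner_comm y₂ e] at i2
      rw [real_inner_smul_right, inner_add_right]
      push_cast
      nlinarith [sq_nonneg (H (x + s • e) - s * c - H (R y₁)),
        sq_nonneg (H (x - s • e) + s * c - H (R y₂))])
  rw [S.lintegral_comp_halfSqGrad hdet (φ := fun x => s * (H x * (⟪gradient H x, e⟫ - c)))
      (fun x => by rw [hRT, hψ]) h1,
    S.lintegral_comp_halfSqGrad hdet (φ := fun x => -(s * (H x * (⟪gradient H x, e⟫ - c))))
      (fun x => by rw [hRT, hψ]) h2,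
    S.lintegral_comp_halfSqGrad hdet (φ := secondDiff H e c s)
      (fun x => by
        rw [hRT, S.inner_halfSqGrad_self, secondDiff]
        congr 2
        ring) h3,
    ← ENNReal.ofReal_mul (integral_nonneg fun x => (Real.exp_pos _).le),
    ← ENNReal.ofReal_pow (integral_nonneg fun x => (Real.exp_pos _).le),
    ENNReal.ofReal_le_ofReal_iff (by positivity)] at key
  exact key

theorem hasDerivAt_line {x e : E n} {t : ℝ} (h : x + t • e ≠ 0) :
    HasDerivAt (fun t : ℝ => H (x + t • e)) ⟪gradient H (x + t • e), e⟫ t := by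
  have hd : HasDerivAt (fun t : ℝ => x + t • e) e t := by
    simpa using ((hasDerivAt_id t).smul_const e).const_add x
  have := (S.hasFDerivAt h).comp_hasDerivAt t hd
  rwa [innerSL_apply_apply] at this

theorem hasDerivAt_line_sub {x e : E n} {t : ℝ} (h : x - t • e ≠ 0) :
    HasDerivAt (fun t : ℝ => H (x - t • e)) (-⟪gradient H (x - t • e), e⟫) t := by
  have h' : ∀ t : ℝ, x - t • e = x + t • (-e) := fun t => by rw [smul_neg, sub_eq_add_neg]
  simp only [h'] at h ⊢
  rw [← inner_neg_right]
  exact S.hasDerivAt_line h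

theorem hasDerivAt_inner_gradient_line {x e : E n} {t : ℝ} (h : x + t • e ≠ 0) (v : E n) :
    HasDerivAt (fun t : ℝ => ⟪gradient H (x + t • e), v⟫) ⟪hess H (x + t • e) e, v⟫ t := by
  have hd : HasDerivAt (fun t : ℝ => x + t • e) e t := by
    simpa using ((hasDerivAt_id t).smul_const e).const_add x
  simpa using ((S.hasFDerivAt_gradient h).comp_hasDerivAt t hd).inner ℝ (hasDerivAt_const t v)

theorem hasDerivAt_inner_gradient_line_sub {x e : E n} {t : ℝ} (h : x - t • e ≠ 0) (v : E n) :
    HasDerivAt (fun t : ℝ => ⟪gradient H (x - t • e), v⟫) (-⟪hess H (x - t • e) e, v⟫) t := by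
  have h' : ∀ t : ℝ, x - t • e = x + t • (-e) := fun t => by rw [smul_neg, sub_eq_add_neg]
  simp only [h'] at h ⊢
  rw [← inner_neg_left, ← map_neg]
  exact S.hasDerivAt_inner_gradient_line h v

theorem exists_norm_halfSqHess_le : ∃ M, 0 ≤ M ∧ ∀ x ≠ 0, ‖halfSqHess H x‖ ≤ M := by
  obtain ⟨b, B, hb, hB, -, h2, h3, h4⟩ := S.exists_bounds
  refine ⟨B * B + B * B, by positivity, fun x hx => (norm_add_le _ _).trans (add_le_add ?_ ?_)⟩
  · rw [norm_smul, Real.norm_of_nonneg (S.nonneg x)]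
    calc H x * ‖hess H x‖ ≤ B * ‖x‖ * ‖hess H x‖ := by gcongr; exact h2 x
      _ ≤ B * B := by rw [mul_assoc]; gcongr; exact h4 x hx
  · rw [ContinuousLinearMap.norm_smulRight_apply, innerSL_apply_norm]
    exact mul_le_mul (h3 x hx) (h3 x hx) (norm_nonneg _) hB.le

theorem exists_bound_secondDiff_sq : ∃ C, 0 ≤ C ∧ ∀ x v : E n,
    |H (x + v) ^ 2 / 2 + H (x - v) ^ 2 / 2 - H x ^ 2| ≤ C * ‖v‖ ^ 2 := by
  obtain ⟨b, B, hb, hB, -, h2, -⟩ := S.exists_bounds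
  obtain ⟨M, hM, h3⟩ := S.exists_norm_halfSqHess_le
  refine ⟨max (9 * B ^ 2) (2 * M), by positivity, fun x v => ?_⟩
  rw [abs_of_nonneg]
  swap
  · have h := S.add_le (x + v) (x - v)
    rw [add_add_sub_cancel, ← two_smul ℝ, S.hom 2 x two_pos] at h
    nlinarith [S.nonneg x, sq_nonneg (H (x + v) - H (x - v))]
  rcases lt_or_ge ‖x‖ (2 * ‖v‖) with hxv | hxv
  · refine le_trans ?_ (mul_le_mul_of_nonneg_right (le_max_left _ _) (by positivity))
    have e1 : H (x + v) ≤ B * (3 * ‖v‖) :=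
      (h2 _).trans (by gcongr; linarith [norm_add_le x v])
    have e2 : H (x - v) ≤ B * (3 * ‖v‖) :=
      (h2 _).trans (by gcongr; linarith [norm_sub_le x v])
    have e3 := pow_le_pow_left₀ (S.nonneg _) e1 2
    have e4 := pow_le_pow_left₀ (S.nonneg _) e2 2
    nlinarith [sq_nonneg (H x)]
  · refine le_trans ?_ (mul_le_mul_of_nonneg_right (le_max_right _ _) (by positivity))
    rcases eq_or_ne v 0 with rfl | hv
    · simp
    have hv' : 0 < ‖v‖ := norm_pos_iff.2 hv
    have hmem : ∀ t : ℝ, |t| ≤ 1 → x + t • v ∈ ball x ‖x‖ := fun t ht => by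
      rw [mem_ball_iff_norm, add_sub_cancel_left, norm_smul, Real.norm_eq_abs]
      nlinarith
    have hne : ∀ y ∈ ball x ‖x‖, y ≠ 0 := fun y hy h => by
      rw [h, mem_ball_iff_norm, zero_sub, norm_neg] at hy
      exact lt_irrefl _ hy
    have hp : ∀ t ∈ Set.Icc (0 : ℝ) 1, x + t • v ∈ ball x ‖x‖ := fun t ht =>
      hmem t (abs_le.2 ⟨by linarith [ht.1], ht.2⟩)
    have hm : ∀ t ∈ Set.Icc (0 : ℝ) 1, x - t • v ∈ ball x ‖x‖ := fun t ht => by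
      rw [sub_eq_add_neg, ← neg_smul]
      exact hmem (-t) (abs_le.2 ⟨by linarith [ht.2], by linarith [ht.1]⟩)
    have hd : ∀ t ∈ Set.Icc (0 : ℝ) 1, HasDerivAt
        (fun t : ℝ => H (x + t • v) ^ 2 / 2 + H (x - t • v) ^ 2 / 2)
        ⟪halfSqGrad H (x + t • v) - halfSqGrad H (x - t • v), v⟫ t := fun t ht => by
      refine ((((S.hasDerivAt_line (hne _ (hp t ht))).pow 2).div_const 2).add
        (((S.hasDerivAt_line_sub (hne _ (hm t ht))).pow 2).div_const 2)).congr_deriv ?_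
      rw [halfSqGrad, halfSqGrad, inner_sub_left, real_inner_smul_left, real_inner_smul_left]
      push_cast
      ring
    obtain ⟨ξ, hξ, h⟩ := exists_hasDerivAt_eq_slope _ _ zero_lt_one
      (fun t ht => (hd t ht).continuousAt.continuousWithinAt)
      fun t ht => hd t (Set.Ioo_subset_Icc_self ht)
    have hξ' := Set.Ioo_subset_Icc_self hξ
    have hL := (convex_ball x ‖x‖).norm_image_sub_le_of_norm_hasFDerivWithin_le
      (fun y hy => (S.hasFDerivAt_halfSqGrad (hne y hy)).hasFDerivWithinAt)
      (fun y hy => h3 y (hne y hy)) (hm ξ hξ') (hp ξ hξ')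
    have e : H (x + v) ^ 2 / 2 + H (x - v) ^ 2 / 2 - H x ^ 2 =
        ⟪halfSqGrad H (x + ξ • v) - halfSqGrad H (x - ξ • v), v⟫ := by
      rw [h]
      simp only [one_smul, zero_smul, add_zero, sub_zero]
      ring
    rw [e]
    have e2 : ‖x + ξ • v - (x - ξ • v)‖ ≤ 2 * ‖v‖ := by
      rw [add_sub_sub_cancel, ← two_smul ℝ, norm_smul, norm_smul, Real.norm_of_nonneg hξ.1.le,
        Real.norm_of_nonneg zero_le_two]
      nlinarith [hξ.2]
    calc _ ≤ ‖halfSqGrad H (x + ξ • v) - halfSqGrad H (x - ξ • v)‖ * ‖v‖ := real_inner_le_norm _ _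
      _ ≤ (M * (2 * ‖v‖)) * ‖v‖ := by
        gcongr
        exact hL.trans (by gcongr)
      _ = _ := by ring

theorem exists_bound_secondDiff (e : E n) (c : ℝ) : ∃ C, 0 ≤ C ∧ ∀ s x,
    |secondDiff H e c s x| ≤ C * s ^ 2 := by
  obtain ⟨b, B, hb, hB, -, h2, -⟩ := S.exists_bounds
  obtain ⟨C, hC, h3⟩ := S.exists_bound_secondDiff_sq
  refine ⟨C * ‖e‖ ^ 2 / 2 + |c| * (B * ‖e‖) + c ^ 2 / 2, by positivity, fun s x => ?_⟩
  have e1 : secondDiff H e c s x =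
      (H (x + s • e) ^ 2 / 2 + H (x - s • e) ^ 2 / 2 - H x ^ 2) / 2 -
        s * c * ((H (x + s • e) - H x) - (H (x + -(s • e)) - H x)) / 2 + s ^ 2 * c ^ 2 / 2 := by
    rw [secondDiff, ← sub_eq_add_neg]; ring
  have e2 := h3 x (s • e)
  have e3 := S.abs_sub_le h2 x (s • e)
  have e4 := S.abs_sub_le h2 x (-(s • e))
  rw [norm_neg] at e4
  rw [norm_smul, Real.norm_eq_abs] at e2 e3 e4
  rw [mul_pow, sq_abs] at e2
  have e5 : |s * c * ((H (x + s • e) - H x) - (H (x + -(s • e)) - H x))| ≤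
      |s| * |c| * (B * (|s| * ‖e‖) + B * (|s| * ‖e‖)) := by
    rw [abs_mul, abs_mul]
    gcongr
    exact (abs_sub _ _).trans (add_le_add e3 e4)
  have e6 : |s| * |c| * (B * (|s| * ‖e‖) + B * (|s| * ‖e‖)) = 2 * (|c| * (B * ‖e‖)) * s ^ 2 := by
    rw [← sq_abs s]; ring
  rw [e6] at e5
  rw [e1]
  rw [abs_le] at e2 e5 ⊢
  constructor <;> nlinarith [mul_nonneg (sq_nonneg s) (sq_nonneg c)]

theorem tendsto_secondDiff {x : E n} (hx : x ≠ 0) (e : E n) (c : ℝ) :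
    Filter.Tendsto (fun s : ℝ => secondDiff H e c s x / s ^ 2) (nhdsWithin 0 (Set.Ioi 0))
      (nhds ((H x * ⟪hess H x e, e⟫ + (⟪gradient H x, e⟫ - c) ^ 2) / 2)) := by
  have c1 : ∀ᶠ s : ℝ in nhds 0, x + s • e ≠ 0 := by
    have : ContinuousAt (fun s : ℝ => x + s • e) 0 := by fun_prop
    exact this.eventually_ne (by simpa using hx)
  have c2 : ∀ᶠ s : ℝ in nhds 0, x - s • e ≠ 0 := by
    have : ContinuousAt (fun s : ℝ => x - s • e) 0 := by fun_prop
    exact this.eventually_ne (by simpa using hx)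
  have hs : ∀ s : ℝ, HasDerivAt (fun s : ℝ => s * c) c s := fun s => by
    simpa using (hasDerivAt_id s).mul_const c
  set D : ℝ → ℝ := fun s => (H (x + s • e) - s * c) * (⟪gradient H (x + s • e), e⟫ - c) / 2 +
    (H (x - s • e) + s * c) * (-⟪gradient H (x - s • e), e⟫ + c) / 2 with hD
  have d1 : ∀ᶠ s : ℝ in nhds 0, HasDerivAt (fun s => secondDiff H e c s x) (D s) s := by
    filter_upwards [c1, c2] with s h1 h2
    refine ((((((S.hasDerivAt_line h1).sub (hs s)).pow 2).div_const 4).const_add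
      (-(H x ^ 2 / 2))).add
        ((((S.hasDerivAt_line_sub h2).add (hs s)).pow 2).div_const 4)).congr_deriv ?_
    simp only [hD, Pi.sub_apply, Pi.add_apply]
    push_cast
    ring
  have z1 : x + (0 : ℝ) • e ≠ 0 := by simpa using hx
  have z2 : x - (0 : ℝ) • e ≠ 0 := by simpa using hx
  have d2 : HasDerivAt D (H x * ⟪hess H x e, e⟫ + (⟪gradient H x, e⟫ - c) ^ 2) 0 := by
    refine (((((S.hasDerivAt_line z1).sub (hs 0)).mul
      ((S.hasDerivAt_inner_gradient_line z1 e).sub_const c)).div_const 2).add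
      ((((S.hasDerivAt_line_sub z2).add (hs 0)).mul
      ((S.hasDerivAt_inner_gradient_line_sub z2 e).neg.add_const c)).div_const 2)).congr_deriv ?_
    simp only [Pi.sub_apply, Pi.add_apply, Pi.neg_apply, zero_smul, add_zero, sub_zero, zero_mul]
    ring
  have D0 : D 0 = 0 := by
    simp only [hD, zero_smul, add_zero, sub_zero, zero_mul]; ring
  have f0 : secondDiff H e c 0 x = 0 := by
    simp only [secondDiff, zero_smul, add_zero, sub_zero, zero_mul]; ring
  have hle := nhdsWithin_le_nhds (a := (0 : ℝ)) (s := Set.Ioi 0)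
  refine HasDerivAt.lhopital_zero_nhdsGT (f' := D) (g' := fun s => 2 * s) (hle d1)
    (Filter.Eventually.of_forall fun s => by simpa using hasDerivAt_pow 2 s)
    (eventually_mem_nhdsWithin.mono fun s hs => mul_ne_zero two_ne_zero (ne_of_gt hs))
    ?_ ?_ ?_
  · have := d1.self_of_nhds.continuousAt.tendsto
    rw [f0] at this
    exact this.mono_left hle
  · have : ContinuousAt (fun s : ℝ => s ^ 2) 0 := by fun_prop
    have := this.tendsto
    rw [zero_pow two_ne_zero] at this
    exact this.mono_left hle
  · have := (hasDerivAt_iff_tendsto_slope_zero.1 d2).mono_left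
      (nhdsWithin_mono 0 (fun s (hs : 0 < s) => ne_of_gt hs) :
        nhdsWithin (0 : ℝ) (Set.Ioi 0) ≤ nhdsWithin 0 {0}ᶜ)
    refine (this.div_const 2).congr' (eventually_mem_nhdsWithin.mono fun s hs => ?_)
    have hs' : s ≠ 0 := ne_of_gt hs
    rw [zero_add, D0, sub_zero, smul_eq_mul]
    field_simp

end IsSmoothSupport

theorem one_add_add_sq_div_two_sub_le_exp (t : ℝ) :
    1 + t + t ^ 2 / 2 - |t| ^ 3 * Real.exp |t| ≤ Real.exp t := by
  have h := Complex.norm_exp_sub_sum_le_norm_mul_exp (t : ℂ) 3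
  simp only [Finset.sum_range_succ, Finset.sum_range_zero, Complex.norm_real, Real.norm_eq_abs,
    Nat.factorial] at h
  norm_cast at h
  rw [Real.norm_eq_abs] at h
  have := (abs_le.1 h).1
  norm_num at this
  linarith

namespace IsSmoothSupport

variable {n : ℕ} {H : E n → ℝ} (S : IsSmoothSupport H)
include S

theorem integral_sq_le_integral {a : ℝ}
    (hdet : ∀ x ≠ 0, (halfSqHess H x).det = (H x / ‖x‖) ^ a) (e : E n) (c : ℝ)
    (hc : ∫ x, H x * (⟪gradient H x, e⟫ - c) ∂weightMeasure H a = 0) :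
    ∫ x, (H x * (⟪gradient H x, e⟫ - c)) ^ 2 ∂weightMeasure H a ≤
      ∫ x, (H x * ⟪hess H x e, e⟫ + (⟪gradient H x, e⟫ - c) ^ 2) ∂weightMeasure H a := by
  have := S.isFiniteMeasure a
  set ν := weightMeasure H a with hν
  set f : E n → ℝ := fun x => H x * (⟪gradient H x, e⟫ - c) with hf
  obtain ⟨b, B, hb, hB, -, h2, h3, -⟩ := S.exists_bounds
  have hfG : ExpGrowth f := S.expGrowth.mul ((S.expGrowth_inner_gradient e).sub (.const c))
  set K := B * (B * ‖e‖ + |c|) with hK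
  have hK0 : 0 ≤ K := by positivity
  have hfK : ∀ x ≠ 0, |f x| ≤ K * ‖x‖ := fun x hx => by
    rw [hf, abs_mul, abs_of_nonneg (S.nonneg x)]
    calc _ ≤ (B * ‖x‖) * (B * ‖e‖ + |c|) := by
          gcongr
          · exact h2 x
          · refine (abs_sub _ _).trans ?_
            gcongr
            exact (abs_real_inner_le_norm _ _).trans (by gcongr; exact h3 x hx)
      _ = _ := by rw [hK]; ring
  have hexp : ∀ s : ℝ, ExpGrowth fun x => Real.exp (s * f x) := fun s =>
    .exp (C := |s| * K) (continuousOn_const.mul hfG.1) fun x hx => by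
      have := hfK x hx
      calc s * f x ≤ |s| * |f x| := by rw [← abs_mul]; exact le_abs_self _
        _ ≤ |s| * (K * ‖x‖) := by gcongr
        _ ≤ _ := by nlinarith [mul_nonneg (abs_nonneg s) hK0]
  have habs : ExpGrowth fun x => |f x| ^ 3 * Real.exp |f x| :=
    .mul (.pow (.of_le (C := K) (D := 1) hfG.1.abs fun x hx => by
        rw [abs_abs]
        exact (hfK x hx).trans (by gcongr; linarith [Real.add_one_le_exp (1 * ‖x‖)])) 3)
      (.exp (C := K) hfG.1.abs fun x hx => (hfK x hx).trans (by nlinarith))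
  set W := ∫ x, |f x| ^ 3 * Real.exp |f x| ∂ν with hW
  set V := ∫ x, f x ^ 2 ∂ν with hV
  set Z := ∫ x, (1 : ℝ) ∂ν with hZ
  have hlow : ∀ s : ℝ, |s| ≤ 1 → Z + s ^ 2 * V / 2 - |s| ^ 3 * W ≤ ∫ x, Real.exp (s * f x) ∂ν := by
    intro s hs
    have e1 : ∫ x, ((1 + s * f x + s ^ 2 / 2 * f x ^ 2) - |s| ^ 3 * (|f x| ^ 3 * Real.exp |f x|)) ∂ν =
        Z + s ^ 2 * V / 2 - |s| ^ 3 * W := by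
      have i1 := ExpGrowth.const (n := n) 1
      have i2 := hfG.const_mul s
      have i3 := (hfG.pow 2).const_mul (s ^ 2 / 2)
      have i4 := habs.const_mul (|s| ^ 3)
      rw [S.integral_sub ((i1.add i2).add i3) i4, S.integral_add (i1.add i2) i3,
        S.integral_add i1 i2, integral_const_mul, integral_const_mul, integral_const_mul, hc]
      ring
    rw [← e1]
    refine integral_mono (S.integrable
      ((((ExpGrowth.const 1).add (hfG.const_mul s)).add ((hfG.pow 2).const_mul (s ^ 2 / 2))).sub
        (habs.const_mul (|s| ^ 3))) a) (S.integrable (hexp s) a) fun x => ?_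
    refine le_trans ?_ (one_add_add_sq_div_two_sub_le_exp (s * f x))
    have e2 : |s * f x| ≤ |f x| := by
      rw [abs_mul]; exact mul_le_of_le_one_left (abs_nonneg _) hs
    have e3 : |s * f x| ^ 3 * Real.exp |s * f x| ≤ |s| ^ 3 * (|f x| ^ 3 * Real.exp |f x|) := by
      calc |s * f x| ^ 3 * Real.exp |s * f x| ≤ |s * f x| ^ 3 * Real.exp |f x| :=
            mul_le_mul_of_nonneg_left (Real.exp_le_exp.2 e2) (by positivity)
        _ = _ := by rw [abs_mul s (f x), mul_pow, mul_assoc]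
    linarith [show (s * f x) ^ 2 / 2 = s ^ 2 / 2 * f x ^ 2 by ring]
  obtain ⟨C, hC, hδ⟩ := S.exists_bound_secondDiff e c
  have hδc : ∀ s, ContinuousOn (secondDiff H e c s) {(0 : E n)}ᶜ := fun s => by
    have := S.continuous
    unfold secondDiff
    fun_prop
  have hδG : ∀ s, ExpGrowth (secondDiff H e c s) := fun s => .of_bounded (hδc s) fun x _ => hδ s x
  have hδexp : ∀ s, ExpGrowth fun x => Real.exp (secondDiff H e c s x) := fun s =>
    .exp (C := C * s ^ 2) (hδc s) fun x _ => ((le_abs_self _).trans (hδ s x)).trans (by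
      nlinarith [mul_nonneg (mul_nonneg hC (sq_nonneg s)) (norm_nonneg x)])
  have hZ0 : 0 ≤ Z := integral_nonneg fun _ => zero_le_one
  have hup : ∀ s : ℝ, C * s ^ 2 ≤ 1 → ∫ x, Real.exp (secondDiff H e c s x) ∂ν ≤
      Z + ∫ x, secondDiff H e c s x ∂ν + C ^ 2 * s ^ 4 * Z := by
    intro s hs
    have i1 := ExpGrowth.const (n := n) 1
    have i2 := hδG s
    have i3 := ExpGrowth.const (n := n) (C ^ 2 * s ^ 4 * 1)
    have e1 : ∫ x, (1 + secondDiff H e c s x + C ^ 2 * s ^ 4 * 1) ∂ν =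
        Z + ∫ x, secondDiff H e c s x ∂ν + C ^ 2 * s ^ 4 * Z := by
      rw [S.integral_add (i1.add i2) i3, S.integral_add i1 i2, integral_const_mul]
    rw [← e1]
    refine integral_mono (S.integrable (hδexp s) a) (S.integrable ((i1.add i2).add i3) a) fun x => ?_
    have h5 := hδ s x
    have h6 := (abs_le.1 (Real.abs_exp_sub_one_sub_id_le (h5.trans hs))).2
    have h7 : secondDiff H e c s x ^ 2 ≤ (C * s ^ 2) ^ 2 := by
      rw [← sq_abs]; exact pow_le_pow_left₀ (abs_nonneg _) h5 2
    change _ ≤ 1 + secondDiff H e c s x + C ^ 2 * s ^ 4 * 1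
    linarith [show (C * s ^ 2) ^ 2 = C ^ 2 * s ^ 4 by ring]
  set Q := ∫ x, (H x * ⟪hess H x e, e⟫ + (⟪gradient H x, e⟫ - c) ^ 2) ∂ν with hQ
  have hlim : Filter.Tendsto (fun s : ℝ => ∫ x, secondDiff H e c s x / s ^ 2 ∂ν)
      (nhdsWithin 0 (Set.Ioi 0)) (nhds (Q / 2)) := by
    rw [hQ, ← integral_div]
    refine tendsto_integral_filter_of_dominated_convergence (fun _ => C)
      (Filter.Eventually.of_forall fun s => ((S.integrable (hδG s) a).div_const _).1)
      (eventually_mem_nhdsWithin.mono fun s hs => Filter.Eventually.of_forall fun x => ?_)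
      (integrable_const C) ?_
    · rw [norm_div, Real.norm_eq_abs, Real.norm_of_nonneg (sq_nonneg s),
        div_le_iff₀ (pow_pos hs 2)]
      exact hδ s x
    · filter_upwards [ae_ne_zero_weightMeasure H a] with x hx
      exact S.tendsto_secondDiff hx e c
  have hcmp : ∀ᶠ s : ℝ in nhdsWithin 0 (Set.Ioi 0),
      V / 2 - s * W ≤ ∫ x, secondDiff H e c s x / s ^ 2 ∂ν + C ^ 2 * s ^ 2 * Z := by
    have hsmall : ∀ᶠ s : ℝ in nhds 0, C * s ^ 2 < 1 := by
      have : ContinuousAt (fun s : ℝ => C * s ^ 2) 0 := by fun_prop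
      exact this.eventually_lt_const (by simp)
    filter_upwards [hsmall.filter_mono nhdsWithin_le_nhds, Ioo_mem_nhdsGT zero_lt_one]
      with s hs1 hs2
    have hs : |s| ≤ 1 := by rw [abs_of_pos hs2.1]; exact hs2.2.le
    have k1 := hlow s hs
    have k2 := hlow (-s) (by rwa [abs_neg])
    have k3 := S.integral_exp_mul_integral_exp_le hdet e c s (hexp s)
      (by simpa only [neg_mul] using hexp (-s)) (hδexp s)
    have k4 := hup s hs1.le
    have k5 : 0 ≤ ∫ x, Real.exp (secondDiff H e c s x) ∂ν :=
      integral_nonneg fun x => (Real.exp_pos _).le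
    simp only [neg_mul, neg_sq, abs_neg] at k2
    have k6 : Z + s ^ 2 * V / 2 - |s| ^ 3 * W ≤ ∫ x, Real.exp (secondDiff H e c s x) ∂ν := by
      by_contra! hlt
      have k7 : 0 < Z + s ^ 2 * V / 2 - |s| ^ 3 * W := k5.trans_lt hlt
      have k8 := mul_le_mul k1 k2 k7.le (k7.le.trans k1)
      have k9 := k8.trans k3
      nlinarith
    have hs0 : 0 < s ^ 2 := pow_pos hs2.1 2
    rw [integral_div, ← mul_le_mul_iff_of_pos_left hs0, mul_add, mul_div_cancel₀ _ hs0.ne']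
    rw [abs_of_pos hs2.1] at k6
    linarith [show s ^ 2 * (V / 2 - s * W) = s ^ 2 * V / 2 - s ^ 3 * W by ring,
      show s ^ 2 * (C ^ 2 * s ^ 2 * Z) = C ^ 2 * s ^ 4 * Z by ring]
  have hl1 : Filter.Tendsto (fun s : ℝ => V / 2 - s * W) (nhdsWithin 0 (Set.Ioi 0))
      (nhds (V / 2)) := by
    have : ContinuousAt (fun s : ℝ => V / 2 - s * W) 0 := by fun_prop
    have := this.tendsto
    rw [zero_mul, sub_zero] at this
    exact this.mono_left nhdsWithin_le_nhds
  have hl2 : Filter.Tendsto (fun s : ℝ => ∫ x, secondDiff H e c s x / s ^ 2 ∂ν + C ^ 2 * s ^ 2 * Z)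
      (nhdsWithin 0 (Set.Ioi 0)) (nhds (Q / 2)) := by
    have : ContinuousAt (fun s : ℝ => C ^ 2 * s ^ 2 * Z) 0 := by fun_prop
    have := this.tendsto
    rw [zero_pow two_ne_zero, mul_zero, zero_mul] at this
    simpa using hlim.add (this.mono_left nhdsWithin_le_nhds)
  have := le_of_tendsto_of_tendsto hl1 hl2 hcmp
  linarith

end IsSmoothSupport

/-- Functions homogeneous of degree zero and continuous off the origin. -/
structure IsZeroHomogeneous {n : ℕ} (F : E n → ℝ) : Prop where
  continuousOn : ContinuousOn F {(0 : E n)}ᶜ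
  smul : ∀ (t : ℝ) (x : E n), 0 < t → x ≠ 0 → F (t • x) = F x

namespace IsZeroHomogeneous

variable {n : ℕ} {F G : E n → ℝ}

theorem const (c : ℝ) : IsZeroHomogeneous fun _ : E n => c := ⟨continuousOn_const, fun _ _ _ _ => rfl⟩

theorem add (hF : IsZeroHomogeneous F) (hG : IsZeroHomogeneous G) :
    IsZeroHomogeneous fun x => F x + G x :=
  ⟨hF.1.add hG.1, fun t x ht hx => by rw [hF.2 t x ht hx, hG.2 t x ht hx]⟩

theorem sub (hF : IsZeroHomogeneous F) (hG : IsZeroHomogeneous G) :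
    IsZeroHomogeneous fun x => F x - G x :=
  ⟨hF.1.sub hG.1, fun t x ht hx => by rw [hF.2 t x ht hx, hG.2 t x ht hx]⟩

theorem mul (hF : IsZeroHomogeneous F) (hG : IsZeroHomogeneous G) :
    IsZeroHomogeneous fun x => F x * G x :=
  ⟨hF.1.mul hG.1, fun t x ht hx => by rw [hF.2 t x ht hx, hG.2 t x ht hx]⟩

theorem const_mul (hF : IsZeroHomogeneous F) (c : ℝ) : IsZeroHomogeneous fun x => c * F x :=
  (const c).mul hF

theorem exists_bound (hF : IsZeroHomogeneous F) : ∃ C, 0 ≤ C ∧ ∀ x ≠ 0, |F x| ≤ C :=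
  exists_bound_of_zero_homogeneous hF.1 hF.2

theorem expGrowth (hF : IsZeroHomogeneous F) : ExpGrowth F :=
  let ⟨_, _, h⟩ := hF.exists_bound
  .of_bounded hF.1 h

end IsZeroHomogeneous

namespace IsSmoothSupport

variable {n : ℕ} {H : E n → ℝ} (S : IsSmoothSupport H)
include S

theorem zeroHomogeneous_inner_gradient (e : E n) :
    IsZeroHomogeneous fun x => ⟪gradient H x, e⟫ :=
  ⟨S.continuousOn_gradient.inner continuousOn_const, fun t x ht hx => by rw [S.gradient_smul ht hx]⟩

theorem zeroHomogeneous_hess (e v : E n) :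
    IsZeroHomogeneous fun x => H x * ⟪hess H x e, v⟫ :=
  ⟨S.continuousOn.mul ((S.continuousOn_hess.clm_apply continuousOn_const).inner continuousOn_const),
    fun t x ht hx => by
      rw [S.hom t x ht, ← S.hess_smul ht hx, smul_apply, real_inner_smul_left]
      ring⟩

theorem zeroHomogeneous_div_norm : IsZeroHomogeneous fun x => H x / ‖x‖ :=
  ⟨S.expGrowth_div_norm.1, fun t x ht hx => by
    rw [S.hom t x ht, norm_smul, Real.norm_of_nonneg ht.le, mul_div_mul_left _ _ ht.ne']⟩

theorem zeroHomogeneous_div_norm_rpow (a : ℝ) : IsZeroHomogeneous fun x => (H x / ‖x‖) ^ a :=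
  ⟨S.continuousOn_div_norm_rpow a, fun t x ht hx => by
    rw [S.zeroHomogeneous_div_norm.2 t x ht hx]⟩

theorem zeroHomogeneous_inner_div_norm_sq (e : E n) :
    IsZeroHomogeneous fun x => H x * ⟪x, e⟫ / ‖x‖ ^ 2 :=
  ⟨(S.continuousOn.mul (by fun_prop)).div (by fun_prop)
      fun x hx => pow_ne_zero 2 (norm_ne_zero_iff.2 hx), fun t x ht hx => by
    rw [S.hom t x ht, norm_smul, Real.norm_of_nonneg ht.le, real_inner_smul_left, mul_pow,
      ← mul_div_mul_left (H x * ⟪x, e⟫) _ (pow_ne_zero 2 ht.ne')]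
    congr 1
    ring⟩

theorem hasDerivAt_integral_mul_exp {P : E n → ℝ} (hP : ExpGrowth P) :
    HasDerivAt (fun t : ℝ => ∫ x, P x * Real.exp (-(t ^ 2 / 2 * H x ^ 2)))
      (∫ x, -(1 * H x ^ 2) * (P x * Real.exp (-((1 : ℝ) ^ 2 / 2 * H x ^ 2)))) 1 := by
  have hH := S.continuous
  have hPint : Integrable (fun x => P x * Real.exp (-((1 : ℝ) ^ 2 / 2 * H x ^ 2))) :=
    S.integrable_mul_exp hP (t := 1 ^ 2 / 2) (by norm_num)
  have hmeas : ∀ t : ℝ, AEStronglyMeasurable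
      (fun x => P x * Real.exp (-(t ^ 2 / 2 * H x ^ 2))) volume := fun t =>
    hP.aestronglyMeasurable.mul
      (Continuous.aestronglyMeasurable (by fun_prop))
  have hmeas' : AEStronglyMeasurable
      (fun x => -(1 * H x ^ 2) * (P x * Real.exp (-((1 : ℝ) ^ 2 / 2 * H x ^ 2)))) volume :=
    AEStronglyMeasurable.mul (Continuous.aestronglyMeasurable (by fun_prop)) (hmeas 1)
  have hbound : ∀ (x : E n), ∀ t ∈ Set.Ioo (1 / 2 : ℝ) 2,
      ‖-(t * H x ^ 2) * (P x * Real.exp (-(t ^ 2 / 2 * H x ^ 2)))‖ ≤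
        2 * H x ^ 2 * |P x| * Real.exp (-(1 / 8 * H x ^ 2)) := fun x t ht => by
    have h1 : |-(t * H x ^ 2)| ≤ 2 * H x ^ 2 := by
      rw [abs_neg, abs_of_nonneg (mul_nonneg (by linarith [ht.1]) (sq_nonneg _))]
      nlinarith [ht.2, sq_nonneg (H x)]
    have h2 : Real.exp (-(t ^ 2 / 2 * H x ^ 2)) ≤ Real.exp (-(1 / 8 * H x ^ 2)) := by
      refine Real.exp_le_exp.2 (neg_le_neg (mul_le_mul_of_nonneg_right ?_ (sq_nonneg _)))
      nlinarith [ht.1]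
    rw [norm_mul, norm_mul, Real.norm_eq_abs, Real.norm_eq_abs,
      Real.norm_of_nonneg (Real.exp_pos _).le, mul_assoc (2 * H x ^ 2)]
    exact mul_le_mul h1 (mul_le_mul_of_nonneg_left h2 (abs_nonneg _))
      (mul_nonneg (abs_nonneg _) (Real.exp_pos _).le) (by positivity)
  have hbint : Integrable (fun x => 2 * H x ^ 2 * |P x| * Real.exp (-(1 / 8 * H x ^ 2))) := by
    refine S.integrable_mul_exp (f := fun x => 2 * H x ^ 2 * |P x|) ?_ (t := 1 / 8) (by norm_num)
    refine ((S.expGrowth.pow 2).const_mul 2).mul ⟨hP.1.abs, ?_⟩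
    simpa only [abs_abs] using hP.2
  have hdiff : ∀ (x : E n), ∀ t ∈ Set.Ioo (1 / 2 : ℝ) 2,
      HasDerivAt (fun t : ℝ => P x * Real.exp (-(t ^ 2 / 2 * H x ^ 2)))
        (-(t * H x ^ 2) * (P x * Real.exp (-(t ^ 2 / 2 * H x ^ 2)))) t := fun x t _ => by
    have h1 : HasDerivAt (fun t : ℝ => -(t ^ 2 / 2 * H x ^ 2)) (-(t * H x ^ 2)) t := by
      refine ((((hasDerivAt_pow 2 t).div_const 2).mul_const (H x ^ 2)).neg).congr_deriv ?_
      push_cast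
      ring
    exact (h1.exp.const_mul (P x)).congr_deriv (by ring)
  exact (hasDerivAt_integral_of_dominated_loc_of_deriv_le (𝕜 := ℝ) (μ := (volume : Measure (E n)))
    (F := fun t x => P x * Real.exp (-(t ^ 2 / 2 * H x ^ 2)))
    (F' := fun t x => -(t * H x ^ 2) * (P x * Real.exp (-(t ^ 2 / 2 * H x ^ 2))))
    (x₀ := 1) (s := Set.Ioo (1 / 2) 2)
    (bound := fun x => 2 * H x ^ 2 * |P x| * Real.exp (-(1 / 8 * H x ^ 2)))
    (Ioo_mem_nhds (by norm_num) (by norm_num)) (Filter.Eventually.of_forall hmeas) hPint hmeas'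
    (Filter.Eventually.of_forall hbound) hbint (Filter.Eventually.of_forall hdiff)).2

theorem integral_pow_add_two_mul {F : E n → ℝ} (hF : IsZeroHomogeneous F) (a : ℝ) (k : ℕ) :
    ∫ x, H x ^ (k + 2) * F x ∂weightMeasure H a =
      ((n : ℝ) + 1 + k) * ∫ x, H x ^ k * F x ∂weightMeasure H a := by
  set P : E n → ℝ := fun x => (H x / ‖x‖) ^ a * (H x ^ k * F x) with hP
  have hPG : ExpGrowth P := (S.expGrowth_div_norm_rpow a).mul ((S.expGrowth.pow k).mul hF.expGrowth)
  have hPs : ∀ (t : ℝ) (x : E n), 0 < t → x ≠ 0 → P (t • x) = t ^ k * P x := fun t x ht hx => by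
    rw [hP]
    simp only
    rw [S.zeroHomogeneous_div_norm.2 t x ht hx, S.hom t x ht, hF.2 t x ht hx]
    ring
  set J : ℝ → ℝ := fun t => ∫ x, P x * Real.exp (-(t ^ 2 / 2 * H x ^ 2)) with hJ
  have hJ1 : J 1 = ∫ x, H x ^ k * F x ∂weightMeasure H a := by
    rw [S.integral_weightMeasure]
    refine integral_congr_ae (Filter.Eventually.of_forall fun x => ?_)
    simp only [hP, weight]
    rw [show (1 : ℝ) ^ 2 / 2 * H x ^ 2 = H x ^ 2 / 2 by ring]
    ring
  have hscale : ∀ t : ℝ, 0 < t → t ^ (n + 1 + k) * J t = J 1 := fun t ht => by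
    have h1 := Measure.integral_comp_smul volume
      (fun x : E n => P x * Real.exp (-(1 ^ 2 / 2 * H x ^ 2))) t
    have h2 : ∫ x : E n, P (t • x) * Real.exp (-(1 ^ 2 / 2 * H (t • x) ^ 2)) = t ^ k * J t := by
      rw [hJ, ← integral_const_mul]
      refine integral_congr_ae ?_
      filter_upwards [Measure.ae_ne volume (0 : E n)] with x hx
      rw [hPs t x ht hx, S.hom t x ht, mul_assoc,
        show (1 : ℝ) ^ 2 / 2 * (t * H x) ^ 2 = t ^ 2 / 2 * H x ^ 2 by ring]
    rw [h2, finrank_euclideanSpace_fin, abs_of_pos (by positivity), smul_eq_mul] at h1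
    rw [pow_add, mul_assoc, h1, mul_inv_cancel_left₀ (by positivity)]
  have hder : HasDerivAt J (-∫ x, H x ^ (k + 2) * F x ∂weightMeasure H a) 1 := by
    refine (S.hasDerivAt_integral_mul_exp hPG).congr_deriv ?_
    rw [S.integral_weightMeasure, ← integral_neg]
    refine integral_congr_ae (Filter.Eventually.of_forall fun x => ?_)
    simp only [hP, weight]
    rw [show (1 : ℝ) ^ 2 / 2 * H x ^ 2 = H x ^ 2 / 2 by ring]
    ring
  have hprod := (hasDerivAt_pow (n + 1 + k) (1 : ℝ)).mul hder
  have hconst : HasDerivAt ((fun t : ℝ => t ^ (n + 1 + k)) * J) 0 1 := by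
    refine (hasDerivAt_const (1 : ℝ) (J 1)).congr_of_eventuallyEq ?_
    filter_upwards [lt_mem_nhds (zero_lt_one (α := ℝ))] with t ht using hscale t ht
  have := hprod.unique hconst
  rw [← hJ1]
  simp only [one_pow, mul_one, one_mul] at this
  push_cast at this
  linarith

theorem hasLineDerivAt_weight {x : E n} (hx : x ≠ 0) (e : E n) (a : ℝ) :
    HasLineDerivAt ℝ (weight H a) (weight H a x * (a * ⟪gradient H x, e⟫ / H x -
      a * ⟪x, e⟫ / ‖x‖ ^ 2 - H x * ⟪gradient H x, e⟫)) x e := by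
  have hn : ‖x‖ ≠ 0 := norm_ne_zero_iff.2 hx
  have hp := S.pos hx
  have h1 : HasDerivAt (fun t : ℝ => H (x + t • e)) ⟪gradient H x, e⟫ 0 := by
    simpa using S.hasDerivAt_line (x := x) (e := e) (t := 0) (by simpa using hx)
  have hl : HasDerivAt (fun t : ℝ => x + t • e) e 0 := by
    simpa using ((hasDerivAt_id (0 : ℝ)).smul_const e).const_add x
  have h2 : HasDerivAt (fun t : ℝ => ‖x + t • e‖) (⟪x, e⟫ / ‖x‖) 0 := by
    have h := hl.norm_sq.sqrt (by simpa using hx)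
    simp only [zero_smul, add_zero, Real.sqrt_sq (norm_nonneg _)] at h
    refine h.congr_deriv ?_
    field_simp
  have h3 := ((h1.div h2 (by simpa using hx)).rpow_const (p := a)
    (Or.inl (by simpa using (div_pos hp (norm_pos_iff.2 hx)).ne')))
  have h4 := (((h1.pow 2).div_const 2).neg.exp).mul h3
  refine HasDerivAt.congr_deriv h4 ?_
  simp only [zero_smul, add_zero, Pi.div_apply, Pi.pow_apply, weight, Pi.neg_apply]
  rw [Real.rpow_sub_one (div_pos hp (norm_pos_iff.2 hx)).ne']
  push_cast
  field_simp
  ring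

theorem integral_lineDeriv_eq_zero {G D : E n → ℝ} (hG : IsZeroHomogeneous G)
    (hD : IsZeroHomogeneous D) (e : E n)
    (hGD : ∀ x ≠ 0, HasLineDerivAt ℝ G (D x / H x) x e) (a : ℝ) :
    ∫ x, ((a - n) * (⟪gradient H x, e⟫ * G x) - a * (H x * ⟪x, e⟫ / ‖x‖ ^ 2 * G x) + D x)
      ∂weightMeasure H a = 0 := by
  have hw := S.zeroHomogeneous_inner_gradient e
  have hwG := hw.mul hG
  have hθG := (S.zeroHomogeneous_inner_div_norm_sq e).mul hG
  set A : E n → ℝ := fun x => (a + 3) * (⟪gradient H x, e⟫ * G x) -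
    a * (H x * ⟪x, e⟫ / ‖x‖ ^ 2 * G x) + D x with hA
  have hAz : IsZeroHomogeneous A := ((hwG.const_mul (a + 3)).sub (hθG.const_mul a)).add hD
  have hf : ExpGrowth fun x => H x ^ 3 * G x := (S.expGrowth.pow 3).mul hG.expGrowth
  have hf1 : ExpGrowth fun x => H x ^ 2 * A x := (S.expGrowth.pow 2).mul hAz.expGrowth
  have hf2 : ExpGrowth fun x => H x ^ 4 * (⟪gradient H x, e⟫ * G x) :=
    (S.expGrowth.pow 4).mul hwG.expGrowth
  have hline : ∀ x, HasLineDerivAt ℝ (fun x => weight H a x * (H x ^ 3 * G x))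
      (weight H a x * (H x ^ 2 * A x - H x ^ 4 * (⟪gradient H x, e⟫ * G x))) x e := by
    intro x
    rcases eq_or_ne x 0 with rfl | hx
    · rw [S.zero]
      simp only [ne_eq, OfNat.ofNat_ne_zero, not_false_eq_true, zero_pow, zero_mul, sub_self,
        mul_zero]
      obtain ⟨C, hC, hb⟩ := ((S.zeroHomogeneous_div_norm_rpow a).mul
        ((S.zeroHomogeneous_div_norm.mul (S.zeroHomogeneous_div_norm.mul
          S.zeroHomogeneous_div_norm)).mul hG)).exists_bound
      have hO : (fun x => weight H a x * (H x ^ 3 * G x)) =O[nhds 0]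
          fun x => ‖x - 0‖ ^ 3 := by
        refine Asymptotics.IsBigO.of_bound C (Filter.Eventually.of_forall fun y => ?_)
        rcases eq_or_ne y 0 with rfl | hy
        · simp [S.zero]
        have hn : ‖y‖ ≠ 0 := norm_ne_zero_iff.2 hy
        have h1 : weight H a y * (H y ^ 3 * G y) = Real.exp (-(H y ^ 2 / 2)) *
            ((H y / ‖y‖) ^ a * (H y / ‖y‖ * (H y / ‖y‖ * (H y / ‖y‖)) * G y)) * ‖y‖ ^ 3 := by
          rw [weight]
          field_simp
        rw [h1, sub_zero, norm_mul, norm_mul, Real.norm_of_nonneg (Real.exp_pos _).le,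
          Real.norm_eq_abs]
        refine mul_le_mul_of_nonneg_right ?_ (norm_nonneg _)
        refine (mul_le_mul (Real.exp_le_one_iff.2 (by nlinarith [sq_nonneg (H y)])) (hb y hy)
          (abs_nonneg _) zero_le_one).trans_eq (one_mul C)
      simpa using (hO.hasFDerivAt (𝕜 := ℝ) (by norm_num)).hasLineDerivAt e
    · have h1 := S.hasLineDerivAt_weight hx e a
      have h2 : HasDerivAt (fun t : ℝ => H (x + t • e)) ⟪gradient H x, e⟫ 0 := by
        simpa using S.hasDerivAt_line (x := x) (e := e) (t := 0) (by simpa using hx)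
      have h3 := HasDerivAt.mul h1 ((h2.pow 3).mul (hGD x hx))
      refine HasDerivAt.congr_deriv h3 ?_
      have hp := (S.pos hx).ne'
      have hn : ‖x‖ ≠ 0 := norm_ne_zero_iff.2 hx
      simp only [zero_smul, add_zero, Pi.mul_apply, Pi.pow_apply, hA]
      push_cast
      field_simp
      ring
  have hzero := integral_bilinear_hasLineDerivAt_right_eq_neg_left_of_integrable
    (μ := (volume : Measure (E n))) (B := ContinuousLinearMap.mul ℝ ℝ) (v := e)
    (f := fun _ => (1 : ℝ)) (f' := fun _ => (0 : ℝ))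
    (g := fun x => weight H a x * (H x ^ 3 * G x))
    (g' := fun x => weight H a x * (H x ^ 2 * A x - H x ^ 4 * (⟪gradient H x, e⟫ * G x)))
    (by simp) (by simpa using S.integrable_weight_mul (hf1.sub hf2) a)
    (by simpa using S.integrable_weight_mul hf a)
    (fun x _ => hasDerivAt_const _ _) (fun x _ => hline x)
  simp only [ContinuousLinearMap.mul_apply', one_mul, zero_mul, integral_zero, neg_zero] at hzero
  rw [← S.integral_weightMeasure, S.integral_sub hf1 hf2] at hzero
  have e1 := S.integral_pow_add_two_mul hAz a 0
  have e2 := S.integral_pow_add_two_mul hwG a 0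
  have e3 := S.integral_pow_add_two_mul hwG a 2
  simp only [zero_add, Nat.reduceAdd, pow_zero, one_mul, Nat.cast_ofNat, CharP.cast_eq_zero,
    add_zero] at e1 e2 e3
  have e4 : ∫ x, ((a - n) * (⟪gradient H x, e⟫ * G x) - a * (H x * ⟪x, e⟫ / ‖x‖ ^ 2 * G x) + D x)
      ∂weightMeasure H a = (∫ x, A x ∂weightMeasure H a) -
      (n + 3) * ∫ x, ⟪gradient H x, e⟫ * G x ∂weightMeasure H a := by
    rw [← integral_const_mul, ← S.integral_sub hAz.expGrowth (hwG.expGrowth.const_mul _)]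
    congr 1
    funext x
    rw [hA]
    ring
  rw [e4]
  rw [e1, e3, e2] at hzero
  have h5 : (n : ℝ) + 1 ≠ 0 := by positivity
  refine mul_left_cancel₀ h5 ?_
  rw [mul_zero, ← hzero]
  ring

theorem integral_inner_gradient_eq (e : E n) (a : ℝ) :
    (a - n) * ∫ x, ⟪gradient H x, e⟫ ∂weightMeasure H a =
      a * ∫ x, H x * ⟪x, e⟫ / ‖x‖ ^ 2 ∂weightMeasure H a := by
  have h := S.integral_lineDeriv_eq_zero (.const 1) (.const 0) e
    (fun x _ => (hasDerivAt_const (0 : ℝ) (1 : ℝ)).congr_deriv (zero_div _).symm) a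
  simp only [mul_one, add_zero] at h
  rw [S.integral_sub ((S.zeroHomogeneous_inner_gradient e).const_mul _).expGrowth
    ((S.zeroHomogeneous_inner_div_norm_sq e).const_mul _).expGrowth, integral_const_mul,
    integral_const_mul] at h
  linarith

theorem integral_hess_eq (e : E n) (a : ℝ) :
    ∫ x, H x * ⟪hess H x e, e⟫ ∂weightMeasure H a =
      a * ∫ x, H x * ⟪x, e⟫ / ‖x‖ ^ 2 * ⟪gradient H x, e⟫ ∂weightMeasure H a -
        (a - n) * ∫ x, ⟪gradient H x, e⟫ * ⟪gradient H x, e⟫ ∂weightMeasure H a := by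
  have hg := S.zeroHomogeneous_inner_gradient e
  have hθ := S.zeroHomogeneous_inner_div_norm_sq e
  have h := S.integral_lineDeriv_eq_zero hg (S.zeroHomogeneous_hess e e) e
    (fun x hx => by
      rw [mul_div_cancel_left₀ _ (S.pos hx).ne']
      simpa [HasLineDerivAt] using
        S.hasDerivAt_inner_gradient_line (x := x) (e := e) (t := 0) (by simpa using hx) e) a
  rw [S.integral_add (((hg.mul hg).const_mul _).sub ((hθ.mul hg).const_mul _)).expGrowth
    (S.zeroHomogeneous_hess e e).expGrowth, S.integral_sub ((hg.mul hg).const_mul _).expGrowth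
    ((hθ.mul hg).const_mul _).expGrowth, integral_const_mul, integral_const_mul] at h
  linarith

/-- Poincaré inequality for one component of the gradient. -/
theorem exists_mul_integral_sq_le {a : ℝ}
    (hdet : ∀ x ≠ 0, (halfSqHess H x).det = (H x / ‖x‖) ^ a) (e : E n) :
    ∃ c : ℝ, n * ∫ x, (⟪gradient H x, e⟫ - c) ^ 2 ∂weightMeasure H a ≤
      ∫ x, H x * ⟪hess H x e, e⟫ ∂weightMeasure H a := by
  have hg := S.zeroHomogeneous_inner_gradient e
  have hI : 0 < ∫ x, H x ∂weightMeasure H a := S.integral_pos S.expGrowth (fun x hx => S.pos hx) a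
  set c := (∫ x, H x * ⟪gradient H x, e⟫ ∂weightMeasure H a) / ∫ x, H x ∂weightMeasure H a with hc
  have hgc := hg.sub (.const c)
  have hF : IsZeroHomogeneous fun x => (⟪gradient H x, e⟫ - c) ^ 2 := by
    simpa only [sq] using hgc.mul hgc
  have h0 : ∫ x, H x * (⟪gradient H x, e⟫ - c) ∂weightMeasure H a = 0 := by
    simp only [mul_sub]
    rw [S.integral_sub (S.expGrowth.mul hg.expGrowth) (S.expGrowth.mul (.const c)),
      integral_mul_const, hc, mul_div_cancel₀ _ hI.ne', sub_self]
  have h1 := S.integral_sq_le_integral hdet e c h0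
  have h2 := S.integral_pow_add_two_mul hF a 0
  simp only [zero_add, pow_zero, one_mul, CharP.cast_eq_zero, add_zero] at h2
  simp only [mul_pow] at h1
  rw [h2, S.integral_add (S.zeroHomogeneous_hess e e).expGrowth hF.expGrowth] at h1
  exact ⟨c, by linarith⟩

theorem integral_const_pos (a : ℝ) : 0 < ∫ _, (1 : ℝ) ∂weightMeasure H a :=
  S.integral_pos (.const 1) (fun _ _ => one_pos) a

theorem integral_sub_const_sq {f : E n → ℝ} (hf : ExpGrowth f) (a c : ℝ) :
    ∫ x, (f x - c) ^ 2 ∂weightMeasure H a =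
      (∫ x, f x * f x ∂weightMeasure H a) - 2 * c * (∫ x, f x ∂weightMeasure H a) +
        c ^ 2 * ∫ _, (1 : ℝ) ∂weightMeasure H a := by
  rw [← integral_const_mul, ← integral_const_mul, ← S.integral_sub (hf.mul hf) (hf.const_mul _),
    ← S.integral_add ((hf.mul hf).sub (hf.const_mul _)) ((ExpGrowth.const 1).const_mul _)]
  congr 1
  funext x
  ring

theorem mul_integral_sub_le {a : ℝ}
    (hdet : ∀ x ≠ 0, (halfSqHess H x).det = (H x / ‖x‖) ^ a) (e : E n) :
    a * ((∫ x, ⟪gradient H x, e⟫ * ⟪gradient H x, e⟫ ∂weightMeasure H a) -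
      ∫ x, H x * ⟪x, e⟫ / ‖x‖ ^ 2 * ⟪gradient H x, e⟫ ∂weightMeasure H a) ≤
        n * (∫ x, ⟪gradient H x, e⟫ ∂weightMeasure H a) ^ 2 /
          ∫ _, (1 : ℝ) ∂weightMeasure H a := by
  obtain ⟨c, hc⟩ := S.exists_mul_integral_sq_le hdet e
  rw [S.integral_sub_const_sq (S.expGrowth_inner_gradient e), S.integral_hess_eq e a] at hc
  have hZ := S.integral_const_pos a
  rw [le_div_iff₀ hZ]
  generalize (∫ _, (1 : ℝ) ∂weightMeasure H a) = Z at *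
  generalize (∫ x, ⟪gradient H x, e⟫ ∂weightMeasure H a) = w at *
  have h := mul_le_mul_of_nonneg_right hc hZ.le
  nlinarith [mul_nonneg (Nat.cast_nonneg (α := ℝ) n) (sq_nonneg (w - c * Z))]

/-- The tangential part of the gradient is constant. -/
theorem exists_inner_gradient_sub_eq {a : ℝ} (ha : 0 < a) (han : a ≤ n)
    (hdet : ∀ x ≠ 0, (halfSqHess H x).det = (H x / ‖x‖) ^ a) :
    ∃ d : Fin (n + 1) → ℝ, ∀ x ≠ 0, ∀ l, ⟪gradient H x, EuclideanSpace.single l (1 : ℝ)⟫ -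
      H x * ⟪x, EuclideanSpace.single l (1 : ℝ)⟫ / ‖x‖ ^ 2 = d l := by
  set b : Fin (n + 1) → E n := fun l => EuclideanSpace.single l (1 : ℝ) with hb
  set g : Fin (n + 1) → E n → ℝ := fun l x => ⟪gradient H x, b l⟫ with hg
  set θ : Fin (n + 1) → E n → ℝ := fun l x => H x * ⟪x, b l⟫ / ‖x‖ ^ 2 with hθ
  have zg : ∀ l, IsZeroHomogeneous (g l) := fun l => S.zeroHomogeneous_inner_gradient (b l)
  have zθ : ∀ l, IsZeroHomogeneous (θ l) := fun l => S.zeroHomogeneous_inner_div_norm_sq (b l)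
  set ν := weightMeasure H a with hν
  have hZ := S.integral_const_pos a
  set Z := ∫ _, (1 : ℝ) ∂ν with hZdef
  set w : Fin (n + 1) → ℝ := fun l => ∫ x, g l x ∂ν with hw
  set u : Fin (n + 1) → ℝ := fun l => ∫ x, θ l x ∂ν with hu
  have hwu : ∀ l, (a - n) * w l = a * u l := fun l => S.integral_inner_gradient_eq (b l) a
  have hP : ∀ l, a * ((∫ x, g l x * g l x ∂ν) - ∫ x, θ l x * g l x ∂ν) ≤ n * w l ^ 2 / Z :=
    fun l => S.mul_integral_sub_le hdet (b l)
  have hsum : ∑ l, ∫ x, θ l x * g l x ∂ν = ∑ l, ∫ x, θ l x * θ l x ∂ν := by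
    rw [← integral_finsetSum _ fun l _ => S.integrable ((zθ l).mul (zg l)).expGrowth a,
      ← integral_finsetSum _ fun l _ => S.integrable ((zθ l).mul (zθ l)).expGrowth a]
    refine integral_congr_ae ?_
    filter_upwards [ae_ne_zero_weightMeasure H a] with x hx
    have hn : ‖x‖ ≠ 0 := norm_ne_zero_iff.2 hx
    have e1 : ∑ l, θ l x * g l x = H x / ‖x‖ ^ 2 * ⟪x, gradient H x⟫ := by
      rw [← sum_inner_single_mul_inner_single, Finset.mul_sum]
      exact Finset.sum_congr rfl fun l _ => by simp only [hθ, hg, hb]; ring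
    have e2 : ∑ l, θ l x * θ l x = (H x / ‖x‖ ^ 2) ^ 2 * ⟪x, x⟫ := by
      rw [← sum_inner_single_mul_inner_single x x, Finset.mul_sum]
      exact Finset.sum_congr rfl fun l _ => by simp only [hθ, hb]; ring
    rw [e1, e2, real_inner_comm, S.inner_gradient_self hx, real_inner_self_eq_norm_sq]
    field_simp
  set d : Fin (n + 1) → ℝ := fun l => n / a * w l / Z with hd
  have zt : ∀ l, IsZeroHomogeneous fun x => g l x - θ l x := fun l => (zg l).sub (zθ l)
  have ztt : ∀ l, IsZeroHomogeneous fun x => (g l x - θ l x - d l) ^ 2 := fun l => by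
    simpa only [sq] using ((zt l).sub (.const (d l))).mul ((zt l).sub (.const (d l)))
  have hone : ∀ l, ∫ x, (g l x - θ l x - d l) ^ 2 ∂ν =
      (∫ x, g l x * g l x ∂ν) - 2 * (∫ x, θ l x * g l x ∂ν) + (∫ x, θ l x * θ l x ∂ν) -
        d l ^ 2 * Z := fun l => by
    have h1 : ∫ x, (g l x - θ l x) * (g l x - θ l x) ∂ν =
        (∫ x, g l x * g l x ∂ν) - 2 * (∫ x, θ l x * g l x ∂ν) + (∫ x, θ l x * θ l x ∂ν) := by
      rw [← integral_const_mul, hν, ← S.integral_sub ((zg l).mul (zg l)).expGrowth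
          (((zθ l).mul (zg l)).const_mul 2).expGrowth,
        ← S.integral_add (((zg l).mul (zg l)).sub (((zθ l).mul (zg l)).const_mul 2)).expGrowth
          ((zθ l).mul (zθ l)).expGrowth]
      congr 1
      funext x
      ring
    have h2 : ∫ x, g l x - θ l x ∂ν = d l * Z := by
      rw [hν, S.integral_sub (zg l).expGrowth (zθ l).expGrowth]
      change w l - u l = n / a * w l / Z * Z
      have := hwu l
      field_simp
      linarith
    rw [hν, S.integral_sub_const_sq (zt l).expGrowth, ← hν, h1, h2]
    ring
  have hle : ∑ l, ∫ x, (g l x - θ l x - d l) ^ 2 ∂ν ≤ 0 := by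
    have h1 : ∑ l, ∫ x, (g l x - θ l x - d l) ^ 2 ∂ν =
        ∑ l, ((∫ x, g l x * g l x ∂ν) - (∫ x, θ l x * g l x ∂ν) - d l ^ 2 * Z) := by
      simp only [hone, Finset.sum_sub_distrib, Finset.sum_add_distrib, ← Finset.mul_sum, hsum]
      ring
    rw [h1]
    refine Finset.sum_nonpos fun l _ => ?_
    have h2 : (∫ x, g l x * g l x ∂ν) - (∫ x, θ l x * g l x ∂ν) ≤ n * w l ^ 2 / Z / a := by
      rw [le_div_iff₀ ha, mul_comm]
      exact hP l
    have h3 : n * w l ^ 2 / Z / a ≤ d l ^ 2 * Z := by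
      have h4 : d l ^ 2 * Z - n * w l ^ 2 / Z / a = n * (n - a) * w l ^ 2 / (Z * a ^ 2) := by
        simp only [hd]
        field_simp
      have h5 : 0 ≤ n * (n - a) * w l ^ 2 / (Z * a ^ 2) :=
        div_nonneg (mul_nonneg (mul_nonneg (Nat.cast_nonneg n) (sub_nonneg.2 han)) (sq_nonneg _))
          (mul_pos hZ (pow_pos ha 2)).le
      linarith
    linarith
  refine ⟨d, fun x hx l => ?_⟩
  have hl : ∫ x, (g l x - θ l x - d l) ^ 2 ∂ν = 0 :=
    (Finset.sum_eq_zero_iff_of_nonneg fun l _ => integral_nonneg fun x => sq_nonneg _).1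
      (le_antisymm hle (Finset.sum_nonneg fun l _ => integral_nonneg fun x => sq_nonneg _)) l
      (Finset.mem_univ l)
  rw [integral_eq_zero_iff_of_nonneg (fun x => sq_nonneg _) (S.integrable (ztt l).expGrowth a)] at hl
  have hvol : ∀ᵐ x ∂(volume : Measure (E n)), (g l x - θ l x - d l) ^ 2 = 0 := S.ae_volume hl
  have heq := Measure.eqOn_open_of_ae_eq (μ := (volume : Measure (E n)))
    (f := fun x => (g l x - θ l x - d l) ^ 2) (g := fun _ => (0 : ℝ))
    (ae_restrict_of_ae hvol) isOpen_compl_singleton (ztt l).1 continuousOn_const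
  exact sub_eq_zero.1 (pow_eq_zero_iff two_ne_zero |>.1 (heq hx))

theorem gradient_eq {a : ℝ} (ha : 0 < a) (han : a ≤ n)
    (hdet : ∀ x ≠ 0, (halfSqHess H x).det = (H x / ‖x‖) ^ a) {x : E n} (hx : x ≠ 0) :
    gradient H x = (H x / ‖x‖ ^ 2) • x := by
  obtain ⟨d, hd⟩ := S.exists_inner_gradient_sub_eq ha han hdet
  have hdv : ∀ x ≠ 0, gradient H x - (H x / ‖x‖ ^ 2) • x = WithLp.toLp 2 d := fun x hx => by
    ext l
    have := hd x hx l
    simp only [EuclideanSpace.inner_single_right, conj_trivial, one_mul] at this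
    simp [← this]
    ring
  have hd0 : (WithLp.toLp 2 d : E n) = 0 := by
    by_contra h
    refine h (inner_self_eq_zero (𝕜 := ℝ).1 ?_)
    nth_rw 1 [← hdv _ h]
    rw [inner_sub_left, S.inner_gradient_self h, real_inner_smul_left, real_inner_self_eq_norm_sq,
      div_mul_cancel₀ _ (pow_ne_zero 2 (norm_ne_zero_iff.2 h)), sub_self]
  exact sub_eq_zero.1 ((hdv x hx).trans hd0)

theorem exists_eq_mul_norm (hn : 1 ≤ n) (hgrad : ∀ x ≠ 0, gradient H x = (H x / ‖x‖ ^ 2) • x) :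
    ∃ r, 0 < r ∧ ∀ x, H x = r * ‖x‖ := by
  have hder : ∀ x ≠ 0, HasFDerivAt (fun x => H x ^ 2 / ‖x‖ ^ 2) (0 : E n →L[ℝ] ℝ) x := by
    intro x hx
    have hnx : ‖x‖ ≠ 0 := norm_ne_zero_iff.2 hx
    have h1 := ((S.hasFDerivAt hx).pow 2).mul ((hasDerivAt_inv (pow_ne_zero 2 hnx)).comp_hasFDerivAt
      x (hasStrictFDerivAt_norm_sq x).hasFDerivAt)
    simp only [div_eq_mul_inv]
    refine h1.congr_fderiv ?_
    ext v
    simp [hgrad x hx]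
    field_simp
    ring
  have hpre : IsPreconnected ({(0 : E n)}ᶜ : Set (E n)) :=
    (isConnected_compl_singleton_of_one_lt_rank (by
      rw [← Module.finrank_eq_rank, finrank_euclideanSpace_fin]
      exact_mod_cast (by omega : 1 < n + 1)) 0).isPreconnected
  obtain ⟨y, hy⟩ := exists_ne (0 : E n)
  refine ⟨H y / ‖y‖, S.div_norm_pos hy, fun x => ?_⟩
  rcases eq_or_ne x 0 with rfl | hx
  · simp [S.zero]
  have hxy := isOpen_compl_singleton.is_const_of_fderiv_eq_zero (𝕜 := ℝ) hpre
    (fun z hz => (hder z hz).differentiableAt.differentiableWithinAt)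
    (fun z hz => (hder z hz).fderiv) (x := x) (y := y) hx hy
  simp only [← div_pow] at hxy
  have := (pow_left_inj₀ (S.div_norm_nonneg x) (S.div_norm_nonneg y) two_ne_zero).1 hxy
  rw [← this, div_mul_cancel₀ _ (norm_ne_zero_iff.2 hx)]

end IsSmoothSupport

theorem body_eq_closedBall {n : ℕ} {H : E n → ℝ} {r : ℝ} (hr : 0 < r) (hH : ∀ x, H x = r * ‖x‖) :
    body H = closedBall 0 r := by
  ext y
  rw [mem_closedBall_zero_iff]
  constructor
  · intro hy
    rcases eq_or_ne y 0 with rfl | hy0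
    · simpa using hr.le
    have h := hy (‖y‖⁻¹ • y) (inv_norm_smul_mem_sphere hy0)
    rw [hH, mem_sphere_zero_iff_norm.1 (inv_norm_smul_mem_sphere hy0), real_inner_smul_right,
      real_inner_self_eq_norm_sq, mul_one, pow_two, inv_mul_cancel_left₀ (norm_ne_zero_iff.2 hy0)] at h
    exact h
  · intro hy x hx
    rw [hH, mem_sphere_zero_iff_norm.1 hx, mul_one]
    refine (real_inner_le_norm y x).trans ?_
    rwa [mem_sphere_zero_iff_norm.1 hx, mul_one]

/-- Isotropic `L^p`-Minkowski problem for `p ∈ (-(n+1), -1]`: if `𝒦 = h^{1-p}`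
then the body is an origin-centred ball (no centroid assumption). -/
theorem stmt14 (n : ℕ) (p : ℝ) (hp₁ : -((n : ℝ) + 1) < p) (hp₂ : p ≤ -1)
    (H : E n → ℝ)
    (hhom : ∀ (t : ℝ) (x : E n), 0 < t → H (t • x) = t * H x)
    (hsmooth : ContDiffOn ℝ (⊤ : ℕ∞) H {(0 : E n)}ᶜ)
    (hpos : ∀ x ∈ sphere (0 : E n) 1, 0 < H x)
    (hconvex : ∀ x ∈ sphere (0 : E n) 1, ∀ v : E n, ⟪v, x⟫ = 0 → v ≠ 0 →
      0 < ⟪(hess H x) v, v⟫)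
    (hflow : ∀ x ∈ sphere (0 : E n) 1, (sigmaDet H x)⁻¹ = H x ^ (1 - p)) :
    ∃ r : ℝ, 0 < r ∧ body H = Metric.closedBall (0 : E n) r := by
  have S : IsSmoothSupport H := ⟨hhom, hsmooth, hpos, hconvex⟩
  have hn : 1 ≤ n := by
    have : (0 : ℝ) < n := by linarith
    exact_mod_cast this
  obtain ⟨r, hr, hH⟩ := S.exists_eq_mul_norm hn fun x hx =>
    S.gradient_eq (a := n + 1 + p) (by linarith) (by linarith)
      (fun x hx => S.det_halfSqHess hflow hx) hx
  exact ⟨r, hr, body_eq_closedBall hr hH⟩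

end
end

section
/- Let K ⊂ ℝ^{n+1} be a smooth, strictly convex body with the origin in its interior whose support function h satisfies 𝒦 = h^{n+2} on S^n (i.e. the case p = −(n+1)). Then K is an ellipsoid centred at the origin. -/
open MeasureTheory Metric
open scoped RealInnerProductSpace ENNReal

noncomputable section

section PuncturedCalculus

set_option linter.unusedSectionVars false

variable {ι : Type*} [Fintype ι]

/-- Smoothness on the complement of the origin. -/
abbrev SmoothOffZero (f : EuclideanSpace ℝ ι → ℝ) : Prop :=
  ContDiffOn ℝ (⊤ : ℕ∞) f {0}ᶜ

lemma SmoothOffZero.contDiffAt {f : EuclideanSpace ℝ ι → ℝ} (hf : SmoothOffZero f)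
    {x : EuclideanSpace ℝ ι} (hx : x ≠ 0) : ContDiffAt ℝ (⊤ : ℕ∞) f x :=
  ContDiffOn.contDiffAt hf (isOpen_compl_singleton.mem_nhds hx)

lemma SmoothOffZero.differentiableAt {f : EuclideanSpace ℝ ι → ℝ} (hf : SmoothOffZero f)
    {x : EuclideanSpace ℝ ι} (hx : x ≠ 0) : DifferentiableAt ℝ f x :=
  (hf.contDiffAt hx).differentiableAt (by simp)

/-- Entrywise smoothness of a matrix-valued function off the origin. -/
def MatSmoothOffZero (A : EuclideanSpace ℝ ι → Matrix ι ι ℝ) : Prop :=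
  ∀ i j, SmoothOffZero fun x => A x i j

lemma MatSmoothOffZero.mul {A B : EuclideanSpace ℝ ι → Matrix ι ι ℝ}
    (hA : MatSmoothOffZero A) (hB : MatSmoothOffZero B) :
    MatSmoothOffZero fun x => A x * B x := fun i j => by
  simp only [Matrix.mul_apply]
  exact ContDiffOn.sum fun k _ => (hA i k).mul (hB k j)

lemma smoothOffZero_coord (j : ι) :
    SmoothOffZero (fun y : EuclideanSpace ℝ ι => y j) :=
  (EuclideanSpace.proj j : EuclideanSpace ℝ ι →L[ℝ] ℝ).contDiff.contDiffOn

variable [DecidableEq ι]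

/-- The `i`-th partial derivative. -/
def partialDeriv (i : ι) (f : EuclideanSpace ℝ ι → ℝ) (x : EuclideanSpace ℝ ι) : ℝ :=
  fderiv ℝ f x (EuclideanSpace.single i 1)

lemma partialDeriv_congr {f g : EuclideanSpace ℝ ι → ℝ} (h : ∀ x ≠ 0, f x = g x) (i : ι)
    {x : EuclideanSpace ℝ ι} (hx : x ≠ 0) : partialDeriv i f x = partialDeriv i g x := by
  have : f =ᶠ[nhds x] g := by
    filter_upwards [isOpen_compl_singleton.mem_nhds hx] with y hy using h y hy
  rw [partialDeriv, this.fderiv_eq, partialDeriv]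

lemma SmoothOffZero.partialDeriv {f : EuclideanSpace ℝ ι → ℝ} (hf : SmoothOffZero f) (i : ι) :
    SmoothOffZero (partialDeriv i f) :=
  ((contDiffOn_infty_iff_fderiv_of_isOpen isOpen_compl_singleton).1 hf).2.clm_apply
    contDiffOn_const

lemma partialDeriv_const (i : ι) (c : ℝ) (x : EuclideanSpace ℝ ι) :
    partialDeriv i (fun _ => c) x = 0 := by
  simp [partialDeriv]

lemma partialDeriv_mul {f g : EuclideanSpace ℝ ι → ℝ} {x : EuclideanSpace ℝ ι}
    (hf : DifferentiableAt ℝ f x) (hg : DifferentiableAt ℝ g x) (i : ι) :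
    partialDeriv i (fun y => f y * g y) x =
      partialDeriv i f x * g x + f x * partialDeriv i g x := by
  simp only [partialDeriv, fderiv_fun_mul hf hg, add_apply, smul_apply, smul_eq_mul]
  ring

lemma partialDeriv_sum {κ : Type*} (s : Finset κ) {f : κ → EuclideanSpace ℝ ι → ℝ}
    {x : EuclideanSpace ℝ ι} (hf : ∀ k ∈ s, DifferentiableAt ℝ (f k) x) (i : ι) :
    partialDeriv i (fun y => ∑ k ∈ s, f k y) x = ∑ k ∈ s, partialDeriv i (f k) x := by
  simp [partialDeriv, fderiv_fun_sum hf]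

lemma partialDeriv_comm {f : EuclideanSpace ℝ ι → ℝ} (hf : SmoothOffZero f) (i j : ι)
    {x : EuclideanSpace ℝ ι} (hx : x ≠ 0) :
    partialDeriv i (partialDeriv j f) x = partialDeriv j (partialDeriv i f) x := by
  have hd : DifferentiableAt ℝ (fderiv ℝ f) x :=
    ((contDiffOn_infty_iff_fderiv_of_isOpen isOpen_compl_singleton).1 hf).2.differentiableOn
      (by simp) |>.differentiableAt (isOpen_compl_singleton.mem_nhds hx)
  have key (v w : EuclideanSpace ℝ ι) :
      fderiv ℝ (fun y => fderiv ℝ f y v) x w = fderiv ℝ (fderiv ℝ f) x w v := by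
    rw [fderiv_clm_apply hd (by fun_prop)]
    simp
  have hs : IsSymmSndFDerivAt ℝ f x :=
    (hf.contDiffAt hx).isSymmSndFDerivAt (by
      rw [minSmoothness_of_isRCLikeNormedField]; exact WithTop.coe_le_coe.2 (le_top : (2 : ℕ∞) ≤ ⊤))
  unfold partialDeriv
  rw [key, key, hs.eq]

lemma partialDeriv_coord (i j : ι) (x : EuclideanSpace ℝ ι) :
    partialDeriv i (fun y => y j) x = if i = j then 1 else 0 := by
  have : fderiv ℝ (fun y : EuclideanSpace ℝ ι => y j) x = EuclideanSpace.proj j :=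
    (EuclideanSpace.proj j : EuclideanSpace ℝ ι →L[ℝ] ℝ).hasFDerivAt.fderiv
  rw [partialDeriv, this]
  simp [eq_comm]

lemma fderiv_eq_sum_partialDeriv (f : EuclideanSpace ℝ ι → ℝ) (x v : EuclideanSpace ℝ ι) :
    fderiv ℝ f x v = ∑ i, v i * partialDeriv i f x := by
  conv_lhs => rw [← (EuclideanSpace.basisFun ι ℝ).sum_repr v]
  simp [partialDeriv]

/-- Euler's identity for functions homogeneous of degree `d`. -/
lemma euler_identity {f : EuclideanSpace ℝ ι → ℝ} (d : ℕ)
    (hhom : ∀ (t : ℝ) (x : EuclideanSpace ℝ ι), 0 < t → f (t • x) = t ^ d * f x)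
    {x : EuclideanSpace ℝ ι} (hf : DifferentiableAt ℝ f x) :
    ∑ i, x i * partialDeriv i f x = d * f x := by
  rw [← fderiv_eq_sum_partialDeriv]
  have h1 : HasDerivAt (fun t : ℝ => f (t • x)) (fderiv ℝ f x x) 1 := by
    have h : HasDerivAt (fun t : ℝ => t • x) x 1 := by
      simpa using (hasDerivAt_id (1 : ℝ)).smul_const x
    have hf' : HasFDerivAt f (fderiv ℝ f x) ((1 : ℝ) • x) := by simpa using hf.hasFDerivAt
    exact hf'.comp_hasDerivAt 1 h
  have h2 : HasDerivAt (fun t : ℝ => f (t • x)) (d * f x) 1 := by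
    have h := ((hasDerivAt_pow d (1 : ℝ)).mul_const (f x))
    simp only [one_pow, mul_one] at h
    refine h.congr_of_eventuallyEq ?_
    filter_upwards [lt_mem_nhds one_pos] with t ht using hhom t x ht
  exact h1.unique h2

/-- Differentiating Euler's identity lowers the degree by one. -/
lemma euler_identity_partialDeriv {f : EuclideanSpace ℝ ι → ℝ} (hf : SmoothOffZero f) {c : ℝ}
    (he : ∀ x ≠ 0, ∑ i, x i * partialDeriv i f x = c * f x) (k : ι)
    {x : EuclideanSpace ℝ ι} (hx : x ≠ 0) :
    ∑ i, x i * partialDeriv i (partialDeriv k f) x = (c - 1) * partialDeriv k f x := by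
  have h := partialDeriv_congr he k hx
  rw [partialDeriv_sum, partialDeriv_mul (by fun_prop) (hf.differentiableAt hx),
    partialDeriv_const] at h
  · have h' : ∀ i, partialDeriv k (fun y => y i * partialDeriv i f y) x =
        (if k = i then partialDeriv i f x else 0) + x i * partialDeriv i (partialDeriv k f) x := by
      intro i
      rw [partialDeriv_mul ((smoothOffZero_coord i).differentiableAt hx)
        ((hf.partialDeriv i).differentiableAt hx), partialDeriv_coord, partialDeriv_comm hf i k hx]
      simp
    simp only [h', Finset.sum_add_distrib, Finset.sum_ite_eq, Finset.mem_univ, if_true] at h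
    linarith
  · intro i _
    exact ((smoothOffZero_coord i).differentiableAt hx).mul
      ((hf.partialDeriv i).differentiableAt hx)

lemma partialDeriv_smul_arg {f : EuclideanSpace ℝ ι → ℝ} {d : ℕ}
    (hhom : ∀ (t : ℝ) (x : EuclideanSpace ℝ ι), 0 < t → f (t • x) = t ^ (d + 1) * f x)
    (i : ι) (t : ℝ) (x : EuclideanSpace ℝ ι) (ht : 0 < t) :
    partialDeriv i f (t • x) = t ^ d * partialDeriv i f x := by
  have h : (fun y => f (t • y)) = fun y => t ^ (d + 1) • f y := funext fun y => hhom t y ht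
  have h2 := congrArg (fun g => fderiv ℝ g x (EuclideanSpace.single i 1)) h
  simp only [fderiv_comp_smul] at h2
  rw [show (fun y => t ^ (d + 1) • f y) = t ^ (d + 1) • f from rfl,
    fderiv_const_smul_field] at h2
  simp only [Pi.smul_apply, smul_apply, smul_eq_mul] at h2
  unfold partialDeriv
  apply mul_left_cancel₀ ht.ne'
  rw [h2]; ring

/-- The entrywise `k`-th partial derivative of a matrix-valued function. -/
def matDeriv (k : ι) (A : EuclideanSpace ℝ ι → Matrix ι ι ℝ) (x : EuclideanSpace ℝ ι) :
    Matrix ι ι ℝ :=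
  Matrix.of fun i j => partialDeriv k (fun y => A y i j) x

lemma MatSmoothOffZero.matDeriv {A : EuclideanSpace ℝ ι → Matrix ι ι ℝ}
    (hA : MatSmoothOffZero A) (k : ι) : MatSmoothOffZero (matDeriv k A) :=
  fun i j => (hA i j).partialDeriv k

lemma MatSmoothOffZero.adjugate {A : EuclideanSpace ℝ ι → Matrix ι ι ℝ}
    (hA : MatSmoothOffZero A) : MatSmoothOffZero fun x => (A x).adjugate := fun i j => by
  simp only [Matrix.adjugate_apply, Matrix.det_apply]
  refine ContDiffOn.sum fun σ _ => ContDiffOn.const_smul _ (contDiffOn_prod fun k _ => ?_)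
  by_cases h : σ k = j
  · simp only [h, Matrix.updateRow_self]; exact contDiffOn_const
  · simp only [Matrix.updateRow_ne h]; exact hA _ _

lemma matDeriv_congr {A B : EuclideanSpace ℝ ι → Matrix ι ι ℝ} (h : ∀ x ≠ 0, A x = B x) (k : ι)
    {x : EuclideanSpace ℝ ι} (hx : x ≠ 0) : matDeriv k A x = matDeriv k B x := by
  ext i j
  exact partialDeriv_congr (fun y hy => by rw [h y hy]) k hx

lemma matDeriv_const (k : ι) (A : Matrix ι ι ℝ) (x : EuclideanSpace ℝ ι) :
    matDeriv k (fun _ => A) x = 0 := by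
  ext i j
  exact partialDeriv_const _ _ _

lemma matDeriv_mul {A B : EuclideanSpace ℝ ι → Matrix ι ι ℝ}
    (hA : MatSmoothOffZero A) (hB : MatSmoothOffZero B) (k : ι)
    {x : EuclideanSpace ℝ ι} (hx : x ≠ 0) :
    matDeriv k (fun y => A y * B y) x = matDeriv k A x * B x + A x * matDeriv k B x := by
  ext i j
  simp only [matDeriv, Matrix.of_apply, Matrix.mul_apply, Matrix.add_apply]
  rw [partialDeriv_sum, ← Finset.sum_add_distrib]
  · exact Finset.sum_congr rfl fun l _ => partialDeriv_mul
      ((hA i l).differentiableAt hx) ((hB l j).differentiableAt hx) k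
  · exact fun l _ => ((hA i l).differentiableAt hx).mul ((hB l j).differentiableAt hx)

lemma partialDeriv_trace {A : EuclideanSpace ℝ ι → Matrix ι ι ℝ} (hA : MatSmoothOffZero A)
    (k : ι) {x : EuclideanSpace ℝ ι} (hx : x ≠ 0) :
    partialDeriv k (fun y => (A y).trace) x = (matDeriv k A x).trace := by
  simp only [Matrix.trace, Matrix.diag, matDeriv, Matrix.of_apply]
  exact partialDeriv_sum _ (fun i _ => (hA i i).differentiableAt hx) k

/-- Jacobi's formula for a matrix function of unit determinant. -/
lemma trace_adjugate_mul_matDeriv {A : EuclideanSpace ℝ ι → Matrix ι ι ℝ}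
    (hA : MatSmoothOffZero A) (hdet : ∀ x ≠ 0, (A x).det = 1) (k : ι)
    {x : EuclideanSpace ℝ ι} (hx : x ≠ 0) :
    ((A x).adjugate * matDeriv k A x).trace = 0 := by
  have hD : Differentiable ℝ fun M : ι → ι → ℝ => (Matrix.of M).det := by
    simp only [Matrix.det_apply, Matrix.of_apply]
    fun_prop
  have hA' : HasFDerivAt (fun y => (fun i j => A y i j : ι → ι → ℝ))
      (ContinuousLinearMap.pi fun i => ContinuousLinearMap.pi fun j =>
        fderiv ℝ (fun y => A y i j) x) x :=
    hasFDerivAt_pi.2 fun i => hasFDerivAt_pi.2 fun j =>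
      ((hA i j).differentiableAt hx).hasFDerivAt
  have h0 : fderiv ℝ (fun M : ι → ι → ℝ => (Matrix.of M).det) (fun i j => A x i j)
      (fun i j => matDeriv k A x i j) = 0 := by
    have h := ((hD _).hasFDerivAt.comp x hA').fderiv
    have hc : ((fun M : ι → ι → ℝ => (Matrix.of M).det) ∘ fun y => (fun i j => A y i j))
        =ᶠ[nhds x] fun _ => 1 := by
      filter_upwards [isOpen_compl_singleton.mem_nhds hx] with y hy using hdet y hy
    rw [hc.fderiv_eq] at h
    have := DFunLike.congr_fun h (EuclideanSpace.single k 1)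
    simpa [matDeriv, partialDeriv] using this.symm
  have h1 : HasDerivAt (fun t : ℝ => (A x + t • matDeriv k A x).det) 0 0 := by
    have hl : HasDerivAt (fun t : ℝ => ((fun i j => A x i j : ι → ι → ℝ) +
        t • (fun i j => matDeriv k A x i j : ι → ι → ℝ))) (fun i j => matDeriv k A x i j) 0 := by
      simpa using ((hasDerivAt_id (0 : ℝ)).smul_const
        (fun i j => matDeriv k A x i j : ι → ι → ℝ)).const_add (fun i j => A x i j : ι → ι → ℝ)
    have hf := (hD ((fun i j => A x i j : ι → ι → ℝ) +
        (0 : ℝ) • (fun i j => matDeriv k A x i j : ι → ι → ℝ))).hasFDerivAt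
    have := hf.comp_hasDerivAt (0 : ℝ) hl
    simp only [zero_smul, add_zero, h0] at this
    exact this
  have h2 : HasDerivAt (fun t : ℝ => (A x + t • matDeriv k A x).det)
      ((A x).adjugate * matDeriv k A x).trace 0 := by
    set N := (A x).adjugate * matDeriv k A x
    have hfac : ∀ t : ℝ, (A x + t • matDeriv k A x).det = 1 + N.trace * t +
        ((Matrix.det (1 + (Polynomial.X : Polynomial ℝ) •
          N.map Polynomial.C)).divX.divX.eval t) * t ^ 2 := by
      intro t
      rw [← Matrix.det_one_add_smul, ← one_mul (Matrix.det (1 + t • N)), ← hdet x hx,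
        ← Matrix.det_mul]
      congr 1
      rw [mul_add, mul_one, Matrix.mul_smul, ← Matrix.mul_assoc, Matrix.mul_adjugate, hdet x hx,
        one_smul, Matrix.one_mul]
    simp only [hfac]
    have := (((hasDerivAt_id (0 : ℝ)).const_mul N.trace).const_add 1).add
      (((Matrix.det (1 + (Polynomial.X : Polynomial ℝ) •
          N.map Polynomial.C)).divX.divX.hasDerivAt 0).mul (hasDerivAt_pow 2 (0 : ℝ)))
    simp only [mul_one, zero_pow, ne_eq, OfNat.ofNat_ne_zero, not_false_eq_true, mul_zero,
      Nat.cast_ofNat, Nat.add_one_sub_one, pow_one, add_zero] at this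
    exact this
  exact h2.unique h1

end PuncturedCalculus

section Deicke

open scoped Matrix

variable {ι : Type*} [Fintype ι]

lemma Matrix.PosDef.trace_mul_symm_mul_symm_nonneg {P S : Matrix ι ι ℝ} (hP : P.PosDef)
    (hS : Sᵀ = S) : 0 ≤ (P * S * P * S).trace ∧ ((P * S * P * S).trace = 0 → S = 0) := by
  classical
  open scoped MatrixOrder in
  obtain ⟨B, hB⟩ := CStarAlgebra.nonneg_iff_eq_star_mul_self.mp hP.posSemidef.nonneg
  rw [Matrix.star_eq_conjTranspose] at hB
  have hBu : IsUnit B := by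
    rw [Matrix.isUnit_iff_isUnit_det, isUnit_iff_ne_zero]
    have := hP.det_pos.ne'
    rw [hB, Matrix.det_mul] at this
    exact right_ne_zero_of_mul this
  have hT : (B * S * Bᴴ)ᴴ = B * S * Bᴴ := by
    simp [Matrix.mul_assoc, hS]
  have htr : (P * S * P * S).trace = ((B * S * Bᴴ)ᴴ * (B * S * Bᴴ)).trace := by
    rw [hT, hB, Matrix.mul_assoc Bᴴ, Matrix.mul_assoc Bᴴ, Matrix.mul_assoc Bᴴ,
      Matrix.trace_mul_comm]
    simp only [Matrix.mul_assoc]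
  rw [htr]
  refine ⟨(Matrix.posSemidef_conjTranspose_mul_self _).trace_nonneg, fun h => ?_⟩
  rw [Matrix.trace_conjTranspose_mul_self_eq_zero_iff] at h
  have hBu' : IsUnit Bᴴ := hBu.star
  rwa [hBu'.mul_left_eq_zero, hBu.mul_right_eq_zero] at h

lemma contDiff_of_eq_zero_off_annulus {V : EuclideanSpace ℝ ι → ℝ} (hV : SmoothOffZero V)
    {r R : ℝ} (hr : 0 < r) (h0 : ∀ x, V x ≠ 0 → r ≤ ‖x‖ ∧ ‖x‖ ≤ R) :
    ContDiff ℝ (⊤ : ℕ∞) V ∧ HasCompactSupport V := by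
  have hsub : Function.support V ⊆ closedBall 0 R ∩ (ball 0 r)ᶜ := fun x hx => by
    simpa [and_comm] using h0 x hx
  have hcomp : IsCompact (closedBall (0 : EuclideanSpace ℝ ι) R ∩ (ball 0 r)ᶜ) :=
    (isCompact_closedBall 0 R).inter_right isOpen_ball.isClosed_compl
  have ht : tsupport V ⊆ closedBall 0 R ∩ (ball 0 r)ᶜ :=
    closure_minimal hsub hcomp.isClosed
  refine ⟨contDiff_iff_contDiffAt.2 fun x => ?_, hcomp.of_isClosed_subset isClosed_closure ht⟩
  by_cases hx : x = 0
  · have : V =ᶠ[nhds x] fun _ => 0 := by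
      refine notMem_tsupport_iff_eventuallyEq.1 fun h => ?_
      have := (ht h).2
      simp [hx, hr] at this
    exact contDiffAt_const.congr_of_eventuallyEq this
  · exact hV.contDiffAt hx

/-- A function positive off the origin and homogeneous of degree two is comparable with the squared
norm. -/
lemma exists_norm_sq_bounds {L : EuclideanSpace ℝ ι → ℝ} (hL : SmoothOffZero L)
    (hhom : ∀ (t : ℝ) (x : EuclideanSpace ℝ ι), 0 < t → L (t • x) = t ^ 2 * L x)
    (hpos : ∀ x ≠ 0, 0 < L x) [Nonempty ι] :
    ∃ m M : ℝ, 0 < m ∧ 0 < M ∧ ∀ x, m * ‖x‖ ^ 2 ≤ L x ∧ L x ≤ M * ‖x‖ ^ 2 := by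
  have hne : (sphere (0 : EuclideanSpace ℝ ι) 1).Nonempty :=
    NormedSpace.sphere_nonempty.2 zero_le_one
  have hcont : ContinuousOn L (sphere 0 1) :=
    hL.continuousOn.mono fun x hx => ne_zero_of_mem_unit_sphere ⟨x, hx⟩
  obtain ⟨a, ha, hamin⟩ := (isCompact_sphere 0 1).exists_isMinOn hne hcont
  obtain ⟨b, hb, hbmax⟩ := (isCompact_sphere 0 1).exists_isMaxOn hne hcont
  refine ⟨L a, L b, hpos a (ne_zero_of_mem_unit_sphere ⟨a, ha⟩),
    hpos b (ne_zero_of_mem_unit_sphere ⟨b, hb⟩), fun x => ?_⟩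
  by_cases hx : x = 0
  · have h0 : L 0 = 0 := by
      have := hhom 2 0 two_pos
      rw [smul_zero] at this
      linarith
    simp [hx, h0]
  · have hn : 0 < ‖x‖ := norm_pos_iff.2 hx
    have hs : ‖x‖⁻¹ • x ∈ sphere (0 : EuclideanSpace ℝ ι) 1 := by
      simp [norm_smul, hn.ne']
    have hLx : L x = L (‖x‖⁻¹ • x) * ‖x‖ ^ 2 := by
      rw [hhom _ _ (inv_pos.2 hn)]
      field_simp
    rw [hLx]
    exact ⟨mul_le_mul_of_nonneg_right (hamin hs) (sq_nonneg _),
      mul_le_mul_of_nonneg_right (hbmax hs) (sq_nonneg _)⟩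

variable [DecidableEq ι]

lemma integral_partialDeriv_eq_zero {V : EuclideanSpace ℝ ι → ℝ} (hV : ContDiff ℝ (⊤ : ℕ∞) V)
    (hc : HasCompactSupport V) (i : ι) : Integrable (partialDeriv i V) ∧
      ∫ x, partialDeriv i V x = 0 := by
  have hcont : Continuous (partialDeriv i V) :=
    (hV.continuous_fderiv (by simp)).clm_apply continuous_const
  have hint : Integrable (partialDeriv i V) :=
    hcont.integrable_of_hasCompactSupport (hc.fderiv_apply ℝ _)
  refine ⟨hint, ?_⟩
  have h := integral_mul_fderiv_eq_neg_fderiv_mul_of_integrable (μ := volume)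
    (f := fun _ : EuclideanSpace ℝ ι => (1 : ℝ)) (g := V) (v := EuclideanSpace.single i 1)
    (by simp) (by simp only [one_mul]; exact hint)
    (by simpa using hV.continuous.integrable_of_hasCompactSupport hc)
    (by fun_prop) (fun x _ => (hV.differentiable (by simp)).differentiableAt)
  simpa [partialDeriv] using h

/-- The Hessian matrix. -/
def hessMatrix (L : EuclideanSpace ℝ ι → ℝ) (x : EuclideanSpace ℝ ι) : Matrix ι ι ℝ :=
  Matrix.of fun i j => partialDeriv i (partialDeriv j L) x

variable {L : EuclideanSpace ℝ ι → ℝ}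

lemma matSmoothOffZero_hessMatrix (hL : SmoothOffZero L) : MatSmoothOffZero (hessMatrix L) :=
  fun i j => (hL.partialDeriv j).partialDeriv i

lemma hessMatrix_transpose (hL : SmoothOffZero L) {x : EuclideanSpace ℝ ι} (hx : x ≠ 0) :
    (hessMatrix L x)ᵀ = hessMatrix L x := by
  ext i j
  exact partialDeriv_comm hL j i hx

lemma matDeriv_hessMatrix_swap_left (hL : SmoothOffZero L) {x : EuclideanSpace ℝ ι} (hx : x ≠ 0)
    (i j k : ι) : matDeriv k (hessMatrix L) x i j = matDeriv i (hessMatrix L) x k j :=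
  partialDeriv_comm (hL.partialDeriv j) k i hx

lemma matDeriv_hessMatrix_transpose (hL : SmoothOffZero L) {x : EuclideanSpace ℝ ι} (hx : x ≠ 0)
    (k : ι) : (matDeriv k (hessMatrix L) x)ᵀ = matDeriv k (hessMatrix L) x := by
  ext i j
  exact partialDeriv_congr (fun y hy => partialDeriv_comm hL j i hy) k hx

lemma matDeriv_matDeriv_hessMatrix (hL : SmoothOffZero L) {x : EuclideanSpace ℝ ι} (hx : x ≠ 0)
    (i j k : ι) : matDeriv k (matDeriv k (hessMatrix L)) x j i =
      partialDeriv i (partialDeriv j (partialDeriv k (partialDeriv k L))) x := by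
  calc partialDeriv k (partialDeriv k (partialDeriv j (partialDeriv i L))) x
      = partialDeriv k (partialDeriv j (partialDeriv k (partialDeriv i L))) x :=
        partialDeriv_congr (fun y hy => partialDeriv_comm (hL.partialDeriv i) k j hy) k hx
    _ = partialDeriv j (partialDeriv k (partialDeriv k (partialDeriv i L))) x :=
        partialDeriv_comm ((hL.partialDeriv i).partialDeriv k) k j hx
    _ = partialDeriv j (partialDeriv k (partialDeriv i (partialDeriv k L))) x :=
        partialDeriv_congr (fun y hy => partialDeriv_congr
          (fun z hz => partialDeriv_comm hL k i hz) k hy) j hx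
    _ = partialDeriv j (partialDeriv i (partialDeriv k (partialDeriv k L))) x :=
        partialDeriv_congr (fun y hy => partialDeriv_comm (hL.partialDeriv k) k i hy) j hx
    _ = partialDeriv i (partialDeriv j (partialDeriv k (partialDeriv k L))) x :=
        partialDeriv_comm ((hL.partialDeriv k).partialDeriv k) j i hx

lemma matDeriv_adjugate_hessMatrix (hL : SmoothOffZero L)
    (hdet : ∀ x ≠ 0, (hessMatrix L x).det = 1) (k : ι) {x : EuclideanSpace ℝ ι} (hx : x ≠ 0) :
    matDeriv k (fun y => (hessMatrix L y).adjugate) x =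
      -((hessMatrix L x).adjugate * matDeriv k (hessMatrix L) x * (hessMatrix L x).adjugate) := by
  have hG := matSmoothOffZero_hessMatrix hL
  have h := matDeriv_congr (A := fun y => (hessMatrix L y).adjugate * hessMatrix L y)
    (B := fun _ => 1) (fun y hy => by rw [Matrix.adjugate_mul, hdet y hy, one_smul]) k hx
  rw [matDeriv_const, matDeriv_mul hG.adjugate hG k hx] at h
  have h2 := congrArg (· * (hessMatrix L x).adjugate) h
  simp only [Matrix.add_mul, Matrix.zero_mul] at h2
  rw [Matrix.mul_assoc _ (hessMatrix L x), Matrix.mul_adjugate, hdet x hx, one_smul,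
    Matrix.mul_one] at h2
  exact eq_neg_of_add_eq_zero_left h2

/-- The inverse Hessian is divergence free. -/
lemma sum_matDeriv_adjugate_hessMatrix (hL : SmoothOffZero L)
    (hdet : ∀ x ≠ 0, (hessMatrix L x).det = 1) (j : ι) {x : EuclideanSpace ℝ ι} (hx : x ≠ 0) :
    ∑ i, matDeriv i (fun y => (hessMatrix L y).adjugate) x i j = 0 := by
  simp only [matDeriv_adjugate_hessMatrix hL hdet _ hx, Matrix.neg_apply,
    Finset.sum_neg_distrib, neg_eq_zero]
  simp only [Matrix.mul_apply (M := _ * _)]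
  rw [Finset.sum_comm]
  refine Finset.sum_eq_zero fun b _ => ?_
  rw [← Finset.sum_mul]
  have h := trace_adjugate_mul_matDeriv (matSmoothOffZero_hessMatrix hL) hdet b hx
  have : ∑ i, ((hessMatrix L x).adjugate * matDeriv i (hessMatrix L) x) i b = 0 := by
    rw [← h]
    refine Finset.sum_congr rfl fun i _ => ?_
    rw [Matrix.diag_apply, Matrix.mul_apply, Matrix.mul_apply]
    refine Finset.sum_congr rfl fun a _ => ?_
    congr 1
    rw [← matDeriv_hessMatrix_swap_left hL hx, ← Matrix.transpose_apply
      (matDeriv a (hessMatrix L) x), matDeriv_hessMatrix_transpose hL hx]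
    exact matDeriv_hessMatrix_swap_left hL hx b i a
  rw [this, zero_mul]

/-- Twice differentiating `det = 1`. -/
lemma trace_adjugate_mul_matDeriv_matDeriv (hL : SmoothOffZero L)
    (hdet : ∀ x ≠ 0, (hessMatrix L x).det = 1) (k : ι) {x : EuclideanSpace ℝ ι} (hx : x ≠ 0) :
    ((hessMatrix L x).adjugate * matDeriv k (matDeriv k (hessMatrix L)) x).trace =
      ((hessMatrix L x).adjugate * matDeriv k (hessMatrix L) x *
        (hessMatrix L x).adjugate * matDeriv k (hessMatrix L) x).trace := by
  have hG := matSmoothOffZero_hessMatrix hL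
  have h := partialDeriv_congr
    (fun y hy => trace_adjugate_mul_matDeriv hG hdet k (x := y) hy) k hx
  rw [partialDeriv_const, partialDeriv_trace (hG.adjugate.mul (hG.matDeriv k)) k hx,
    matDeriv_mul hG.adjugate (hG.matDeriv k) k hx, matDeriv_adjugate_hessMatrix hL hdet k hx,
    Matrix.neg_mul, Matrix.trace_add, Matrix.trace_neg] at h
  linarith

/-- The divergence of `φ(L) • (D²L)⁻¹ ∇(∂ₖ∂ₖL)`. -/
lemma divergence_cutoff (hL : SmoothOffZero L)
    (hdet : ∀ x ≠ 0, (hessMatrix L x).det = 1) {φ : ℝ → ℝ} (hφ : ContDiff ℝ (⊤ : ℕ∞) φ)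
    (he : ∀ x ≠ 0, ∑ i, x i * partialDeriv i L x = 2 * L x) (k : ι)
    {x : EuclideanSpace ℝ ι} (hx : x ≠ 0) :
    ∑ i, partialDeriv i (fun y => φ (L y) * ∑ j, (hessMatrix L y).adjugate i j *
        partialDeriv j (partialDeriv k (partialDeriv k L)) y) x =
      φ (L x) * ((hessMatrix L x).adjugate * matDeriv k (hessMatrix L) x *
        (hessMatrix L x).adjugate * matDeriv k (hessMatrix L) x).trace := by
  have hG := matSmoothOffZero_hessMatrix hL
  set u := partialDeriv k (partialDeriv k L) with hu
  have hus : SmoothOffZero u := (hL.partialDeriv k).partialDeriv k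
  have hφL : SmoothOffZero fun y => φ (L y) := hφ.comp_contDiffOn hL
  have hPu (i j : ι) : SmoothOffZero fun y => (hessMatrix L y).adjugate i j * partialDeriv j u y :=
    (hG.adjugate i j).mul (hus.partialDeriv j)
  have hchain (i : ι) : partialDeriv i (fun y => φ (L y)) x =
      deriv φ (L x) * partialDeriv i L x := by
    have := ((hφ.differentiable (by simp)) (L x)).hasDerivAt.comp_hasFDerivAt x
      (hL.differentiableAt hx).hasFDerivAt
    simp [partialDeriv, show (fun y => φ (L y)) = φ ∘ L from rfl, this.fderiv]
  have hterm (i : ι) : partialDeriv i (fun y => φ (L y) * ∑ j, (hessMatrix L y).adjugate i j *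
        partialDeriv j u y) x =
      deriv φ (L x) * (partialDeriv i L x * ∑ j, (hessMatrix L x).adjugate i j *
        partialDeriv j u x) + φ (L x) *
      (∑ j, matDeriv i (fun y => (hessMatrix L y).adjugate) x i j * partialDeriv j u x +
        ∑ j, (hessMatrix L x).adjugate i j * partialDeriv i (partialDeriv j u) x) := by
    rw [partialDeriv_mul (hφL.differentiableAt hx)
      (DifferentiableAt.fun_sum fun j _ => (hPu i j).differentiableAt hx), hchain,
      partialDeriv_sum _ fun j _ => (hPu i j).differentiableAt hx, ← Finset.sum_add_distrib,
      mul_assoc]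
    congr 2
    refine Finset.sum_congr rfl fun j _ => ?_
    exact partialDeriv_mul ((hG.adjugate i j).differentiableAt hx)
      ((hus.partialDeriv j).differentiableAt hx) i
  have hflux : ∑ i, partialDeriv i L x * ∑ j, (hessMatrix L x).adjugate i j *
        partialDeriv j u x = 0 := by
    have e1 : ∀ y ≠ 0, ∀ l, ∑ i, y i * partialDeriv i (partialDeriv l L) y =
        1 * partialDeriv l L y := fun y hy l => by
      rw [euler_identity_partialDeriv hL he l hy]; norm_num
    have e3 : ∑ i, x i * partialDeriv i u x = 0 := by
      rw [hu, euler_identity_partialDeriv (hL.partialDeriv k) (fun y hy => e1 y hy k) k hx]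
      norm_num
    have hdL : (fun i => partialDeriv i L x) = x.ofLp ᵥ* hessMatrix L x := by
      funext l
      rw [← one_mul (partialDeriv l L x), ← e1 x hx l]
      rfl
    calc _ = (fun i => partialDeriv i L x) ⬝ᵥ
          ((hessMatrix L x).adjugate *ᵥ fun j => partialDeriv j u x) := rfl
      _ = x.ofLp ⬝ᵥ fun j => partialDeriv j u x := by
        rw [hdL, ← Matrix.dotProduct_mulVec, Matrix.mulVec_mulVec, Matrix.mul_adjugate,
          hdet x hx, one_smul, Matrix.one_mulVec]
      _ = 0 := e3
  have hdiv : ∑ i, ∑ j, matDeriv i (fun y => (hessMatrix L y).adjugate) x i j *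
      partialDeriv j u x = 0 := by
    rw [Finset.sum_comm]
    refine Finset.sum_eq_zero fun j _ => ?_
    rw [← Finset.sum_mul, sum_matDeriv_adjugate_hessMatrix hL hdet j hx, zero_mul]
  have htr : ∑ i, ∑ j, (hessMatrix L x).adjugate i j * partialDeriv i (partialDeriv j u) x =
      ((hessMatrix L x).adjugate * matDeriv k (matDeriv k (hessMatrix L)) x).trace := by
    refine Finset.sum_congr rfl fun i _ => ?_
    rw [Matrix.diag_apply, Matrix.mul_apply]
    exact Finset.sum_congr rfl fun j _ => by rw [matDeriv_matDeriv_hessMatrix hL hx]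
  simp only [hterm]
  rw [Finset.sum_add_distrib, ← Finset.mul_sum, ← Finset.mul_sum, Finset.sum_add_distrib,
    hflux, hdiv, htr, trace_adjugate_mul_matDeriv_matDeriv hL hdet k hx]
  ring

/-- **Deicke's theorem**: a positive function, homogeneous of degree two and smooth off the origin,
whose Hessian is positive definite of unit determinant, has constant Hessian. -/
theorem matDeriv_hessMatrix_eq_zero (hL : SmoothOffZero L)
    (hhom : ∀ (t : ℝ) (x : EuclideanSpace ℝ ι), 0 < t → L (t • x) = t ^ 2 * L x)
    (hpos : ∀ x ≠ 0, 0 < L x) (hposDef : ∀ x ≠ 0, (hessMatrix L x).PosDef)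
    (hdet : ∀ x ≠ 0, (hessMatrix L x).det = 1) (k : ι) {x₀ : EuclideanSpace ℝ ι}
    (hx₀ : x₀ ≠ 0) : matDeriv k (hessMatrix L) x₀ = 0 := by
  have : Nonempty ι := ⟨k⟩
  obtain ⟨m, M, hm, hM, hbd⟩ := exists_norm_sq_bounds hL hhom hpos
  have hc := hpos x₀ hx₀
  let φ : ContDiffBump (L x₀) := ⟨L x₀ / 4, L x₀ / 2, by positivity, by linarith⟩
  have hφ : ContDiff ℝ (⊤ : ℕ∞) φ := φ.contDiff
  have he : ∀ x ≠ 0, ∑ i, x i * partialDeriv i L x = 2 * L x := fun x hx => by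
    exact_mod_cast euler_identity 2 hhom (hL.differentiableAt hx)
  have hP : ∀ x ≠ 0, (hessMatrix L x).adjugate.PosDef := fun x hx => by
    have h := (hposDef x hx).inv
    rwa [Matrix.inv_def, hdet x hx, Ring.inverse_one, one_smul] at h
  set V : ι → EuclideanSpace ℝ ι → ℝ := fun i y => φ (L y) * ∑ j, (hessMatrix L y).adjugate i j *
    partialDeriv j (partialDeriv k (partialDeriv k L)) y with hVdef
  have hV (i : ι) : SmoothOffZero (V i) :=
    (hφ.comp_contDiffOn hL).mul (ContDiffOn.sum fun j _ =>
      ((matSmoothOffZero_hessMatrix hL).adjugate i j).mul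
        (((hL.partialDeriv k).partialDeriv k).partialDeriv j))
  have hsupp (i : ι) (x : EuclideanSpace ℝ ι) (hx : V i x ≠ 0) :
      √(L x₀ / 2 / M) ≤ ‖x‖ ∧ ‖x‖ ≤ √(3 * L x₀ / 2 / m) := by
    have h1 : φ (L x) ≠ 0 := left_ne_zero_of_mul hx
    have h2 : L x ∈ ball (L x₀) (L x₀ / 2) := by
      rw [← show φ.rOut = L x₀ / 2 from rfl, ← φ.support_eq]; exact h1
    rw [mem_ball, Real.dist_eq, abs_lt] at h2
    obtain ⟨h3, h4⟩ := hbd x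
    constructor
    · rw [Real.sqrt_le_left (norm_nonneg x), div_le_iff₀ hM]
      linarith
    · refine Real.le_sqrt_of_sq_le ?_
      rw [le_div_iff₀ hm]
      linarith
  have hr : 0 < √(L x₀ / 2 / M) := by positivity
  have hVs (i : ι) := contDiff_of_eq_zero_off_annulus (hV i) hr (hsupp i)
  have hpt : ∀ x ≠ 0, ∑ i, partialDeriv i (V i) x = φ (L x) *
      ((hessMatrix L x).adjugate * matDeriv k (hessMatrix L) x *
        (hessMatrix L x).adjugate * matDeriv k (hessMatrix L) x).trace :=
    fun x hx => divergence_cutoff hL hdet hφ he k hx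
  have hnonneg : 0 ≤ fun x => ∑ i, partialDeriv i (V i) x := by
    intro x
    by_cases hx : x = 0
    · refine (Finset.sum_eq_zero fun i _ => ?_).ge
      have : V i =ᶠ[nhds x] fun _ => 0 := by
        filter_upwards [ball_mem_nhds x hr] with y hy
        by_contra h
        have := (hsupp i y h).1
        rw [hx, mem_ball_zero_iff] at hy
        linarith
      rw [partialDeriv, this.fderiv_eq]
      simp
    · change 0 ≤ ∑ i, partialDeriv i (V i) x
      rw [hpt x hx]
      exact mul_nonneg φ.nonneg ((hP x hx).trace_mul_symm_mul_symm_nonneg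
        (matDeriv_hessMatrix_transpose hL hx k)).1
  have hcont : Continuous fun x => ∑ i, partialDeriv i (V i) x :=
    continuous_finsetSum _ fun i _ =>
      ((hVs i).1.continuous_fderiv (by simp)).clm_apply continuous_const
  have hint : ∫ x, ∑ i, partialDeriv i (V i) x = 0 := by
    rw [integral_finsetSum _ fun i _ => (integral_partialDeriv_eq_zero (hVs i).1 (hVs i).2 i).1]
    exact Finset.sum_eq_zero fun i _ => (integral_partialDeriv_eq_zero (hVs i).1 (hVs i).2 i).2
  have hintegrable : Integrable fun x => ∑ i, partialDeriv i (V i) x :=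
    integrable_finsetSum _ fun i _ => (integral_partialDeriv_eq_zero (hVs i).1 (hVs i).2 i).1
  have hzero : ∑ i, partialDeriv i (V i) x₀ = 0 := by
    by_contra h
    exact (integral_pos_of_integrable_nonneg_nonzero hcont hintegrable hnonneg h).ne' hint
  rw [hpt x₀ hx₀, φ.one_of_mem_closedBall (mem_closedBall_self φ.rIn_pos.le), one_mul] at hzero
  exact ((hP x₀ hx₀).trace_mul_symm_mul_symm_nonneg
    (matDeriv_hessMatrix_transpose hL hx₀ k)).2 hzero

end Deicke

section SupportFunction

open scoped Matrix

variable {ι : Type*} [Fintype ι]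

lemma Matrix.posDef_smul_add_vecMulVec {S : Matrix ι ι ℝ} {x p : ι → ℝ} {h : ℝ} (hS : Sᵀ = S)
    (hSx : S *ᵥ x = 0) (hx : x ⬝ᵥ x = 1) (hp : p ⬝ᵥ x = h) (hh : 0 < h)
    (hconv : ∀ v, v ⬝ᵥ x = 0 → v ≠ 0 → 0 < v ⬝ᵥ S *ᵥ v) :
    (h • S + vecMulVec p p).PosDef := by
  refine .of_dotProduct_mulVec_pos ?_ fun v hv => ?_
  · ext i j
    simp [vecMulVec_apply, ← congrFun₂ hS j i, mul_comm (p i)]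
  · have hxS : x ᵥ* S = 0 := by rw [← Matrix.mulVec_transpose, hS, hSx]
    set a := v ⬝ᵥ x with ha
    set w := v - a • x with hw
    have hwx : w ⬝ᵥ x = 0 := by simp [hw, sub_dotProduct, hx, ha]
    have hvw : v = w + a • x := by simp [hw]
    have hvS : v ⬝ᵥ S *ᵥ v = w ⬝ᵥ S *ᵥ w := by
      rw [hvw, Matrix.mulVec_add, Matrix.mulVec_smul, hSx, smul_zero, add_zero, add_dotProduct,
        smul_dotProduct, Matrix.dotProduct_mulVec x, hxS, zero_dotProduct, smul_zero, add_zero]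
    have hq : star v ⬝ᵥ (h • S + vecMulVec p p) *ᵥ v = h * (w ⬝ᵥ S *ᵥ w) + (p ⬝ᵥ v) ^ 2 := by
      rw [star_trivial, Matrix.add_mulVec, Matrix.smul_mulVec, vecMulVec_mulVec, dotProduct_add,
        dotProduct_smul, hvS]
      simp [dotProduct_comm v p, sq]
    rw [hq]
    by_cases hw0 : w = 0
    · have hva : v = a • x := by rw [hvw, hw0, zero_add]
      have ha0 : a ≠ 0 := fun h0 => hv (by rw [hva, h0, zero_smul])
      rw [hw0, hva, dotProduct_smul, hp]
      simp only [zero_dotProduct, mul_zero, zero_add, smul_eq_mul]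
      positivity
    · have := hconv w hwx hw0
      positivity

variable [DecidableEq ι]

lemma Matrix.det_one_add_vecMulVec (u v : ι → ℝ) : (1 + vecMulVec u v).det = 1 + v ⬝ᵥ u := by
  rw [vecMulVec_eq Unit, det_one_add_replicateCol_mul_replicateRow]

lemma Matrix.det_smul_add_vecMulVec {S : Matrix ι ι ℝ} {x p : ι → ℝ} {h : ℝ} (hS : Sᵀ = S)
    (hSx : S *ᵥ x = 0) (hx : x ⬝ᵥ x = 1) (hp : p ⬝ᵥ x = h) (hh : h ≠ 0) :
    (h • S + vecMulVec p p).det = h ^ (Fintype.card ι + 1) * (S + vecMulVec x x).det := by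
  have hxS : x ᵥ* S = 0 := by rw [← Matrix.mulVec_transpose, hS, hSx]
  have hfac : h • S + vecMulVec p p = (h • (1 + vecMulVec (h⁻¹ • p - x) x)) *
      (S + vecMulVec x x) * (1 + vecMulVec x (p - x)) := by
    have h1 : (h • (1 + vecMulVec (h⁻¹ • p - x) x)) * (S + vecMulVec x x) =
        h • S + vecMulVec p x := by
      rw [smul_mul_assoc, Matrix.add_mul, Matrix.one_mul, Matrix.mul_add, vecMulVec_mul, hxS,
        Matrix.mul_vecMulVec, vecMulVec_mulVec, hx]
      ext i j
      simp only [smul_apply, add_apply, vecMulVec_apply, Pi.sub_apply, Pi.smul_apply,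
        Pi.zero_apply, smul_eq_mul, MulOpposite.op_one, one_smul]
      field_simp
      ring
    rw [h1, Matrix.mul_add, Matrix.mul_one, Matrix.mul_vecMulVec, Matrix.add_mulVec,
      Matrix.smul_mulVec, hSx, vecMulVec_mulVec, hx]
    ext i j
    simp only [smul_apply, add_apply, vecMulVec_apply, Pi.sub_apply, Pi.add_apply, Pi.smul_apply,
      Pi.zero_apply, smul_eq_mul, MulOpposite.op_one, one_smul]
    ring
  rw [hfac, Matrix.det_mul, Matrix.det_mul, Matrix.det_smul, Matrix.det_one_add_vecMulVec,
    Matrix.det_one_add_vecMulVec, dotProduct_sub, dotProduct_smul, dotProduct_comm x p, hp, hx,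
    sub_dotProduct, hp, hx]
  simp only [smul_eq_mul]
  field_simp
  ring

lemma hessMatrix_half_sq {H : EuclideanSpace ℝ ι → ℝ} (hH : SmoothOffZero H)
    {x : EuclideanSpace ℝ ι} (hx : x ≠ 0) :
    hessMatrix (fun y => H y * H y * 2⁻¹) x = H x • hessMatrix H x +
      Matrix.vecMulVec (fun i => partialDeriv i H x) (fun i => partialDeriv i H x) := by
  have h1 (j : ι) : ∀ y ≠ 0, partialDeriv j (fun y => H y * H y * 2⁻¹) y =
      H y * partialDeriv j H y := fun y hy => by
    have hd := hH.differentiableAt hy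
    rw [partialDeriv_mul (hd.fun_mul hd) (by fun_prop), partialDeriv_mul hd hd, partialDeriv_const]
    ring
  ext i j
  have h2 : hessMatrix (fun y => H y * H y * 2⁻¹) x i j =
      partialDeriv i (fun y => H y * partialDeriv j H y) x := partialDeriv_congr (h1 j) i hx
  rw [h2, partialDeriv_mul (hH.differentiableAt hx) ((hH.partialDeriv j).differentiableAt hx)]
  simp [hessMatrix, Matrix.vecMulVec_apply, add_comm]

lemma hessMatrix_smul_arg {L : EuclideanSpace ℝ ι → ℝ}
    (hhom : ∀ (t : ℝ) (x : EuclideanSpace ℝ ι), 0 < t → L (t • x) = t ^ 2 * L x)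
    {t : ℝ} (ht : 0 < t) (x : EuclideanSpace ℝ ι) :
    hessMatrix L (t • x) = hessMatrix L x := by
  ext i j
  have := partialDeriv_smul_arg (d := 0)
    (fun s y hs => partialDeriv_smul_arg (d := 1) hhom j s y hs) i t x ht
  simpa [hessMatrix] using this

lemma two_mul_eq_dotProduct_hessMatrix {L : EuclideanSpace ℝ ι → ℝ} (hL : SmoothOffZero L)
    (hhom : ∀ (t : ℝ) (x : EuclideanSpace ℝ ι), 0 < t → L (t • x) = t ^ 2 * L x)
    {x : EuclideanSpace ℝ ι} (hx : x ≠ 0) :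
    2 * L x = x.ofLp ⬝ᵥ hessMatrix L x *ᵥ x.ofLp := by
  have he : ∀ y ≠ 0, ∑ i, y i * partialDeriv i L y = 2 * L y := fun y hy => by
    exact_mod_cast euler_identity 2 hhom (hL.differentiableAt hy)
  rw [← he x hx, Matrix.dotProduct_mulVec, dotProduct_comm]
  refine Finset.sum_congr rfl fun k _ => ?_
  have := euler_identity_partialDeriv hL he k hx
  rw [show (2 : ℝ) - 1 = 1 by norm_num, one_mul] at this
  rw [← this]
  rfl

variable {n : ℕ} {H : E n → ℝ}

lemma inner_hess_apply (hH : SmoothOffZero H) {x : E n} (hx : x ≠ 0) (v w : E n) :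
    ⟪hess H x v, w⟫ = v.ofLp ⬝ᵥ hessMatrix H x *ᵥ w.ofLp := by
  have hd : DifferentiableAt ℝ (gradient H) x := by
    have : DifferentiableAt ℝ (fderiv ℝ H) x :=
      ((contDiffOn_infty_iff_fderiv_of_isOpen isOpen_compl_singleton).1 hH).2.differentiableOn
        (by simp) |>.differentiableAt (isOpen_compl_singleton.mem_nhds hx)
    exact (InnerProductSpace.toDual ℝ (E n)).symm.toContinuousLinearEquiv.differentiableAt.comp
      x this
  have h1 : ⟪hess H x v, w⟫ = fderiv ℝ (fun y => ∑ j, w j * partialDeriv j H y) x v := by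
    have : (fun y => ∑ j, w j * partialDeriv j H y) = fun y => ⟪gradient H y, w⟫ := by
      funext y
      rw [← fderiv_eq_sum_partialDeriv, inner_gradient_left]
    rw [this, fderiv_inner_apply ℝ hd (differentiableAt_const w)]
    simp [hess]
  rw [h1, fderiv_eq_sum_partialDeriv]
  refine Finset.sum_congr rfl fun i _ => ?_
  rw [partialDeriv_sum _ fun j _ =>
    (differentiableAt_const (w j)).fun_mul ((hH.partialDeriv j).differentiableAt hx)]
  congr 1
  refine Finset.sum_congr rfl fun j _ => ?_
  rw [partialDeriv_mul (differentiableAt_const _) ((hH.partialDeriv j).differentiableAt hx),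
    partialDeriv_const, zero_mul, zero_add, mul_comm]
  rfl

lemma sigmaDet_eq_det (hH : SmoothOffZero H) {x : E n} (hx : x ≠ 0) :
    sigmaDet H x = (hessMatrix H x + Matrix.vecMulVec x.ofLp x.ofLp).det := by
  rw [sigmaDet, ← LinearMap.det_toMatrix (EuclideanSpace.basisFun (Fin (n + 1)) ℝ).toBasis,
    ← Matrix.det_transpose]
  congr 1
  ext i j
  have h1 : (hess H x (EuclideanSpace.single i 1)) j = hessMatrix H x i j := by
    have := inner_hess_apply hH hx (EuclideanSpace.single i 1) (EuclideanSpace.single j 1)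
    simpa [EuclideanSpace.inner_single_right] using this
  simp [LinearMap.toMatrix_apply, proj, h1, Matrix.vecMulVec_apply,
    EuclideanSpace.inner_single_right, mul_comm]

end SupportFunction

/-- Jörgens–Calabi–Pogorelov: if `𝒦 = h^{n+2}` on `S^n` then the body is an
origin-centred ellipsoid, i.e. `h(x) = √⟨Mx, x⟩` for a symmetric positive-definite
`M`. -/
theorem stmt15 (n : ℕ) (H : E n → ℝ)
    (hhom : ∀ (t : ℝ) (x : E n), 0 < t → H (t • x) = t * H x)
    (hsmooth : ContDiffOn ℝ (⊤ : ℕ∞) H {(0 : E n)}ᶜ)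
    (hpos : ∀ x ∈ sphere (0 : E n) 1, 0 < H x)
    (hconvex : ∀ x ∈ sphere (0 : E n) 1, ∀ v : E n, ⟪v, x⟫ = 0 → v ≠ 0 →
      0 < ⟪(hess H x) v, v⟫)
    (hflow : ∀ x ∈ sphere (0 : E n) 1, (sigmaDet H x)⁻¹ = H x ^ (n + 2)) :
    ∃ M : E n →L[ℝ] E n, (∀ x y : E n, ⟪M x, y⟫ = ⟪x, M y⟫) ∧
      (∀ x : E n, x ≠ 0 → 0 < ⟪M x, x⟫) ∧
      ∀ x ∈ sphere (0 : E n) 1, H x = Real.sqrt ⟪M x, x⟫ := by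
  have hne : ∀ x ∈ sphere (0 : E n) 1, x ≠ 0 := fun x hx => ne_zero_of_mem_unit_sphere ⟨x, hx⟩
  have hH : SmoothOffZero H := hsmooth
  set L : E n → ℝ := fun y => H y * H y * 2⁻¹ with hLdef
  have hL : SmoothOffZero L := (hH.mul hH).mul contDiffOn_const
  have hhomL (t : ℝ) (x : E n) (ht : 0 < t) : L (t • x) = t ^ 2 * L x := by
    simp only [hLdef, hhom t x ht]; ring
  have hscale (x : E n) (hx : x ≠ 0) : ∃ t : ℝ, 0 < t ∧ ∃ y ∈ sphere (0 : E n) 1, x = t • y := by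
    refine ⟨‖x‖, norm_pos_iff.2 hx, ‖x‖⁻¹ • x, ?_, ?_⟩
    · simp [norm_smul, hx]
    · rw [smul_smul, mul_inv_cancel₀ (norm_ne_zero_iff.2 hx), one_smul]
  have hposL (x : E n) (hx : x ≠ 0) : 0 < L x := by
    obtain ⟨t, ht, y, hy, rfl⟩ := hscale x hx
    have := hpos y hy
    simp only [hLdef, hhom t y ht]
    positivity
  have heH : ∀ x ≠ 0, ∑ i, x i * partialDeriv i H x = 1 * H x := fun x hx => by
    exact_mod_cast euler_identity 1 (by simpa using hhom) (hH.differentiableAt hx)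
  have hunit : ∀ x ∈ sphere (0 : E n) 1,
      (hessMatrix L x).PosDef ∧ (hessMatrix L x).det = 1 := by
    intro x hx
    have hx0 := hne x hx
    have hS := hessMatrix_transpose hH hx0
    have hSx : (hessMatrix H x).mulVec x.ofLp = 0 := by
      rw [← hS, Matrix.mulVec_transpose]
      funext k
      have := euler_identity_partialDeriv hH heH k hx0
      rw [sub_self, zero_mul] at this
      exact this
    have hxx : x.ofLp ⬝ᵥ x.ofLp = 1 := by
      have h := real_inner_self_eq_norm_sq x
      rw [mem_sphere_zero_iff_norm.1 hx, EuclideanSpace.inner_eq_star_dotProduct] at h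
      simpa using h
    have hp : (fun i => partialDeriv i H x) ⬝ᵥ x.ofLp = H x := by
      rw [dotProduct_comm, ← one_mul (H x), ← heH x hx0]; rfl
    have hHx := hpos x hx
    rw [hessMatrix_half_sq hH hx0]
    refine ⟨Matrix.posDef_smul_add_vecMulVec hS hSx hxx hp hHx fun v hv hv0 => ?_, ?_⟩
    · rw [← inner_hess_apply hH hx0 (WithLp.toLp 2 v) (WithLp.toLp 2 v)]
      refine hconvex x hx _ ?_ (by simpa using hv0)
      rw [EuclideanSpace.inner_eq_star_dotProduct, dotProduct_comm]
      simpa using hv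
    · rw [Matrix.det_smul_add_vecMulVec hS hSx hxx hp hHx.ne', ← sigmaDet_eq_det hH hx0,
        Fintype.card_fin, ← inv_inv (sigmaDet H x), hflow x hx]
      exact mul_inv_cancel₀ (pow_pos hHx _).ne'
  have hG (x : E n) (hx : x ≠ 0) : (hessMatrix L x).PosDef ∧ (hessMatrix L x).det = 1 := by
    obtain ⟨t, ht, y, hy, rfl⟩ := hscale x hx
    rw [hessMatrix_smul_arg hhomL ht]
    exact hunit y hy
  have hconst (x y : E n) (hx : x ≠ 0) (hy : y ≠ 0) : hessMatrix L x = hessMatrix L y := by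
    rcases Nat.eq_zero_or_pos n with rfl | hn
    · let _ : Unique (Fin (0 + 1)) := inferInstanceAs (Unique (Fin 1))
      have h := (hG x hx).2.trans (hG y hy).2.symm
      rw [Matrix.det_unique, Matrix.det_unique] at h
      ext i j
      rwa [Subsingleton.elim i default, Subsingleton.elim j default]
    · have hconn : IsPreconnected ({0}ᶜ : Set (E n)) :=
        (isConnected_compl_singleton_of_one_lt_rank (by
          rw [← Module.finrank_eq_rank, finrank_euclideanSpace_fin]
          exact_mod_cast Nat.succ_lt_succ hn) 0).isPreconnected
      ext i j
      refine isOpen_compl_singleton.is_const_of_fderiv_eq_zero (𝕜 := ℝ)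
        (f := fun z => hessMatrix L z i j) hconn
        ((matSmoothOffZero_hessMatrix hL i j).differentiableOn (by simp)) (fun z hz => ?_) hx hy
      ext v
      rw [fderiv_eq_sum_partialDeriv]
      refine Finset.sum_eq_zero fun k _ => ?_
      have := matDeriv_hessMatrix_eq_zero hL hhomL hposL (fun x hx => (hG x hx).1)
        (fun x hx => (hG x hx).2) k hz
      rw [show partialDeriv k (fun z => hessMatrix L z i j) z = 0 from congrFun₂ this i j,
        mul_zero]
  obtain ⟨x₀, hx₀⟩ := exists_ne (0 : E n)
  have hinner (x y : E n) : ⟪Matrix.toEuclideanCLM (𝕜 := ℝ) (hessMatrix L x₀) x, y⟫ =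
      y.ofLp ⬝ᵥ (hessMatrix L x₀).mulVec x.ofLp := by
    simp [EuclideanSpace.inner_eq_star_dotProduct]
  refine ⟨Matrix.toEuclideanCLM (𝕜 := ℝ) (hessMatrix L x₀), fun x y => ?_, fun x hx => ?_,
    fun x hx => ?_⟩
  · rw [hinner, real_inner_comm, hinner, Matrix.dotProduct_mulVec, dotProduct_comm,
      ← Matrix.mulVec_transpose, hessMatrix_transpose hL hx₀]
  · rw [hinner]
    simpa using (hG x₀ hx₀).1.dotProduct_mulVec_pos (x := x.ofLp) (by simpa using hx)
  · rw [hinner, hconst x₀ x hx₀ (hne x hx), ← two_mul_eq_dotProduct_hessMatrix hL hhomL (hne x hx),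
      eq_comm, ← Real.sqrt_sq (hpos x hx).le]
    congr 1
    simp only [hLdef]; ring

end
end
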